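/- Let n ≥ 4 be an integer, let p be a real number with 2n/(n−1) ≤ p < n, and let α be a real number with 1 < α ≤ n/(n−p). Set q = α(p−1)+1, δ = np − (n−p)q, θ = n(α−1)/(α(np − (αp+1−α)(n−p))), and GN(n,p,α) = ((q−p)/(p√π))^θ (pq/(n(q−p)))^{θ/p} (δ/(pq))^{1/(αp)} ( Γ(q(p−1)/(q−p)) Γ(n/2+1) / ( Γ(((p−1)/p)(δ/(q−p))) Γ(n(p−1)/p + 1) ) )^{θ/n}. Then for every smooth function u : ℝⁿ → ℝ with compact support contained in the open unit ball Bⁿ, writing dV = (2/(1−|x|²))ⁿ dx, one has ( ∫_{Bⁿ} |u|^{αp} dV )^{1/(αp)} ≤ GN(n,p,α) ( ∫_{Bⁿ} ((1−|x|²)/2)^p |∇u|^p dV − ((n−1)/p)^p ∫_{Bⁿ} |u|^p dV )^{θ/p} ( ∫_{Bⁿ} |u|^{α(p−1)+1} dV )^{(1−θ)/(α(p−1)+1)}. -/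

import Mathlib

open Real MeasureTheory

/-- The exponent `θ` in the Gagliardo–Nirenberg inequality for `α > 1`. -/
noncomputable def thetaGN (n : ℕ) (p α : ℝ) : ℝ :=
  (n : ℝ) * (α - 1) / (α * ((n : ℝ) * p - (α * p + 1 - α) * ((n : ℝ) - p)))

/-- The sharp constant `GN(n,p,α)` of Del Pino and Dolbeault, case `α > 1`. -/
noncomputable def gagliardoNirenbergConst (n : ℕ) (p α : ℝ) : ℝ :=
  let q : ℝ := α * (p - 1) + 1
  let δ : ℝ := (n : ℝ) * p - ((n : ℝ) - p) * q
  let θ : ℝ := thetaGN n p α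
  ((q - p) / (p * Real.sqrt π)) ^ θ * (p * q / ((n : ℝ) * (q - p))) ^ (θ / p) *
    (δ / (p * q)) ^ (1 / (α * p)) *
    ((Real.Gamma (q * (p - 1) / (q - p)) * Real.Gamma ((n : ℝ) / 2 + 1)) /
      (Real.Gamma ((p - 1) / p * (δ / (q - p))) * Real.Gamma ((n : ℝ) * (p - 1) / p + 1))) ^
      (θ / (n : ℝ))

section HyperbolicReflection

variable {V : Type*} [NormedAddCommGroup V]

lemma hypReflection_radius_sq {a : V} (ha : 1 < ‖a‖) : (√(‖a‖ ^ 2 - 1)) ^ 2 = ‖a‖ ^ 2 - 1 :=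
  Real.sq_sqrt (by nlinarith)

lemma hypReflection_radius_pos {a : V} (ha : 1 < ‖a‖) : 0 < √(‖a‖ ^ 2 - 1) :=
  Real.sqrt_pos.2 (by nlinarith)

lemma ne_center_of_norm_lt {a x : V} (ha : 1 < ‖a‖) (hx : ‖x‖ < 1) : x ≠ a := by
  rintro rfl; linarith

lemma norm_sub_center_pos {a x : V} (ha : 1 < ‖a‖) (hx : ‖x‖ < 1) : 0 < ‖x - a‖ :=
  norm_pos_iff.2 (sub_ne_zero.2 (ne_center_of_norm_lt ha hx))

/-- The square of `2 sinh (d(x, y) / 2)`, up to normalisation, in the ball model. -/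
noncomputable def hypDelta (x y : V) : ℝ := ‖x - y‖ ^ 2 / ((1 - ‖x‖ ^ 2) * (1 - ‖y‖ ^ 2))

lemma hypDelta_comm (x y : V) : hypDelta x y = hypDelta y x := by
  rw [hypDelta, hypDelta, norm_sub_rev, mul_comm (1 - ‖x‖ ^ 2)]

variable [InnerProductSpace ℝ V]

/-- The hyperbolic reflection of the ball model: inversion in the sphere with centre `a`
orthogonal to the unit sphere. -/
noncomputable def hypReflection (a : V) : V → V :=
  EuclideanGeometry.inversion a (√(‖a‖ ^ 2 - 1))

lemma hypReflection_involutive {a : V} (ha : 1 < ‖a‖) : Function.Involutive (hypReflection a) :=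
  EuclideanGeometry.inversion_involutive a (hypReflection_radius_pos ha).ne'

lemma hypReflection_apply {a : V} (ha : 1 < ‖a‖) (x : V) :
    hypReflection a x = ((‖a‖ ^ 2 - 1) / ‖x - a‖ ^ 2) • (x - a) + a := by
  simp [hypReflection, EuclideanGeometry.inversion_def, div_pow, hypReflection_radius_sq ha,
    dist_eq_norm]

lemma one_sub_norm_sq_hypReflection {a x : V} (ha : 1 < ‖a‖) (hx : x ≠ a) :
    1 - ‖hypReflection a x‖ ^ 2 = (1 - ‖x‖ ^ 2) * ((‖a‖ ^ 2 - 1) / ‖x - a‖ ^ 2) := by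
  have h0 : ‖x - a‖ ^ 2 ≠ 0 := by
    have := norm_pos_iff.2 (sub_ne_zero.2 hx); positivity
  rw [hypReflection_apply ha, norm_add_sq_real, norm_smul, mul_pow, Real.norm_eq_abs, sq_abs,
    real_inner_smul_left, inner_sub_left, real_inner_self_eq_norm_sq]
  have h1 : ‖x - a‖ ^ 2 = ‖x‖ ^ 2 - 2 * inner ℝ x a + ‖a‖ ^ 2 := norm_sub_sq_real x a
  have hc : (‖a‖ ^ 2 - 1) / ‖x - a‖ ^ 2 * ‖x - a‖ ^ 2 = ‖a‖ ^ 2 - 1 := div_mul_cancel₀ _ h0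
  set c := (‖a‖ ^ 2 - 1) / ‖x - a‖ ^ 2
  linear_combination (1 - c) * hc - c * h1

lemma norm_hypReflection_lt_one {a x : V} (ha : 1 < ‖a‖) (hx : ‖x‖ < 1) :
    ‖hypReflection a x‖ < 1 := by
  have h := one_sub_norm_sq_hypReflection ha (ne_center_of_norm_lt ha hx)
  have h1 := norm_sub_center_pos ha hx
  have h2 : 0 < (1 - ‖x‖ ^ 2) * ((‖a‖ ^ 2 - 1) / ‖x - a‖ ^ 2) := by
    have : 0 < 1 - ‖x‖ ^ 2 := by nlinarith [norm_nonneg x]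
    have : 0 < ‖a‖ ^ 2 - 1 := by nlinarith
    positivity
  nlinarith [norm_nonneg (hypReflection a x)]

/-- Inside the unit ball, the side of the mirror containing the origin consists of the points
moved away from the origin. -/
lemma norm_le_norm_hypReflection_iff {a x : V} (ha : 1 < ‖a‖) (hx : ‖x‖ < 1) :
    ‖x‖ ≤ ‖hypReflection a x‖ ↔ ‖a‖ ^ 2 - 1 ≤ ‖x - a‖ ^ 2 := by
  have h := one_sub_norm_sq_hypReflection ha (ne_center_of_norm_lt ha hx)
  have h1 := norm_sub_center_pos ha hx
  have h3 : 0 < 1 - ‖x‖ ^ 2 := by nlinarith [norm_nonneg x]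
  rw [← sq_le_sq₀ (norm_nonneg _) (norm_nonneg _)]
  have h4 : ‖hypReflection a x‖ ^ 2 = 1 - (1 - ‖x‖ ^ 2) * ((‖a‖ ^ 2 - 1) / ‖x - a‖ ^ 2) := by
    linarith
  rw [h4, ← div_le_one (by positivity : 0 < ‖x - a‖ ^ 2)]
  constructor <;> intro h5 <;> nlinarith

lemma norm_hypReflection_sub_sq {a x y : V} (ha : 1 < ‖a‖) (hx : x ≠ a) (hy : y ≠ a) :
    ‖hypReflection a x - hypReflection a y‖ ^ 2 =
      ((‖a‖ ^ 2 - 1) / ‖x - a‖ ^ 2) * ((‖a‖ ^ 2 - 1) / ‖y - a‖ ^ 2) * ‖x - y‖ ^ 2 := by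
  have h := EuclideanGeometry.dist_inversion_inversion hx hy (√(‖a‖ ^ 2 - 1))
  rw [hypReflection_radius_sq ha] at h
  simp only [dist_eq_norm] at h
  rw [hypReflection, h]
  have h1 := norm_pos_iff.2 (sub_ne_zero.2 hx)
  have h2 := norm_pos_iff.2 (sub_ne_zero.2 hy)
  field_simp

lemma hypDelta_hypReflection {a x y : V} (ha : 1 < ‖a‖) (hx : ‖x‖ < 1) (hy : ‖y‖ < 1) :
    hypDelta (hypReflection a x) (hypReflection a y) = hypDelta x y := by
  have hx' := ne_center_of_norm_lt ha hx
  have hy' := ne_center_of_norm_lt ha hy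
  rw [hypDelta, hypDelta, norm_hypReflection_sub_sq ha hx' hy',
    one_sub_norm_sq_hypReflection ha hx', one_sub_norm_sq_hypReflection ha hy']
  have h1 := norm_sub_center_pos ha hx
  have h2 := norm_sub_center_pos ha hy
  have h3 : 0 < 1 - ‖x‖ ^ 2 := by nlinarith [norm_nonneg x]
  have h4 : 0 < 1 - ‖y‖ ^ 2 := by nlinarith [norm_nonneg y]
  have h5 : 0 < ‖a‖ ^ 2 - 1 := by nlinarith
  field_simp

lemma hypDelta_hypReflection_right_le {a x y : V} (ha : 1 < ‖a‖) (hx : ‖x‖ < 1) (hy : ‖y‖ < 1)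
    (hxa : ‖a‖ ^ 2 - 1 ≤ ‖x - a‖ ^ 2) (hya : ‖y - a‖ ^ 2 ≤ ‖a‖ ^ 2 - 1) :
    hypDelta x (hypReflection a y) ≤ hypDelta x y := by
  have hy' := ne_center_of_norm_lt ha hy
  have h1 := norm_sub_center_pos ha hx
  have h2 := norm_sub_center_pos ha hy
  have h3 : 0 < 1 - ‖x‖ ^ 2 := by nlinarith [norm_nonneg x]
  have h4 : 0 < 1 - ‖y‖ ^ 2 := by nlinarith [norm_nonneg y]
  have h5 : 0 < ‖a‖ ^ 2 - 1 := by nlinarith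
  rw [hypDelta, hypDelta, one_sub_norm_sq_hypReflection ha hy']
  have e1 : x - hypReflection a y = (x - a) - ((‖a‖ ^ 2 - 1) / ‖y - a‖ ^ 2) • (y - a) := by
    rw [hypReflection_apply ha]; abel
  have e2 : x - y = (x - a) - (y - a) := by abel
  rw [e1, e2, norm_sub_sq_real, norm_sub_sq_real (x - a), norm_smul, mul_pow, Real.norm_eq_abs,
    sq_abs, real_inner_smul_right]
  set X := ‖x - a‖ ^ 2
  set Y := ‖y - a‖ ^ 2 with hY
  set s := ‖a‖ ^ 2 - 1
  set I := inner ℝ (x - a) (y - a)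
  have hYpos : 0 < Y := by positivity
  rw [div_le_div_iff₀ (by positivity) (by positivity)]
  have key : 0 ≤ (X - s) * (s - Y) := mul_nonneg (by linarith) (by linarith)
  have e3 : (X - 2 * (s / Y * I) + (s / Y) ^ 2 * Y) = (X * Y - 2 * s * I + s ^ 2) / Y := by
    field_simp
  rw [e3]
  have e4 : (X * Y - 2 * s * I + s ^ 2) / Y * ((1 - ‖x‖ ^ 2) * (1 - ‖y‖ ^ 2)) =
    (X * Y - 2 * s * I + s ^ 2) * ((1 - ‖x‖ ^ 2) * (1 - ‖y‖ ^ 2) / Y) := by ring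
  have e5 : (X - 2 * I + Y) * ((1 - ‖x‖ ^ 2) * ((1 - ‖y‖ ^ 2) * (s / Y))) =
    (X - 2 * I + Y) * s * ((1 - ‖x‖ ^ 2) * (1 - ‖y‖ ^ 2) / Y) := by ring
  rw [e4, e5]
  exact mul_le_mul_of_nonneg_right (by nlinarith) (by positivity)

/-- Two points of the ball at different distances from the origin are swapped by a hyperbolic
reflection. -/
lemma exists_hypReflection_eq {x y : V} (hxy : ‖x‖ < ‖y‖) (hy : ‖y‖ < 1) :
    ∃ a : V, 1 < ‖a‖ ∧ hypReflection a x = y := by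
  have hx : ‖x‖ < 1 := hxy.trans hy
  have h3 : 0 < 1 - ‖x‖ ^ 2 := by nlinarith [norm_nonneg x]
  have h4 : 0 < 1 - ‖y‖ ^ 2 := by nlinarith [norm_nonneg y]
  set τ := (1 - ‖y‖ ^ 2) / (1 - ‖x‖ ^ 2) with hτ
  have hτ0 : 0 < τ := by positivity
  have hτ1 : τ < 1 := by
    rw [hτ, div_lt_one h3]; nlinarith [norm_nonneg x]
  have hτ2 : τ * (1 - ‖x‖ ^ 2) = 1 - ‖y‖ ^ 2 := by rw [hτ]; field_simp
  have h1τ : 0 < 1 - τ := by linarith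
  clear_value τ
  set a : V := (1 - τ)⁻¹ • (y - τ • x) with ha
  have hxa : x - a = (1 - τ)⁻¹ • (x - y) := by
    have : x = (1 - τ)⁻¹ • ((1 - τ) • x) := by rw [smul_smul, inv_mul_cancel₀ h1τ.ne', one_smul]
    conv_lhs => rw [this]
    rw [ha, ← smul_sub]; congr 1; module
  have hya : y - a = τ • (x - a) := by
    have : y = (1 - τ)⁻¹ • ((1 - τ) • y) := by rw [smul_smul, inv_mul_cancel₀ h1τ.ne', one_smul]
    rw [hxa]
    conv_lhs => rw [this]
    rw [ha, ← smul_sub, smul_comm τ]; congr 1; module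
  have hne : x - y ≠ 0 := by rintro h; rw [sub_eq_zero.1 h] at hxy; exact lt_irrefl _ hxy
  have hpos : 0 < ‖x - y‖ := norm_pos_iff.2 hne
  have hkey : ‖a‖ ^ 2 - 1 = τ * ‖x - a‖ ^ 2 := by
    rw [hxa, ha, norm_smul, norm_smul, mul_pow, mul_pow, norm_sub_sq_real, norm_sub_sq_real,
      norm_smul, real_inner_smul_right, real_inner_comm, Real.norm_eq_abs, Real.norm_eq_abs,
      mul_pow, sq_abs, sq_abs]
    field_simp
    linear_combination (1 - τ) * hτ2
  have hxa' : 0 < ‖x - a‖ := by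
    rw [hxa, norm_smul, Real.norm_eq_abs]; positivity
  have ha1 : 1 < ‖a‖ := by
    have : 0 < τ * ‖x - a‖ ^ 2 := by positivity
    nlinarith [norm_nonneg a]
  refine ⟨a, ha1, ?_⟩
  rw [hypReflection_apply ha1, hkey, mul_div_assoc, div_self (by positivity), mul_one, ← hya]
  abel

end HyperbolicReflection

section HyperbolicVolume

variable {n : ℕ}

/-- The volume measure of hyperbolic space in the ball model. -/
noncomputable def hypVolume (n : ℕ) : Measure (EuclideanSpace ℝ (Fin n)) :=
  (volume.restrict (Metric.ball 0 1)).withDensity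
    (fun x => ENNReal.ofReal ((2 / (1 - ‖x‖ ^ 2)) ^ (n : ℝ)))

lemma measurable_hypDensity : Measurable
    (fun x : EuclideanSpace ℝ (Fin n) => (2 / (1 - ‖x‖ ^ 2)) ^ (n : ℝ)) := by
  fun_prop

lemma hypDensity_pos {x : EuclideanSpace ℝ (Fin n)} (hx : ‖x‖ < 1) :
    0 < (2 / (1 - ‖x‖ ^ 2)) ^ (n : ℝ) := by
  have : 0 < 1 - ‖x‖ ^ 2 := by nlinarith [norm_nonneg x]
  positivity

lemma integral_hypVolume (f : EuclideanSpace ℝ (Fin n) → ℝ) :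
    ∫ x, f x ∂(hypVolume n) =
      ∫ x in Metric.ball (0 : EuclideanSpace ℝ (Fin n)) 1,
        f x * (2 / (1 - ‖x‖ ^ 2)) ^ (n : ℝ) := by
  rw [hypVolume, integral_withDensity_eq_integral_toReal_smul₀]
  · refine setIntegral_congr_fun Metric.isOpen_ball.measurableSet fun x hx => ?_
    have hx' : ‖x‖ < 1 := by simpa using hx
    simp only [smul_eq_mul]
    rw [ENNReal.toReal_ofReal (hypDensity_pos hx').le, mul_comm]
  · exact measurable_hypDensity.ennreal_ofReal.aemeasurable
  · exact Filter.Eventually.of_forall fun x => ENNReal.ofReal_lt_top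

lemma hypVolume_absolutelyContinuous : hypVolume n ≪ volume :=
  (withDensity_absolutelyContinuous _ _).trans Measure.absolutelyContinuous_restrict

lemma ae_hypVolume_norm_lt_one : ∀ᵐ x ∂(hypVolume n), ‖x‖ < 1 := by
  refine (withDensity_absolutelyContinuous _ _).ae_le ?_
  filter_upwards [ae_restrict_mem Metric.isOpen_ball.measurableSet] with x hx
  simpa using hx

lemma hypVolume_closedBall_lt_top {R : ℝ} (hR : R < 1) :
    hypVolume n (Metric.closedBall 0 R) < ⊤ := by
  rw [hypVolume, withDensity_apply _ Metric.isClosed_closedBall.measurableSet,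
    Measure.restrict_restrict Metric.isClosed_closedBall.measurableSet]
  have hsub : Metric.closedBall (0 : EuclideanSpace ℝ (Fin n)) R ∩ Metric.ball 0 1 ⊆
      Metric.closedBall 0 R := Set.inter_subset_left
  refine (lintegral_mono_set hsub).trans_lt ?_
  refine (setLIntegral_mono (g := fun _ => ENNReal.ofReal ((2 / (1 - R ^ 2)) ^ (n : ℝ)))
    measurable_const fun x hx => ?_).trans_lt ?_
  · have hx' : ‖x‖ ≤ R := by simpa using hx
    have : 0 < 1 - R ^ 2 := by nlinarith [norm_nonneg x]
    have h2 : 1 - R ^ 2 ≤ 1 - ‖x‖ ^ 2 := by nlinarith [norm_nonneg x]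
    refine ENNReal.ofReal_le_ofReal (Real.rpow_le_rpow ?_ ?_ (by positivity))
    · have : 0 < 1 - ‖x‖ ^ 2 := by linarith
      positivity
    · exact div_le_div_of_nonneg_left (by norm_num) this h2
  · rw [setLIntegral_const]
    exact ENNReal.mul_lt_top ENNReal.ofReal_lt_top measure_closedBall_lt_top

lemma integrable_hypVolume {f : EuclideanSpace ℝ (Fin n) → ℝ} {R C : ℝ} (hR : R < 1)
    (hf : AEStronglyMeasurable f volume) (hC : ∀ᵐ x, |f x| ≤ C) (h0 : ∀ x, R < ‖x‖ → f x = 0) :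
    Integrable f (hypVolume n) := by
  have h1 : IntegrableOn f (Metric.closedBall 0 R) (hypVolume n) := by
    refine Measure.integrableOn_of_bounded (M := C) (hypVolume_closedBall_lt_top hR).ne
      (hf.mono_ac hypVolume_absolutelyContinuous) ?_
    refine ae_restrict_of_ae ?_
    filter_upwards [hypVolume_absolutelyContinuous.ae_le hC] with x hx
    simpa using hx
  refine (integrableOn_iff_integrable_of_support_subset fun x hx => ?_).1 h1
  by_contra h
  exact hx (h0 x (by simpa using h))

lemma abs_det_smul_reflection (c : ℝ) (K : Submodule ℝ (EuclideanSpace ℝ (Fin n))) :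
    |(c • (K.reflection : EuclideanSpace ℝ (Fin n) →L[ℝ] EuclideanSpace ℝ (Fin n))).det| =
      |c| ^ n := by
  have h1 : (c • (K.reflection : EuclideanSpace ℝ (Fin n) →L[ℝ] EuclideanSpace ℝ (Fin n))).det =
      c ^ n * LinearMap.det (K.reflection.toLinearEquiv : EuclideanSpace ℝ (Fin n) →ₗ[ℝ] _) := by
    have := LinearMap.det_smul c
      (K.reflection.toLinearEquiv : EuclideanSpace ℝ (Fin n) →ₗ[ℝ] EuclideanSpace ℝ (Fin n))
    rw [finrank_euclideanSpace_fin] at this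
    rw [← this]
    rfl
  rw [h1, Submodule.det_reflection, abs_mul, abs_pow, abs_pow, abs_neg, abs_one, one_pow, mul_one]

lemma hasFDerivAt_hypReflection {a x : EuclideanSpace ℝ (Fin n)} (ha : 1 < ‖a‖) (hx : x ≠ a) :
    HasFDerivAt (hypReflection a) (((‖a‖ ^ 2 - 1) / ‖x - a‖ ^ 2) •
      ((ℝ ∙ (x - a))ᗮ.reflection : EuclideanSpace ℝ (Fin n) →L[ℝ] EuclideanSpace ℝ (Fin n))) x := by
  have h := EuclideanGeometry.hasFDerivAt_inversion (R := √(‖a‖ ^ 2 - 1)) hx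
  rwa [div_pow, hypReflection_radius_sq ha, dist_eq_norm] at h

lemma measurable_hypReflection {a : EuclideanSpace ℝ (Fin n)} (ha : 1 < ‖a‖) :
    Measurable (hypReflection a) := by
  have : hypReflection a = fun x => ((‖a‖ ^ 2 - 1) / ‖x - a‖ ^ 2) • (x - a) + a :=
    funext (hypReflection_apply ha)
  rw [this]
  fun_prop

lemma hypDensity_hypReflection {a x : EuclideanSpace ℝ (Fin n)} (ha : 1 < ‖a‖) (hx : ‖x‖ < 1) :
    |(‖a‖ ^ 2 - 1) / ‖x - a‖ ^ 2| ^ n * (2 / (1 - ‖hypReflection a x‖ ^ 2)) ^ (n : ℝ) =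
      (2 / (1 - ‖x‖ ^ 2)) ^ (n : ℝ) := by
  have h1 := norm_sub_center_pos ha hx
  have h3 : 0 < 1 - ‖x‖ ^ 2 := by nlinarith [norm_nonneg x]
  have h5 : 0 < ‖a‖ ^ 2 - 1 := by nlinarith
  rw [one_sub_norm_sq_hypReflection ha (ne_center_of_norm_lt ha hx), Real.rpow_natCast,
    Real.rpow_natCast, ← mul_pow, abs_of_pos (by positivity)]
  congr 1
  field_simp

/-- Hyperbolic reflections preserve the hyperbolic volume. -/
lemma measurePreserving_hypReflection {a : EuclideanSpace ℝ (Fin n)} (ha : 1 < ‖a‖) :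
    MeasurePreserving (hypReflection a) (hypVolume n) (hypVolume n) := by
  have hm := measurable_hypReflection ha
  refine ⟨hm, Measure.ext fun s hs => ?_⟩
  rw [Measure.map_apply hm hs]
  have hball : MeasurableSet (Metric.ball (0 : EuclideanSpace ℝ (Fin n)) 1) :=
    Metric.isOpen_ball.measurableSet
  rw [hypVolume, withDensity_apply _ (hm hs), withDensity_apply _ hs,
    Measure.restrict_restrict (hm hs), Measure.restrict_restrict hs]
  have himg : hypReflection a ⁻¹' s ∩ Metric.ball 0 1 =
      hypReflection a '' (s ∩ Metric.ball 0 1) := by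
    ext x
    simp only [Set.mem_inter_iff, Set.mem_preimage, mem_ball_zero_iff, Set.mem_image]
    constructor
    · rintro ⟨h1, h2⟩
      exact ⟨hypReflection a x, ⟨h1, norm_hypReflection_lt_one ha h2⟩,
        hypReflection_involutive ha x⟩
    · rintro ⟨y, ⟨h1, h2⟩, rfl⟩
      rw [hypReflection_involutive ha y]
      exact ⟨h1, norm_hypReflection_lt_one ha h2⟩
  rw [himg, lintegral_image_eq_lintegral_abs_det_fderiv_mul volume (hs.inter hball)
    (fun x hx => (hasFDerivAt_hypReflection ha
      (ne_center_of_norm_lt ha (by simpa using hx.2))).hasFDerivWithinAt)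
    (hypReflection_involutive ha).injective.injOn]
  refine setLIntegral_congr_fun (hs.inter hball) fun x hx => ?_
  have hx' : ‖x‖ < 1 := by simpa using hx.2
  rw [abs_det_smul_reflection, ← ENNReal.ofReal_mul (by positivity),
    hypDensity_hypReflection ha hx']

lemma integral_comp_hypReflection {a : EuclideanSpace ℝ (Fin n)} (ha : 1 < ‖a‖)
    (f : EuclideanSpace ℝ (Fin n) → ℝ) :
    ∫ x, f (hypReflection a x) ∂(hypVolume n) = ∫ x, f x ∂(hypVolume n) := by
  let e : EuclideanSpace ℝ (Fin n) ≃ᵐ EuclideanSpace ℝ (Fin n) :=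
    { (hypReflection_involutive ha).toPerm with
      measurable_toFun := measurable_hypReflection ha
      measurable_invFun := measurable_hypReflection ha }
  exact MeasurePreserving.integral_comp (measurePreserving_hypReflection ha)
    e.measurableEmbedding f

/-- The norm of the hyperbolic gradient in the ball model. -/
noncomputable def hypGrad (v : EuclideanSpace ℝ (Fin n) → ℝ) (x : EuclideanSpace ℝ (Fin n)) : ℝ :=
  (1 - ‖x‖ ^ 2) / 2 * ‖fderiv ℝ v x‖

lemma norm_comp_smul_reflection (l : EuclideanSpace ℝ (Fin n) →L[ℝ] ℝ) {c : ℝ} (hc : 0 ≤ c)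
    (K : Submodule ℝ (EuclideanSpace ℝ (Fin n))) :
    ‖l.comp (c • (K.reflection : EuclideanSpace ℝ (Fin n) →L[ℝ] EuclideanSpace ℝ (Fin n)))‖ =
      c * ‖l‖ := by
  rw [ContinuousLinearMap.comp_smul, norm_smul, Real.norm_eq_abs, abs_of_nonneg hc]
  congr 1
  exact ContinuousLinearMap.opNorm_comp_linearIsometryEquiv l K.reflection

lemma hypGrad_comp_hypReflection {a x : EuclideanSpace ℝ (Fin n)} (ha : 1 < ‖a‖) (hx : ‖x‖ < 1)
    {v : EuclideanSpace ℝ (Fin n) → ℝ} (hv : DifferentiableAt ℝ v (hypReflection a x)) :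
    hypGrad (v ∘ hypReflection a) x = hypGrad v (hypReflection a x) := by
  have hxa := ne_center_of_norm_lt ha hx
  have h1 := norm_sub_center_pos ha hx
  have h5 : 0 < ‖a‖ ^ 2 - 1 := by nlinarith
  rw [hypGrad, hypGrad, (hv.hasFDerivAt.comp x (hasFDerivAt_hypReflection ha hxa)).fderiv,
    norm_comp_smul_reflection _ (by positivity), one_sub_norm_sq_hypReflection ha hxa]
  ring

end HyperbolicVolume

section Polarization

variable {n : ℕ}

/-- Nonnegative functions on the ball, supported in the ball of radius `R`, that are Lipschitz
for the hyperbolic distance. -/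
structure IsHypLip (R L : ℝ) (v : EuclideanSpace ℝ (Fin n) → ℝ) : Prop where
  nonneg : ∀ x, 0 ≤ v x
  eq_zero : ∀ x, R ≤ ‖x‖ → v x = 0
  sq_le : ∀ x y, ‖x‖ < 1 → ‖y‖ < 1 → (v x - v y) ^ 2 ≤ L * hypDelta x y

lemma dist_projection_le {V : Type*} [NormedAddCommGroup V] [InnerProductSpace ℝ V] {x y : V}
    {R : ℝ} (hR : 0 < R) (hx : ‖x‖ ≤ R) (hy : R ≤ ‖y‖) : ‖x - (R / ‖y‖) • y‖ ≤ ‖x - y‖ := by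
  have hy0 : 0 < ‖y‖ := hR.trans_le hy
  rw [← sq_le_sq₀ (norm_nonneg _) (norm_nonneg _), norm_sub_sq_real, norm_sub_sq_real, norm_smul,
    real_inner_smul_right, Real.norm_eq_abs, abs_of_pos (by positivity)]
  set c := R / ‖y‖ with hc
  have hc1 : c ≤ 1 := (div_le_one hy0).2 hy
  have hcy : c * ‖y‖ = R := by rw [hc]; field_simp
  have hI : inner ℝ x y ≤ R * ‖y‖ :=
    (real_inner_le_norm x y).trans (mul_le_mul_of_nonneg_right hx hy0.le)
  have h1 : 0 ≤ (1 - c) * (R * ‖y‖ - inner ℝ x y) := mul_nonneg (by linarith) (by linarith)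
  have h2 : 0 ≤ (1 - c) * (‖y‖ * (‖y‖ - R)) :=
    mul_nonneg (by linarith) (mul_nonneg hy0.le (by linarith))
  have h3 : c * ‖y‖ ^ 2 = R * ‖y‖ := by rw [← hcy]; ring
  rw [hcy]
  nlinarith

lemma IsHypLip.lipschitzWith {R L : ℝ} (hR0 : 0 < R) (hR : R < 1) (hL : 0 ≤ L)
    {v : EuclideanSpace ℝ (Fin n) → ℝ} (hv : IsHypLip R L v) :
    LipschitzWith (Real.toNNReal (√L / (1 - R ^ 2))) v := by
  have hR2 : 0 < 1 - R ^ 2 := by nlinarith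
  have hK : 0 ≤ √L / (1 - R ^ 2) := by positivity
  have main : ∀ x y : EuclideanSpace ℝ (Fin n), ‖x‖ ≤ R → ‖y‖ ≤ R →
      |v x - v y| ≤ √L / (1 - R ^ 2) * ‖x - y‖ := by
    intro x y hx hy
    refine abs_le_of_sq_le_sq ?_ (by positivity)
    refine (hv.sq_le x y (by linarith) (by linarith)).trans ?_
    have h1 : 1 - R ^ 2 ≤ 1 - ‖x‖ ^ 2 := by nlinarith [norm_nonneg x]
    have h2 : 1 - R ^ 2 ≤ 1 - ‖y‖ ^ 2 := by nlinarith [norm_nonneg y]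
    rw [mul_pow, div_pow, Real.sq_sqrt hL, div_mul_eq_mul_div, mul_div_assoc]
    refine mul_le_mul_of_nonneg_left ?_ hL
    rw [hypDelta]
    refine div_le_div_of_nonneg_left (by positivity) (by positivity) ?_
    rw [sq (1 - R ^ 2)]
    exact mul_le_mul h1 h2 hR2.le (hR2.le.trans h1)
  have main2 : ∀ x y : EuclideanSpace ℝ (Fin n), ‖x‖ ≤ R → R ≤ ‖y‖ →
      |v x - v y| ≤ √L / (1 - R ^ 2) * ‖x - y‖ := by
    intro x y hx hy
    have hy0 : 0 < ‖y‖ := hR0.trans_le hy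
    have hz : ‖(R / ‖y‖) • y‖ = R := by
      rw [norm_smul, Real.norm_eq_abs, abs_of_pos (by positivity)]; field_simp
    have h := main x ((R / ‖y‖) • y) hx hz.le
    rw [hv.eq_zero _ hz.ge, ← hv.eq_zero y hy] at h
    exact h.trans (mul_le_mul_of_nonneg_left (dist_projection_le hR0 hx hy) hK)
  refine LipschitzWith.of_dist_le_mul fun x y => ?_
  rw [Real.coe_toNNReal _ hK, Real.dist_eq, dist_eq_norm]
  rcases le_total ‖x‖ R with hx | hx <;> rcases le_total ‖y‖ R with hy | hy
  · exact main x y hx hy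
  · exact main2 x y hx hy
  · rw [abs_sub_comm, norm_sub_rev]; exact main2 y x hy hx
  · rw [hv.eq_zero x hx, hv.eq_zero y hy]; simp; positivity

/-- Two-point symmetrization with respect to a hyperbolic mirror. -/
noncomputable def polarization (a : EuclideanSpace ℝ (Fin n))
    (v : EuclideanSpace ℝ (Fin n) → ℝ) (x : EuclideanSpace ℝ (Fin n)) : ℝ :=
  if ‖x‖ ≤ ‖hypReflection a x‖ then max (v x) (v (hypReflection a x))
  else min (v x) (v (hypReflection a x))

lemma hypReflection_eq_self_of_norm_eq {a x : EuclideanSpace ℝ (Fin n)} (ha : 1 < ‖a‖)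
    (hx : ‖x‖ < 1) (h : ‖x‖ = ‖hypReflection a x‖) : hypReflection a x = x := by
  have h1 := one_sub_norm_sq_hypReflection ha (ne_center_of_norm_lt ha hx)
  have h3 : 0 < 1 - ‖x‖ ^ 2 := by nlinarith [norm_nonneg x]
  rw [← h] at h1
  have h4 : (‖a‖ ^ 2 - 1) / ‖x - a‖ ^ 2 = 1 := by
    have : (1 - ‖x‖ ^ 2) * ((‖a‖ ^ 2 - 1) / ‖x - a‖ ^ 2 - 1) = 0 := by linarith
    rcases mul_eq_zero.1 this with h | h <;> linarith
  rw [hypReflection_apply ha, h4, one_smul, sub_add_cancel]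

lemma polarization_cases {a x : EuclideanSpace ℝ (Fin n)} (ha : 1 < ‖a‖) (hx : ‖x‖ < 1)
    (v : EuclideanSpace ℝ (Fin n) → ℝ) :
    (polarization a v x = v x ∧
      polarization a v (hypReflection a x) = v (hypReflection a x)) ∨
    (polarization a v x = v (hypReflection a x) ∧
      polarization a v (hypReflection a x) = v x) := by
  unfold polarization
  rw [hypReflection_involutive ha x]
  rcases lt_trichotomy ‖x‖ ‖hypReflection a x‖ with h | h | h
  · rw [if_pos h.le, if_neg h.not_ge]
    rcases le_total (v x) (v (hypReflection a x)) with h' | h' <;> simp [h']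
  · simp [hypReflection_eq_self_of_norm_eq ha hx h]
  · rw [if_neg h.not_ge, if_pos h.le]
    rcases le_total (v x) (v (hypReflection a x)) with h' | h' <;> simp [h']

lemma polarization_two_point {a x : EuclideanSpace ℝ (Fin n)} (ha : 1 < ‖a‖) (hx : ‖x‖ < 1)
    (v : EuclideanSpace ℝ (Fin n) → ℝ) (Φ : ℝ → ℝ) :
    Φ (polarization a v x) + Φ (polarization a v (hypReflection a x)) =
      Φ (v x) + Φ (v (hypReflection a x)) := by
  rcases polarization_cases ha hx v with ⟨h1, h2⟩ | ⟨h1, h2⟩ <;> rw [h1, h2]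
  ring

/-- A function and its rearrangement whose values agree after summing over the two points
exchanged by a reflection have the same integral. -/
lemma integral_eq_of_two_point {a : EuclideanSpace ℝ (Fin n)} (ha : 1 < ‖a‖)
    {f g : EuclideanSpace ℝ (Fin n) → ℝ} (hf : Integrable f (hypVolume n))
    (hg : Integrable g (hypVolume n))
    (h : ∀ᵐ x ∂(hypVolume n), f x + f (hypReflection a x) = g x + g (hypReflection a x)) :
    ∫ x, f x ∂(hypVolume n) = ∫ x, g x ∂(hypVolume n) := by
  have hp := measurePreserving_hypReflection ha
  have h1 := integral_add hf (hp.integrable_comp_of_integrable hf)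
  have h2 := integral_add hg (hp.integrable_comp_of_integrable hg)
  simp only [Function.comp_apply] at h1 h2
  rw [integral_comp_hypReflection ha] at h1 h2
  have h3 := integral_congr_ae h
  linarith

lemma IsHypLip.abs_le (hn : 0 < n) {R L : ℝ} (hR0 : 0 < R) (hR : R < 1)
    {v : EuclideanSpace ℝ (Fin n) → ℝ} (hv : IsHypLip R L v)
    (x : EuclideanSpace ℝ (Fin n)) (hL : 0 ≤ L) : |v x| ≤ √L / (1 - R ^ 2) * 2 := by
  have hK : 0 ≤ √L / (1 - R ^ 2) := div_nonneg (by positivity) (by nlinarith)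
  have : Nonempty (Fin n) := ⟨⟨0, hn⟩⟩
  rcases le_total ‖x‖ R with hx | hx
  · obtain ⟨y, hy⟩ : ∃ y : EuclideanSpace ℝ (Fin n), ‖y‖ = R := by
      obtain ⟨y, hy⟩ := exists_norm_eq (EuclideanSpace ℝ (Fin n)) hR0.le
      exact ⟨y, hy⟩
    have h := (hv.lipschitzWith hR0 hR hL).dist_le_mul x y
    rw [hv.eq_zero y hy.ge, Real.dist_eq, sub_zero, Real.coe_toNNReal _ hK, dist_eq_norm] at h
    refine h.trans (mul_le_mul_of_nonneg_left ?_ hK)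
    exact (norm_sub_le x y).trans (by linarith)
  · rw [hv.eq_zero x hx]; simp; positivity

lemma sq_max_sub_max_le {a b c d K : ℝ} (h1 : (a - c) ^ 2 ≤ K) (h2 : (b - d) ^ 2 ≤ K) :
    (max a b - max c d) ^ 2 ≤ K := by
  have hK : 0 ≤ K := (sq_nonneg _).trans h1
  have := (abs_max_sub_max_le_max a b c d).trans
    (max_le (Real.abs_le_sqrt h1) (Real.abs_le_sqrt h2))
  rw [← Real.sq_sqrt hK, ← sq_abs]
  exact pow_le_pow_left₀ (abs_nonneg _) this 2

lemma sq_min_sub_min_le {a b c d K : ℝ} (h1 : (a - c) ^ 2 ≤ K) (h2 : (b - d) ^ 2 ≤ K) :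
    (min a b - min c d) ^ 2 ≤ K := by
  have hK : 0 ≤ K := (sq_nonneg _).trans h1
  have := (abs_min_sub_min_le_max a b c d).trans
    (max_le (Real.abs_le_sqrt h1) (Real.abs_le_sqrt h2))
  rw [← Real.sq_sqrt hK, ← sq_abs]
  exact pow_le_pow_left₀ (abs_nonneg _) this 2

lemma IsHypLip.polarization {R L : ℝ} (hL : 0 ≤ L) {v : EuclideanSpace ℝ (Fin n) → ℝ}
    (hv : IsHypLip R L v) {a : EuclideanSpace ℝ (Fin n)} (ha : 1 < ‖a‖) :
    IsHypLip R L (polarization a v) := by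
  refine ⟨fun x => ?_, fun x hx => ?_, ?_⟩
  · unfold _root_.polarization
    split_ifs
    · exact (hv.nonneg x).trans (le_max_left _ _)
    · exact le_min (hv.nonneg _) (hv.nonneg _)
  · unfold _root_.polarization
    split_ifs with h
    · rw [hv.eq_zero x hx, hv.eq_zero _ (hx.trans h), max_self]
    · rw [hv.eq_zero x hx, min_eq_left (hv.nonneg _)]
  · have opp : ∀ x y : EuclideanSpace ℝ (Fin n), ‖x‖ < 1 → ‖y‖ < 1 → ‖x‖ ≤ ‖hypReflection a x‖ →
        ¬ ‖y‖ ≤ ‖hypReflection a y‖ →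
        (_root_.polarization a v x - _root_.polarization a v y) ^ 2 ≤ L * hypDelta x y := by
      intro x y hx hy hxs hys
      have hσx := norm_hypReflection_lt_one ha hx
      have hσy := norm_hypReflection_lt_one ha hy
      have hle : hypDelta x (hypReflection a y) ≤ hypDelta x y :=
        hypDelta_hypReflection_right_le ha hx hy ((norm_le_norm_hypReflection_iff ha hx).1 hxs)
          (le_of_lt (not_le.1 fun h => hys ((norm_le_norm_hypReflection_iff ha hy).2 h)))
      have h11 := hv.sq_le x y hx hy
      have h12 := (hv.sq_le x _ hx hσy).trans (mul_le_mul_of_nonneg_left hle hL)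
      have h22 := hv.sq_le _ _ hσx hσy
      rw [hypDelta_hypReflection ha hx hy] at h22
      have h21 := hv.sq_le _ y hσx hy
      rw [← hypDelta_hypReflection ha hσx hy, hypReflection_involutive ha x] at h21
      have h21' := h21.trans (mul_le_mul_of_nonneg_left hle hL)
      unfold _root_.polarization
      rw [if_pos hxs, if_neg hys]
      rcases max_choice (v x) (v (hypReflection a x)) with h | h <;>
      rcases min_choice (v y) (v (hypReflection a y)) with h' | h' <;> rw [h, h'] <;> assumption
    intro x y hx hy
    have hσx := norm_hypReflection_lt_one ha hx
    have hσy := norm_hypReflection_lt_one ha hy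
    have h22 := hv.sq_le _ _ hσx hσy
    rw [hypDelta_hypReflection ha hx hy] at h22
    by_cases hxs : ‖x‖ ≤ ‖hypReflection a x‖ <;> by_cases hys : ‖y‖ ≤ ‖hypReflection a y‖
    · unfold _root_.polarization
      rw [if_pos hxs, if_pos hys]
      exact sq_max_sub_max_le (hv.sq_le x y hx hy) h22
    · exact opp x y hx hy hxs hys
    · have h := opp y x hy hx hys hxs
      rw [hypDelta_comm] at h
      calc _ = (_root_.polarization a v y - _root_.polarization a v x) ^ 2 := by ring
        _ ≤ _ := h
    · unfold _root_.polarization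
      rw [if_neg hxs, if_neg hys]
      exact sq_min_sub_min_le (hv.sq_le x y hx hy) h22

lemma IsHypLip.integrable_comp (hn : 0 < n) {R L : ℝ} (hR0 : 0 < R) (hR : R < 1) (hL : 0 ≤ L)
    {v : EuclideanSpace ℝ (Fin n) → ℝ} (hv : IsHypLip R L v) {Φ : ℝ → ℝ} (hΦ : Continuous Φ)
    (h0 : Φ 0 = 0) : Integrable (fun x => Φ (v x)) (hypVolume n) := by
  obtain ⟨C, hC⟩ := (isCompact_Icc (a := -(√L / (1 - R ^ 2) * 2))
    (b := √L / (1 - R ^ 2) * 2)).exists_bound_of_continuousOn hΦ.continuousOn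
  refine integrable_hypVolume (C := C) hR
    (hΦ.comp (hv.lipschitzWith hR0 hR hL).continuous).aestronglyMeasurable
    (Filter.Eventually.of_forall fun x => hC _ (_root_.abs_le.1 (hv.abs_le hn hR0 hR x hL)))
    fun x hx => ?_
  rw [hv.eq_zero x hx.le, h0]

lemma integral_comp_polarization (hn : 0 < n) {R L : ℝ} (hR0 : 0 < R) (hR : R < 1) (hL : 0 ≤ L)
    {v : EuclideanSpace ℝ (Fin n) → ℝ} (hv : IsHypLip R L v)
    {a : EuclideanSpace ℝ (Fin n)} (ha : 1 < ‖a‖) {Φ : ℝ → ℝ} (hΦ : Continuous Φ)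
    (h0 : Φ 0 = 0) :
    ∫ x, Φ (polarization a v x) ∂(hypVolume n) = ∫ x, Φ (v x) ∂(hypVolume n) := by
  refine integral_eq_of_two_point ha ((hv.polarization hL ha).integrable_comp hn hR0 hR hL hΦ h0)
    (hv.integrable_comp hn hR0 hR hL hΦ h0) ?_
  filter_upwards [ae_hypVolume_norm_lt_one] with x hx
  exact polarization_two_point ha hx v Φ

/-- The `p`-energy for the hyperbolic gradient. -/
noncomputable def hypEnergy (p : ℝ) (v : EuclideanSpace ℝ (Fin n) → ℝ) : ℝ :=
  ∫ x, hypGrad v x ^ p ∂(hypVolume n)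

lemma measurable_hypGrad (v : EuclideanSpace ℝ (Fin n) → ℝ) : Measurable (hypGrad v) := by
  unfold hypGrad
  have := measurable_fderiv ℝ v
  fun_prop

lemma hypGrad_eq_zero {v : EuclideanSpace ℝ (Fin n) → ℝ} {R : ℝ} (h0 : ∀ x, R ≤ ‖x‖ → v x = 0)
    {x : EuclideanSpace ℝ (Fin n)} (hx : R < ‖x‖) : hypGrad v x = 0 := by
  have h : v =ᶠ[nhds x] fun _ => 0 := by
    filter_upwards [continuous_norm.continuousAt.eventually_const_lt hx] with y hy
    exact h0 y hy.le
  rw [hypGrad, h.fderiv_eq]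
  simp

lemma IsHypLip.integrable_hypGrad_rpow {R L : ℝ} (hR0 : 0 < R) (hR : R < 1)
    (hL : 0 ≤ L) {v : EuclideanSpace ℝ (Fin n) → ℝ} (hv : IsHypLip R L v) {p : ℝ} (hp : 0 < p) :
    Integrable (fun x => hypGrad v x ^ p) (hypVolume n) := by
  have hlip := hv.lipschitzWith hR0 hR hL
  refine integrable_hypVolume (C := (Real.toNNReal (√L / (1 - R ^ 2)) : ℝ) ^ p) hR
    ((measurable_hypGrad v).pow_const p).aestronglyMeasurable
    (Filter.Eventually.of_forall fun x => ?_) fun x hx => ?_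
  · rcases le_or_gt ‖x‖ R with hx | hx
    · have h1 : 0 ≤ (1 - ‖x‖ ^ 2) / 2 := by nlinarith [norm_nonneg x]
      have h2 : (1 - ‖x‖ ^ 2) / 2 ≤ 1 := by nlinarith [norm_nonneg x]
      have h3 := norm_fderiv_le_of_lipschitz ℝ hlip (x₀ := x)
      have h4 : 0 ≤ hypGrad v x := mul_nonneg h1 (norm_nonneg _)
      rw [abs_of_nonneg (by positivity)]
      refine Real.rpow_le_rpow h4 ?_ hp.le
      exact (mul_le_mul h2 h3 (norm_nonneg _) zero_le_one).trans (one_mul _).le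
    · rw [hypGrad_eq_zero hv.eq_zero hx, Real.zero_rpow hp.ne', abs_zero]
      positivity
  · rw [hypGrad_eq_zero hv.eq_zero hx, Real.zero_rpow hp.ne']

lemma fderiv_max_min {V : Type*} [NormedAddCommGroup V] [NormedSpace ℝ V] {f g M m : V → ℝ} {x : V}
    (hf : DifferentiableAt ℝ f x) (hg : DifferentiableAt ℝ g x) (hM : DifferentiableAt ℝ M x)
    (hm : DifferentiableAt ℝ m x) (hMe : M =ᶠ[nhds x] fun y => max (f y) (g y))
    (hme : m =ᶠ[nhds x] fun y => min (f y) (g y)) :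
    (fderiv ℝ M x = fderiv ℝ f x ∧ fderiv ℝ m x = fderiv ℝ g x) ∨
      (fderiv ℝ M x = fderiv ℝ g x ∧ fderiv ℝ m x = fderiv ℝ f x) := by
  have touch : ∀ {u w : V → ℝ}, DifferentiableAt ℝ u x → DifferentiableAt ℝ w x → u x = w x →
      (∀ᶠ y in nhds x, w y ≤ u y) → fderiv ℝ u x = fderiv ℝ w x := by
    intro u w hu hw hx hle
    have hmin : IsLocalMin (fun y => u y - w y) x := by
      filter_upwards [hle] with y hy
      linarith
    have := hmin.fderiv_eq_zero
    rw [fderiv_fun_sub hu hw] at this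
    exact sub_eq_zero.1 this
  rcases lt_trichotomy (f x) (g x) with h | h | h
  · right
    have hev := hf.continuousAt.eventually_lt hg.continuousAt h
    constructor
    · refine Filter.EventuallyEq.fderiv_eq ?_
      filter_upwards [hev, hMe] with y h1 h2
      rw [h2, max_eq_right h1.le]
    · refine Filter.EventuallyEq.fderiv_eq ?_
      filter_upwards [hev, hme] with y h1 h2
      rw [h2, min_eq_left h1.le]
  · left
    have hMx := hMe.eq_of_nhds
    have hmx := hme.eq_of_nhds
    simp only [h, max_self, min_self] at hMx hmx
    constructor
    · refine touch hM hf (by rw [hMx, h]) ?_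
      filter_upwards [hMe] with y hy
      rw [hy]; exact le_max_left _ _
    · refine (touch hg hm (by rw [hmx]) ?_).symm
      filter_upwards [hme] with y hy
      rw [hy]; exact min_le_right _ _
  · left
    have hev := hg.continuousAt.eventually_lt hf.continuousAt h
    constructor
    · refine Filter.EventuallyEq.fderiv_eq ?_
      filter_upwards [hev, hMe] with y h1 h2
      rw [h2, max_eq_left h1.le]
    · refine Filter.EventuallyEq.fderiv_eq ?_
      filter_upwards [hev, hme] with y h1 h2
      rw [h2, min_eq_right h1.le]

end Polarization

section PolarizationEnergy

variable {n : ℕ}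

lemma hypGrad_polarization_two_point {a x : EuclideanSpace ℝ (Fin n)} (ha : 1 < ‖a‖)
    (hx : ‖x‖ < 1) (hlt : ‖x‖ < ‖hypReflection a x‖) {v : EuclideanSpace ℝ (Fin n) → ℝ}
    (hv : DifferentiableAt ℝ v x) (hv' : DifferentiableAt ℝ v (hypReflection a x))
    (hP : DifferentiableAt ℝ (polarization a v) x)
    (hP' : DifferentiableAt ℝ (polarization a v) (hypReflection a x)) (p : ℝ) :
    hypGrad (polarization a v) x ^ p + hypGrad (polarization a v) (hypReflection a x) ^ p =
      hypGrad v x ^ p + hypGrad v (hypReflection a x) ^ p := by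
  have hσ := hasFDerivAt_hypReflection ha (ne_center_of_norm_lt ha hx)
  have hev : ∀ᶠ y in nhds x, ‖y‖ < ‖hypReflection a y‖ :=
    continuous_norm.continuousAt.eventually_lt hσ.continuousAt.norm hlt
  have key := fderiv_max_min hv (hv'.comp x hσ.differentiableAt) hP
    (hP'.comp x hσ.differentiableAt)
    (by filter_upwards [hev] with y hy; simp [polarization, hy.le])
    (by
      filter_upwards [hev] with y hy
      simp only [Function.comp_apply, polarization]
      rw [hypReflection_involutive ha y, if_neg hy.not_ge, min_comm])
  rw [← hypGrad_comp_hypReflection ha hx hP', ← hypGrad_comp_hypReflection ha hx hv']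
  unfold hypGrad
  rcases key with ⟨h1, h2⟩ | ⟨h1, h2⟩ <;> rw [h1, h2]
  ring

lemma norm_ne_norm_hypReflection {a x : EuclideanSpace ℝ (Fin n)} (ha : 1 < ‖a‖)
    (hx : ‖x‖ < 1) (h : ‖x - a‖ ≠ √(‖a‖ ^ 2 - 1)) : ‖x‖ ≠ ‖hypReflection a x‖ := by
  intro heq
  apply h
  have h1 := one_sub_norm_sq_hypReflection ha (ne_center_of_norm_lt ha hx)
  have h2 := norm_sub_center_pos ha hx
  have h3 : 0 < 1 - ‖x‖ ^ 2 := by nlinarith [norm_nonneg x]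
  rw [← heq] at h1
  have h4 : (‖a‖ ^ 2 - 1) / ‖x - a‖ ^ 2 = 1 := by
    have : (1 - ‖x‖ ^ 2) * ((‖a‖ ^ 2 - 1) / ‖x - a‖ ^ 2 - 1) = 0 := by linarith
    rcases mul_eq_zero.1 this with h | h <;> linarith
  rw [div_eq_one_iff_eq (by positivity)] at h4
  rw [h4, Real.sqrt_sq h2.le]

lemma ae_hypVolume_norm_ne (hn : 0 < n) {a : EuclideanSpace ℝ (Fin n)} (ha : 1 < ‖a‖) :
    ∀ᵐ x ∂(hypVolume n), ‖x‖ ≠ ‖hypReflection a x‖ := by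
  have : Nonempty (Fin n) := ⟨⟨0, hn⟩⟩
  have h : ∀ᵐ x : EuclideanSpace ℝ (Fin n), ‖x - a‖ ≠ √(‖a‖ ^ 2 - 1) := by
    have := Measure.addHaar_sphere (volume : Measure (EuclideanSpace ℝ (Fin n))) a
      (√(‖a‖ ^ 2 - 1))
    filter_upwards [measure_eq_zero_iff_ae_notMem.1 this] with x hx
    simpa [dist_eq_norm] using hx
  filter_upwards [hypVolume_absolutelyContinuous.ae_le h, ae_hypVolume_norm_lt_one] with x h1 h2
  exact norm_ne_norm_hypReflection ha h2 h1

lemma hypEnergy_polarization (hn : 0 < n) {R L : ℝ} (hR0 : 0 < R) (hR : R < 1) (hL : 0 ≤ L)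
    {v : EuclideanSpace ℝ (Fin n) → ℝ} (hv : IsHypLip R L v)
    {a : EuclideanSpace ℝ (Fin n)} (ha : 1 < ‖a‖) {p : ℝ} (hp : 0 < p) :
    hypEnergy p (polarization a v) = hypEnergy p v := by
  have hpol := hv.polarization hL ha
  refine integral_eq_of_two_point ha (hpol.integrable_hypGrad_rpow hR0 hR hL hp)
    (hv.integrable_hypGrad_rpow hR0 hR hL hp) ?_
  have d1 := hypVolume_absolutelyContinuous.ae_le (hv.lipschitzWith hR0 hR hL).ae_differentiableAt
  have d2 := hypVolume_absolutelyContinuous.ae_le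
    (hpol.lipschitzWith hR0 hR hL).ae_differentiableAt
  have hq := (measurePreserving_hypReflection ha).quasiMeasurePreserving
  filter_upwards [d1, d2, hq.ae d1, hq.ae d2, ae_hypVolume_norm_ne hn ha,
    ae_hypVolume_norm_lt_one] with x h1 h2 h3 h4 h5 h6
  rcases lt_or_gt_of_ne h5 with h | h
  · exact hypGrad_polarization_two_point ha h6 h h1 h3 h2 h4 p
  · have hσσ := hypReflection_involutive ha x
    have := hypGrad_polarization_two_point ha (norm_hypReflection_lt_one ha h6)
      (by rwa [hσσ]) h3 (by rwa [hσσ]) h4 (by rwa [hσσ]) p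
    rw [hσσ] at this
    linarith

lemma hypVolume_pos_of_isOpen {U : Set (EuclideanSpace ℝ (Fin n))} (hU : IsOpen U)
    (hne : (U ∩ Metric.ball 0 1).Nonempty) : 0 < hypVolume n U := by
  refine pos_iff_ne_zero.2 fun h0 => ?_
  have hac : volume.restrict (Metric.ball (0 : EuclideanSpace ℝ (Fin n)) 1) ≪ hypVolume n := by
    refine withDensity_absolutelyContinuous' ?_ ?_
    · exact measurable_hypDensity.ennreal_ofReal.aemeasurable
    · filter_upwards [ae_restrict_mem Metric.isOpen_ball.measurableSet] with x hx
      have hx' : ‖x‖ < 1 := by simpa using hx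
      simpa using hypDensity_pos hx'
  have := hac h0
  rw [Measure.restrict_apply hU.measurableSet] at this
  exact ((hU.inter Metric.isOpen_ball).measure_pos volume hne).ne' this

/-- The functional that polarizations increase strictly. -/
noncomputable def hypMoment (v : EuclideanSpace ℝ (Fin n) → ℝ) : ℝ :=
  ∫ x, v x * (1 - ‖x‖ ^ 2) ∂(hypVolume n)

lemma IsHypLip.integrable_moment (hn : 0 < n) {R L : ℝ} (hR0 : 0 < R) (hR : R < 1) (hL : 0 ≤ L)
    {v : EuclideanSpace ℝ (Fin n) → ℝ} (hv : IsHypLip R L v) :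
    Integrable (fun x => v x * (1 - ‖x‖ ^ 2)) (hypVolume n) := by
  refine integrable_hypVolume (C := √L / (1 - R ^ 2) * 2) hR
    (((hv.lipschitzWith hR0 hR hL).continuous.mul (by fun_prop)).aestronglyMeasurable)
    (Filter.Eventually.of_forall fun x => ?_) fun x hx => by rw [hv.eq_zero x hx.le, zero_mul]
  rcases le_or_gt ‖x‖ R with hx | hx
  · rw [abs_mul]
    have h1 : |1 - ‖x‖ ^ 2| ≤ 1 := by
      rw [_root_.abs_le]; constructor <;> nlinarith [norm_nonneg x]
    exact (mul_le_mul (hv.abs_le hn hR0 hR x hL) h1 (abs_nonneg _)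
      ((abs_nonneg _).trans (hv.abs_le hn hR0 hR x hL))).trans (mul_one _).le
  · rw [hv.eq_zero x hx.le, zero_mul, abs_zero]
    exact (abs_nonneg _).trans (hv.abs_le hn hR0 hR x hL)

lemma polarization_moment_two_point {v : EuclideanSpace ℝ (Fin n) → ℝ}
    {a x : EuclideanSpace ℝ (Fin n)} (ha : 1 < ‖a‖) (hx : ‖x‖ < 1) :
    (polarization a v x * (1 - ‖x‖ ^ 2) - v x * (1 - ‖x‖ ^ 2)) +
      (polarization a v (hypReflection a x) * (1 - ‖hypReflection a x‖ ^ 2) -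
        v (hypReflection a x) * (1 - ‖hypReflection a x‖ ^ 2)) =
      (polarization a v x - v x) * (‖hypReflection a x‖ ^ 2 - ‖x‖ ^ 2) := by
  have := polarization_two_point ha hx v id
  simp only [id] at this
  linear_combination (1 - ‖hypReflection a x‖ ^ 2) * this

lemma polarization_sub_mul_nonneg (v : EuclideanSpace ℝ (Fin n) → ℝ)
    (a x : EuclideanSpace ℝ (Fin n)) :
    0 ≤ (polarization a v x - v x) * (‖hypReflection a x‖ ^ 2 - ‖x‖ ^ 2) := by
  rcases le_or_gt ‖x‖ ‖hypReflection a x‖ with h | h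
  · have : v x ≤ polarization a v x := by
      rw [polarization, if_pos h]; exact le_max_left _ _
    have h2 := pow_le_pow_left₀ (norm_nonneg x) h 2
    exact mul_nonneg (by linarith) (by linarith)
  · have : polarization a v x ≤ v x := by
      rw [polarization, if_neg h.not_ge]; exact min_le_left _ _
    have h2 := pow_le_pow_left₀ (norm_nonneg (hypReflection a x)) h.le 2
    exact mul_nonneg_of_nonpos_of_nonpos (by linarith) (by linarith)

lemma hypMoment_lt_polarization (hn : 0 < n) {R L : ℝ} (hR0 : 0 < R) (hR : R < 1) (hL : 0 ≤ L)
    {v : EuclideanSpace ℝ (Fin n) → ℝ} (hv : IsHypLip R L v)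
    {a x₀ : EuclideanSpace ℝ (Fin n)} (ha : 1 < ‖a‖) (hx₀ : ‖x₀‖ < 1)
    (hlt : ‖x₀‖ < ‖hypReflection a x₀‖) (hvlt : v x₀ < v (hypReflection a x₀)) :
    hypMoment v < hypMoment (polarization a v) := by
  have hpol := hv.polarization hL ha
  have hmp := measurePreserving_hypReflection ha
  have i1 := hv.integrable_moment hn hR0 hR hL
  have i2 := hpol.integrable_moment hn hR0 hR hL
  have hdiff := i2.sub i1
  have hdiffσ := hmp.integrable_comp_of_integrable hdiff
  have hsub := integral_sub i2 i1
  have hadd := integral_add hdiff hdiffσ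
  have hcomp := integral_comp_hypReflection ha
    (fun x => polarization a v x * (1 - ‖x‖ ^ 2) - v x * (1 - ‖x‖ ^ 2))
  have hinteg := hdiff.add hdiffσ
  simp only [Function.comp_apply, Pi.sub_apply] at hadd hinteg
  rw [hcomp, hsub] at hadd
  have heq : (fun x => (polarization a v x * (1 - ‖x‖ ^ 2) - v x * (1 - ‖x‖ ^ 2)) +
      (polarization a v (hypReflection a x) * (1 - ‖hypReflection a x‖ ^ 2) -
        v (hypReflection a x) * (1 - ‖hypReflection a x‖ ^ 2))) =ᵐ[hypVolume n]
      fun x => (polarization a v x - v x) * (‖hypReflection a x‖ ^ 2 - ‖x‖ ^ 2) := by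
    filter_upwards [ae_hypVolume_norm_lt_one] with x hx
    exact polarization_moment_two_point ha hx
  rw [integral_congr_ae heq] at hadd
  have hpos : 0 < ∫ x, (polarization a v x - v x) *
      (‖hypReflection a x‖ ^ 2 - ‖x‖ ^ 2) ∂(hypVolume n) := by
    rw [integral_pos_iff_support_of_nonneg (polarization_sub_mul_nonneg v a)
      ((integrable_congr heq).1 hinteg)]
    have hσ := (hasFDerivAt_hypReflection ha (ne_center_of_norm_lt ha hx₀)).continuousAt
    have hvc := (hv.lipschitzWith hR0 hR hL).continuous
    have hev : ∀ᶠ x in nhds x₀, ‖x‖ < ‖hypReflection a x‖ ∧ v x < v (hypReflection a x) :=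
      (continuous_norm.continuousAt.eventually_lt hσ.norm hlt).and
        (hvc.continuousAt.eventually_lt (ContinuousAt.comp hvc.continuousAt hσ) hvlt)
    obtain ⟨U, hUsub, hUo, hUx⟩ := eventually_nhds_iff.1 hev
    refine (hypVolume_pos_of_isOpen hUo ⟨x₀, hUx, by simpa using hx₀⟩).trans_le
      (measure_mono fun x hx => ?_)
    obtain ⟨h2, h3⟩ := hUsub x hx
    rw [Function.mem_support, polarization, if_pos h2.le, max_eq_right h3.le]
    have h4 := pow_lt_pow_left₀ h2 (norm_nonneg x) two_ne_zero
    exact (mul_pos (by linarith) (by linarith)).ne'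
  unfold hypMoment
  linarith

end PolarizationEnergy

section WeakConvergence

variable {n : ℕ}

lemma integrable_lineDeriv_mul {w : EuclideanSpace ℝ (Fin n) → ℝ} {K : NNReal}
    (hw : LipschitzWith K w) (e : EuclideanSpace ℝ (Fin n)) {Y : EuclideanSpace ℝ (Fin n) → ℝ}
    (hY : Integrable Y) : Integrable (fun x => lineDeriv ℝ w x e * Y x) :=
  hY.bdd_mul (measurable_lineDeriv hw.continuous).aestronglyMeasurable
    (Filter.Eventually.of_forall fun _ => norm_lineDeriv_le_of_lipschitz ℝ hw)

lemma abs_integral_lineDeriv_mul_le {w : EuclideanSpace ℝ (Fin n) → ℝ} {K : NNReal}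
    (hw : LipschitzWith K w) (e : EuclideanSpace ℝ (Fin n)) {Y : EuclideanSpace ℝ (Fin n) → ℝ}
    (hY : Integrable Y) :
    |∫ x, lineDeriv ℝ w x e * Y x| ≤ K * ‖e‖ * ∫ x, ‖Y x‖ := by
  rw [← integral_const_mul]
  have h := norm_integral_le_of_norm_le (f := fun x => lineDeriv ℝ w x e * Y x)
    (hY.norm.const_mul (K * ‖e‖)) (Filter.Eventually.of_forall fun x => ?_)
  · exact h
  rw [norm_mul]
  exact mul_le_mul_of_nonneg_right (norm_lineDeriv_le_of_lipschitz ℝ hw) (norm_nonneg _)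

lemma tendsto_integral_lineDeriv_mul_of_smooth {v : ℕ → EuclideanSpace ℝ (Fin n) → ℝ}
    {w : EuclideanSpace ℝ (Fin n) → ℝ} {K : NNReal} {C : ℝ} (hv : ∀ k, LipschitzWith K (v k))
    (hw : LipschitzWith K w) (hC : ∀ k x, |v k x| ≤ C)
    (hlim : ∀ x, Filter.Tendsto (fun k => v k x) Filter.atTop (nhds (w x)))
    (e : EuclideanSpace ℝ (Fin n)) {g : EuclideanSpace ℝ (Fin n) → ℝ}
    (hg : HasCompactSupport g) (hg' : ContDiff ℝ (⊤ : ℕ∞) g) :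
    Filter.Tendsto (fun k => ∫ x, lineDeriv ℝ (v k) x e * g x) Filter.atTop
      (nhds (∫ x, lineDeriv ℝ w x e * g x)) := by
  obtain ⟨D, hD⟩ := ContDiff.lipschitzWith_of_hasCompactSupport hg hg' (by simp)
  have heq : (fun x => lineDeriv ℝ g x (-e)) = fun x => fderiv ℝ g x (-e) := by
    ext x
    exact (hg'.differentiable (by simp) x).lineDeriv_eq_fderiv
  have hinteg : Integrable (fun x => lineDeriv ℝ g x (-e)) := by
    rw [heq]
    refine Continuous.integrable_of_hasCompactSupport ?_ (hg.fderiv_apply ℝ (-e))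
    exact (hg'.continuous_fderiv (by simp)).clm_apply continuous_const
  rw [hw.integral_lineDeriv_mul_eq hD hg e]
  simp_rw [fun k => (hv k).integral_lineDeriv_mul_eq (μ := volume) hD hg e]
  refine tendsto_integral_of_dominated_convergence (fun x => ‖lineDeriv ℝ g x (-e)‖ * C)
    (fun k => hinteg.aestronglyMeasurable.mul (hv k).continuous.aestronglyMeasurable)
    (hinteg.norm.mul_const C)
    (fun k => Filter.Eventually.of_forall fun x => ?_)
    (Filter.Eventually.of_forall fun x => (hlim x).const_mul _)
  rw [norm_mul]
  exact mul_le_mul_of_nonneg_left (hC k x) (norm_nonneg _)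

lemma tendsto_integral_lineDeriv_mul {v : ℕ → EuclideanSpace ℝ (Fin n) → ℝ}
    {w : EuclideanSpace ℝ (Fin n) → ℝ} {K : NNReal} {C : ℝ} (hv : ∀ k, LipschitzWith K (v k))
    (hw : LipschitzWith K w) (hC : ∀ k x, |v k x| ≤ C)
    (hlim : ∀ x, Filter.Tendsto (fun k => v k x) Filter.atTop (nhds (w x)))
    (e : EuclideanSpace ℝ (Fin n)) {Y : EuclideanSpace ℝ (Fin n) → ℝ} (hY : Integrable Y) :
    Filter.Tendsto (fun k => ∫ x, lineDeriv ℝ (v k) x e * Y x) Filter.atTop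
      (nhds (∫ x, lineDeriv ℝ w x e * Y x)) := by
  rw [Metric.tendsto_atTop]
  intro ε hε
  set A : ℝ := K * ‖e‖ + 1
  have hA : 0 < A := by positivity
  obtain ⟨g, hg, hg', hgY⟩ := MemLp.exist_eLpNorm_sub_le ENNReal.one_ne_top le_rfl
    (memLp_one_iff_integrable.2 hY) (ε := ε / (3 * A)) (by positivity)
  have hgi : Integrable g := hg'.continuous.integrable_of_hasCompactSupport hg
  have hd : Integrable (fun x => Y x - g x) := hY.sub hgi
  have hnorm : ∫ x, ‖Y x - g x‖ ≤ ε / (3 * A) := by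
    rw [integral_norm_eq_lintegral_enorm hd.aestronglyMeasurable]
    rw [eLpNorm_one_eq_lintegral_enorm] at hgY
    exact ENNReal.toReal_le_of_le_ofReal (by positivity) hgY
  have hsmall : ∀ {u : EuclideanSpace ℝ (Fin n) → ℝ}, LipschitzWith K u →
      |(∫ x, lineDeriv ℝ u x e * Y x) - ∫ x, lineDeriv ℝ u x e * g x| ≤ ε / 3 := by
    intro u hu
    rw [← integral_sub (integrable_lineDeriv_mul hu e hY) (integrable_lineDeriv_mul hu e hgi)]
    simp_rw [← mul_sub]
    refine (abs_integral_lineDeriv_mul_le hu e hd).trans ?_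
    calc (K : ℝ) * ‖e‖ * ∫ x, ‖Y x - g x‖ ≤ A * (ε / (3 * A)) :=
          mul_le_mul (by simp [A]) hnorm (by positivity) hA.le
      _ = ε / 3 := by field_simp
  obtain ⟨N, hN⟩ := Metric.tendsto_atTop.1
    (tendsto_integral_lineDeriv_mul_of_smooth hv hw hC hlim e hg hg') (ε / 3) (by positivity)
  refine ⟨N, fun k hk => ?_⟩
  have h1 := hN k hk
  have h2 := hsmall (hv k)
  have h3 := hsmall hw
  rw [Real.dist_eq] at h1 ⊢
  rw [abs_le] at h2 h3
  rw [abs_lt] at h1 ⊢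
  constructor <;> linarith

lemma integral_hypVolume_eq_indicator (f : EuclideanSpace ℝ (Fin n) → ℝ) :
    ∫ x, f x ∂(hypVolume n) = ∫ x, (Metric.ball (0 : EuclideanSpace ℝ (Fin n)) 1).indicator
      (fun x => f x * (2 / (1 - ‖x‖ ^ 2)) ^ (n : ℝ)) x := by
  rw [integral_hypVolume, integral_indicator Metric.isOpen_ball.measurableSet]

lemma integrable_indicator_of_hypVolume {f : EuclideanSpace ℝ (Fin n) → ℝ}
    (hf : Integrable f (hypVolume n)) :
    Integrable ((Metric.ball (0 : EuclideanSpace ℝ (Fin n)) 1).indicator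
      (fun x => f x * (2 / (1 - ‖x‖ ^ 2)) ^ (n : ℝ))) := by
  rw [integrable_indicator_iff Metric.isOpen_ball.measurableSet]
  rw [hypVolume, integrable_withDensity_iff_integrable_smul' measurable_hypDensity.ennreal_ofReal
    (by simp)] at hf
  refine hf.congr ?_
  filter_upwards [ae_restrict_mem Metric.isOpen_ball.measurableSet] with x hx
  have hx' : ‖x‖ < 1 := by simpa using hx
  rw [ENNReal.toReal_ofReal (hypDensity_pos hx').le, smul_eq_mul, mul_comm]

lemma tendsto_integral_hypVolume_fderiv_mul {v : ℕ → EuclideanSpace ℝ (Fin n) → ℝ}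
    {w : EuclideanSpace ℝ (Fin n) → ℝ} {K : NNReal} {C : ℝ} (hv : ∀ k, LipschitzWith K (v k))
    (hw : LipschitzWith K w) (hC : ∀ k x, |v k x| ≤ C)
    (hlim : ∀ x, Filter.Tendsto (fun k => v k x) Filter.atTop (nhds (w x)))
    (e : EuclideanSpace ℝ (Fin n)) {Y : EuclideanSpace ℝ (Fin n) → ℝ}
    (hY : Integrable Y (hypVolume n)) :
    Filter.Tendsto (fun k => ∫ x, fderiv ℝ (v k) x e * Y x ∂(hypVolume n)) Filter.atTop
      (nhds (∫ x, fderiv ℝ w x e * Y x ∂(hypVolume n))) := by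
  have h := tendsto_integral_lineDeriv_mul hv hw hC hlim e (integrable_indicator_of_hypVolume hY)
  have key : ∀ {u : EuclideanSpace ℝ (Fin n) → ℝ}, LipschitzWith K u →
      ∫ x, fderiv ℝ u x e * Y x ∂(hypVolume n) =
      ∫ x, lineDeriv ℝ u x e * (Metric.ball (0 : EuclideanSpace ℝ (Fin n)) 1).indicator
        (fun x => Y x * (2 / (1 - ‖x‖ ^ 2)) ^ (n : ℝ)) x := by
    intro u hu
    rw [integral_hypVolume_eq_indicator]
    refine integral_congr_ae ?_
    filter_upwards [hu.ae_differentiableAt (μ := volume)] with x hx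
    rw [hx.lineDeriv_eq_fderiv]
    by_cases hb : x ∈ Metric.ball (0 : EuclideanSpace ℝ (Fin n)) 1
    · rw [Set.indicator_of_mem hb, Set.indicator_of_mem hb, mul_assoc]
    · rw [Set.indicator_of_notMem hb, Set.indicator_of_notMem hb, mul_zero]
  rw [key hw]
  simp_rw [fun k => key (hv k)]
  exact h

lemma sum_apply_single_mul (a b : EuclideanSpace ℝ (Fin n) →L[ℝ] ℝ) :
    ∃ z : EuclideanSpace ℝ (Fin n), ‖z‖ = ‖b‖ ∧ a z = ∑ i, a (EuclideanSpace.single i 1) *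
      b (EuclideanSpace.single i 1) ∧ b z = ‖b‖ ^ 2 := by
  refine ⟨(InnerProductSpace.toDual ℝ _).symm b, LinearIsometryEquiv.norm_map _ _, ?_, ?_⟩
  · conv_lhs => rw [← (EuclideanSpace.basisFun (Fin n) ℝ).sum_repr'
      ((InnerProductSpace.toDual ℝ _).symm b)]
    rw [map_sum]
    refine Finset.sum_congr rfl fun i _ => ?_
    rw [map_smul, real_inner_comm, InnerProductSpace.toDual_symm_apply, smul_eq_mul, mul_comm,
      EuclideanSpace.basisFun_apply]
  · rw [← InnerProductSpace.toDual_symm_apply (𝕜 := ℝ) (y := b), real_inner_self_eq_norm_sq,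
      LinearIsometryEquiv.norm_map]

lemma sum_apply_single_mul_le (a b : EuclideanSpace ℝ (Fin n) →L[ℝ] ℝ) :
    ∑ i, a (EuclideanSpace.single i 1) * b (EuclideanSpace.single i 1) ≤ ‖a‖ * ‖b‖ := by
  obtain ⟨z, h1, h2, -⟩ := sum_apply_single_mul a b
  rw [← h2, ← h1]
  exact (le_abs_self _).trans (a.le_opNorm z)

lemma sum_apply_single_mul_self (b : EuclideanSpace ℝ (Fin n) →L[ℝ] ℝ) :
    ∑ i, b (EuclideanSpace.single i 1) * b (EuclideanSpace.single i 1) = ‖b‖ ^ 2 := by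
  obtain ⟨z, -, h2, h3⟩ := sum_apply_single_mul b b
  rw [← h2, h3]

lemma rpow_young {s t p : ℝ} (hs : 0 ≤ s) (ht : 0 ≤ t) (hp : 1 < p) :
    p * (s * t ^ (p - 1)) - (p - 1) * t ^ p ≤ s ^ p := by
  have hpq := Real.HolderConjugate.conjExponent hp
  have h := Real.young_inequality_of_nonneg hs (Real.rpow_nonneg ht (p - 1)) hpq
  have hp0 : 0 < p := by linarith
  have h1 : (p - 1) * (p / (p - 1)) = p := by
    have : p - 1 ≠ 0 := by linarith
    field_simp
  rw [Real.conjExponent, ← Real.rpow_mul ht, h1] at h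
  have h2 : p * (s ^ p / p + t ^ p / (p / (p - 1))) = s ^ p + (p - 1) * t ^ p := by
    have : p - 1 ≠ 0 := by linarith
    field_simp
  nlinarith [mul_le_mul_of_nonneg_left h hp0.le]

lemma norm_rpow_ge_tangent {a b : EuclideanSpace ℝ (Fin n) →L[ℝ] ℝ} {p : ℝ} (hp : 2 < p) :
    p * (‖b‖ ^ (p - 2) * ∑ i, a (EuclideanSpace.single i 1) * b (EuclideanSpace.single i 1))
      - (p - 1) * ‖b‖ ^ p ≤ ‖a‖ ^ p := by
  refine le_trans ?_ (rpow_young (norm_nonneg a) (norm_nonneg b) (by linarith : 1 < p))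
  have h1 : ‖b‖ ^ (p - 1) = ‖b‖ ^ (p - 2) * ‖b‖ := by
    rw [← Real.rpow_add_one' (norm_nonneg b) (by linarith)]; congr 1; ring
  have := mul_le_mul_of_nonneg_left (sum_apply_single_mul_le a b)
    (Real.rpow_nonneg (norm_nonneg b) (p - 2))
  rw [h1]
  nlinarith

end WeakConvergence

section LowerSemicontinuity

variable {n : ℕ}

lemma fderiv_eq_zero_of_radius_lt {v : EuclideanSpace ℝ (Fin n) → ℝ} {R : ℝ}
    (h0 : ∀ x, R ≤ ‖x‖ → v x = 0) {x : EuclideanSpace ℝ (Fin n)} (hx : R < ‖x‖) :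
    fderiv ℝ v x = 0 := by
  have h : v =ᶠ[nhds x] fun _ => 0 := by
    filter_upwards [continuous_norm.continuousAt.eventually_const_lt hx] with y hy
    exact h0 y hy.le
  rw [h.fderiv_eq]
  simp

/-- The coordinates of the vector field dual to `hypGrad w` in `L^p`. -/
noncomputable def hypDualField (p : ℝ) (w : EuclideanSpace ℝ (Fin n) → ℝ) (i : Fin n)
    (x : EuclideanSpace ℝ (Fin n)) : ℝ :=
  p * (((1 - ‖x‖ ^ 2) / 2) ^ p *
    (‖fderiv ℝ w x‖ ^ (p - 2) * fderiv ℝ w x (EuclideanSpace.single i 1)))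

lemma IsHypLip.integrable_dualField {R L : ℝ} (hR0 : 0 < R) (hR : R < 1) (hL : 0 ≤ L)
    {w : EuclideanSpace ℝ (Fin n) → ℝ} (hw : IsHypLip R L w) {p : ℝ} (hp : 2 < p) (i : Fin n) :
    Integrable (hypDualField p w i) (hypVolume n) := by
  set K := Real.toNNReal (√L / (1 - R ^ 2)) with hK
  have hlip := hw.lipschitzWith hR0 hR hL
  refine integrable_hypVolume (C := p * (1 * ((K : ℝ) ^ (p - 2) * (K * 1)))) hR ?_
    (Filter.Eventually.of_forall fun x => ?_) fun x hx => ?_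
  · unfold hypDualField
    have h1 := measurable_fderiv ℝ w
    have h2 := measurable_fderiv_apply_const ℝ w (EuclideanSpace.single i 1)
    exact (by fun_prop : Measurable _).aestronglyMeasurable
  · rcases le_or_gt ‖x‖ R with hx | hx
    · have h1 : 0 ≤ (1 - ‖x‖ ^ 2) / 2 := by nlinarith [norm_nonneg x]
      have h2 : (1 - ‖x‖ ^ 2) / 2 ≤ 1 := by nlinarith [norm_nonneg x]
      have h3 := norm_fderiv_le_of_lipschitz ℝ hlip (x₀ := x)
      have h4 : ‖fderiv ℝ w x (EuclideanSpace.single i 1)‖ ≤ K * 1 := by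
        refine (ContinuousLinearMap.le_opNorm _ _).trans ?_
        rw [PiLp.norm_single, norm_one]
        exact mul_le_mul_of_nonneg_right h3 zero_le_one
      rw [hypDualField, abs_mul, abs_mul, abs_mul, abs_of_pos (by linarith : 0 < p),
        abs_of_nonneg (Real.rpow_nonneg h1 p), abs_of_nonneg (Real.rpow_nonneg (norm_nonneg _) _)]
      have h5 : ((1 - ‖x‖ ^ 2) / 2) ^ p ≤ 1 := Real.rpow_le_one h1 h2 (by linarith)
      have h6 := Real.rpow_le_rpow (norm_nonneg _) h3 (by linarith : 0 ≤ p - 2)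
      rw [Real.norm_eq_abs] at h4
      gcongr
    · rw [hypDualField, fderiv_eq_zero_of_radius_lt hw.eq_zero hx]
      simp
      positivity
  · rw [hypDualField, fderiv_eq_zero_of_radius_lt hw.eq_zero hx]
    simp

lemma hypGrad_rpow {p : ℝ} {w : EuclideanSpace ℝ (Fin n) → ℝ} {x : EuclideanSpace ℝ (Fin n)}
    (hx : ‖x‖ < 1) : hypGrad w x ^ p = ((1 - ‖x‖ ^ 2) / 2) ^ p * ‖fderiv ℝ w x‖ ^ p :=
  Real.mul_rpow (by nlinarith [norm_nonneg x]) (norm_nonneg _)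

lemma sum_fderiv_mul_dualField {p : ℝ} (v w : EuclideanSpace ℝ (Fin n) → ℝ)
    (x : EuclideanSpace ℝ (Fin n)) :
    ∑ i, fderiv ℝ v x (EuclideanSpace.single i 1) * hypDualField p w i x =
      ((1 - ‖x‖ ^ 2) / 2) ^ p * (p * (‖fderiv ℝ w x‖ ^ (p - 2) *
        ∑ i, fderiv ℝ v x (EuclideanSpace.single i 1) *
          fderiv ℝ w x (EuclideanSpace.single i 1))) := by
  rw [Finset.mul_sum, Finset.mul_sum, Finset.mul_sum]
  refine Finset.sum_congr rfl fun i _ => ?_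
  rw [hypDualField]
  ring

lemma IsHypLip.integrable_fderiv_mul_dualField {R L : ℝ} (hR0 : 0 < R) (hR : R < 1) (hL : 0 ≤ L)
    {v w : EuclideanSpace ℝ (Fin n) → ℝ} (hv : IsHypLip R L v) (hw : IsHypLip R L w) {p : ℝ}
    (hp : 2 < p) (i : Fin n) :
    Integrable (fun x => fderiv ℝ v x (EuclideanSpace.single i 1) * hypDualField p w i x)
      (hypVolume n) := by
  refine (hw.integrable_dualField hR0 hR hL hp i).bdd_mul
    (c := Real.toNNReal (√L / (1 - R ^ 2)) * ‖EuclideanSpace.single i (1 : ℝ)‖)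
    (measurable_fderiv_apply_const ℝ v (EuclideanSpace.single i 1)).aestronglyMeasurable
    (Filter.Eventually.of_forall fun x => ?_)
  exact (ContinuousLinearMap.le_opNorm _ _).trans (mul_le_mul_of_nonneg_right
    (norm_fderiv_le_of_lipschitz ℝ (hv.lipschitzWith hR0 hR hL)) (norm_nonneg _))

lemma IsHypLip.sum_integral_dualField_self {R L : ℝ} (hR0 : 0 < R) (hR : R < 1) (hL : 0 ≤ L)
    {w : EuclideanSpace ℝ (Fin n) → ℝ} (hw : IsHypLip R L w) {p : ℝ} (hp : 2 < p) :
    ∑ i, ∫ x, fderiv ℝ w x (EuclideanSpace.single i 1) * hypDualField p w i x ∂(hypVolume n) =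
      p * hypEnergy p w := by
  rw [← integral_finsetSum _ fun i _ =>
    hw.integrable_fderiv_mul_dualField hR0 hR hL hw hp i, hypEnergy, ← integral_const_mul]
  refine integral_congr_ae ?_
  filter_upwards [ae_hypVolume_norm_lt_one] with x hx
  rw [sum_fderiv_mul_dualField, sum_apply_single_mul_self, hypGrad_rpow hx]
  have : ‖fderiv ℝ w x‖ ^ (p - 2) * ‖fderiv ℝ w x‖ ^ 2 = ‖fderiv ℝ w x‖ ^ p := by
    rw [← Real.rpow_natCast, ← Real.rpow_add' (norm_nonneg _) (by simp; linarith)]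
    congr 1
    push_cast
    ring
  rw [this]
  ring

lemma IsHypLip.sum_integral_dualField_le {R L : ℝ} (hR0 : 0 < R) (hR : R < 1) (hL : 0 ≤ L)
    {v w : EuclideanSpace ℝ (Fin n) → ℝ} (hv : IsHypLip R L v) (hw : IsHypLip R L w) {p : ℝ}
    (hp : 2 < p) :
    (∑ i, ∫ x, fderiv ℝ v x (EuclideanSpace.single i 1) * hypDualField p w i x ∂(hypVolume n)) -
      (p - 1) * hypEnergy p w ≤ hypEnergy p v := by
  have hi := fun i (_ : i ∈ Finset.univ) => hv.integrable_fderiv_mul_dualField hR0 hR hL hw hp i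
  have hw' := (hw.integrable_hypGrad_rpow hR0 hR hL (by linarith : 0 < p)).const_mul (p - 1)
  rw [← integral_finsetSum _ hi, hypEnergy, hypEnergy, ← integral_const_mul,
    ← integral_sub (integrable_finsetSum _ hi) hw']
  refine integral_mono_ae ((integrable_finsetSum _ hi).sub hw')
    (hv.integrable_hypGrad_rpow hR0 hR hL (by linarith)) ?_
  filter_upwards [ae_hypVolume_norm_lt_one] with x hx
  rw [sum_fderiv_mul_dualField, hypGrad_rpow hx, hypGrad_rpow hx]
  have h1 : 0 ≤ (1 - ‖x‖ ^ 2) / 2 := by nlinarith [norm_nonneg x]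
  have := mul_le_mul_of_nonneg_left (norm_rpow_ge_tangent (a := fderiv ℝ v x) (b := fderiv ℝ w x)
    hp) (Real.rpow_nonneg h1 p)
  linarith

lemma hypEnergy_le_of_tendsto (hn : 0 < n) {R L : ℝ} (hR0 : 0 < R) (hR : R < 1) (hL : 0 ≤ L)
    {v : ℕ → EuclideanSpace ℝ (Fin n) → ℝ} {w : EuclideanSpace ℝ (Fin n) → ℝ}
    (hv : ∀ k, IsHypLip R L (v k)) (hw : IsHypLip R L w)
    (hlim : ∀ x, Filter.Tendsto (fun k => v k x) Filter.atTop (nhds (w x))) {p E : ℝ}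
    (hp : 2 < p) (hE : ∀ k, hypEnergy p (v k) ≤ E) : hypEnergy p w ≤ E := by
  have h := tendsto_finsetSum Finset.univ fun i (_ : i ∈ Finset.univ) =>
    tendsto_integral_hypVolume_fderiv_mul (fun k => (hv k).lipschitzWith hR0 hR hL)
      (hw.lipschitzWith hR0 hR hL) (fun k x => (hv k).abs_le hn hR0 hR x hL) hlim
      (EuclideanSpace.single i 1) (hw.integrable_dualField hR0 hR hL hp i)
  rw [hw.sum_integral_dualField_self hR0 hR hL hp] at h
  have := le_of_tendsto h (Filter.Eventually.of_forall fun k => (by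
    have := (hv k).sum_integral_dualField_le hR0 hR hL hw hp
    linarith [hE k] : _ ≤ E + (p - 1) * hypEnergy p w))
  linarith

lemma IsHypLip.of_tendsto {R L : ℝ} {v : ℕ → EuclideanSpace ℝ (Fin n) → ℝ}
    {w : EuclideanSpace ℝ (Fin n) → ℝ} (hv : ∀ k, IsHypLip R L (v k))
    (hlim : ∀ x, Filter.Tendsto (fun k => v k x) Filter.atTop (nhds (w x))) :
    IsHypLip R L w := by
  refine ⟨fun x => ge_of_tendsto' (hlim x) fun k => (hv k).nonneg x, fun x hx => ?_,
    fun x y hx hy => ?_⟩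
  · refine tendsto_nhds_unique (hlim x) ?_
    simp_rw [fun k => (hv k).eq_zero x hx]
    exact tendsto_const_nhds
  · exact le_of_tendsto' (((hlim x).sub (hlim y)).pow 2) fun k => (hv k).sq_le x y hx hy

/-- Ascoli's theorem for `IsHypLip`. -/
lemma exists_subseq_tendsto_of_isHypLip (hn : 0 < n) {R L : ℝ} (hR0 : 0 < R) (hR : R < 1)
    (hL : 0 ≤ L) {v : ℕ → EuclideanSpace ℝ (Fin n) → ℝ} (hv : ∀ k, IsHypLip R L (v k)) :
    ∃ (w : EuclideanSpace ℝ (Fin n) → ℝ) (φ : ℕ → ℕ), StrictMono φ ∧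
      ∀ x, Filter.Tendsto (fun k => v (φ k) x) Filter.atTop (nhds (w x)) := by
  set B := Metric.closedBall (0 : EuclideanSpace ℝ (Fin n)) 1
  have : CompactSpace B := isCompact_iff_compactSpace.1 (isCompact_closedBall _ _)
  have hlip := fun k => (hv k).lipschitzWith hR0 hR hL
  let F : ℕ → BoundedContinuousFunction B ℝ := fun k =>
    BoundedContinuousFunction.mkOfCompact ⟨fun x => v k x, (hlip k).continuous.comp
      continuous_subtype_val⟩
  have hcomp := BoundedContinuousFunction.arzela_ascoli
    (Set.Icc (-(√L / (1 - R ^ 2) * 2)) (√L / (1 - R ^ 2) * 2)) isCompact_Icc (Set.range F)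
    (by
      rintro _ x ⟨k, rfl⟩
      exact abs_le.1 ((hv k).abs_le hn hR0 hR x hL))
    (by
      refine (LipschitzWith.uniformEquicontinuous _ (Real.toNNReal (√L / (1 - R ^ 2)))
        ?_).equicontinuous
      rintro ⟨_, k, rfl⟩
      have := (hlip k).comp (LipschitzWith.subtype_val B)
      rw [mul_one] at this
      exact this)
  obtain ⟨f, -, φ, hφ, hlim⟩ := hcomp.tendsto_subseq
    (fun k => subset_closure (Set.mem_range_self (f := F) k))
  have hex : ∀ x, ∃ y, Filter.Tendsto (fun k => v (φ k) x) Filter.atTop (nhds y) := by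
    intro x
    by_cases hx : x ∈ B
    · refine ⟨f ⟨x, hx⟩, ?_⟩
      exact ((BoundedContinuousFunction.lipschitz_eval_const (⟨x, hx⟩ : B)).continuous.tendsto
        f).comp hlim
    · refine ⟨0, ?_⟩
      have hx' : R ≤ ‖x‖ := by
        have : 1 < ‖x‖ := by simpa [B] using hx
        linarith
      simp_rw [fun k => (hv (φ k)).eq_zero x hx']
      exact tendsto_const_nhds
  choose w hw using hex
  exact ⟨w, φ, hφ, hw⟩

end LowerSemicontinuity

section Rearrangement

variable {n : ℕ}

lemma tendsto_integral_of_isHypLip (hn : 0 < n) {R L : ℝ} (hR0 : 0 < R) (hR : R < 1) (hL : 0 ≤ L)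
    {v : ℕ → EuclideanSpace ℝ (Fin n) → ℝ} {w : EuclideanSpace ℝ (Fin n) → ℝ}
    (hv : ∀ k, IsHypLip R L (v k))
    (hlim : ∀ x, Filter.Tendsto (fun k => v k x) Filter.atTop (nhds (w x)))
    {Φ : ℝ → ℝ} (hΦ : Continuous Φ) (h0 : Φ 0 = 0) {m : EuclideanSpace ℝ (Fin n) → ℝ}
    (hm : Continuous m) :
    Filter.Tendsto (fun k => ∫ x, Φ (v k x) * m x ∂(hypVolume n)) Filter.atTop
      (nhds (∫ x, Φ (w x) * m x ∂(hypVolume n))) := by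
  obtain ⟨C, hC⟩ := (isCompact_Icc (a := -(√L / (1 - R ^ 2) * 2))
    (b := √L / (1 - R ^ 2) * 2)).exists_bound_of_continuousOn hΦ.continuousOn
  obtain ⟨D, hD⟩ := (isCompact_closedBall
    (0 : EuclideanSpace ℝ (Fin n)) R).exists_bound_of_continuousOn
    hm.continuousOn
  have hbd : ∀ k x, ‖Φ (v k x)‖ ≤ C := fun k x => hC _ (abs_le.1 ((hv k).abs_le hn hR0 hR x hL))
  refine tendsto_integral_of_dominated_convergence
    ((Metric.closedBall (0 : EuclideanSpace ℝ (Fin n)) R).indicator fun _ => C * D)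
    (fun k => ((hΦ.comp ((hv k).lipschitzWith hR0 hR hL).continuous).mul
      hm).aestronglyMeasurable) ?_
    (fun k => Filter.Eventually.of_forall fun x => ?_)
    (Filter.Eventually.of_forall fun x => ((hΦ.tendsto _).comp (hlim x)).mul_const _)
  · rw [integrable_indicator_iff Metric.isClosed_closedBall.measurableSet]
    exact integrableOn_const (hypVolume_closedBall_lt_top hR).ne
  · by_cases hx : x ∈ Metric.closedBall (0 : EuclideanSpace ℝ (Fin n)) R
    · rw [Set.indicator_of_mem hx, norm_mul]
      exact mul_le_mul (hbd k x) (hD x hx) (norm_nonneg _) ((norm_nonneg _).trans (hbd k x))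
    · have hx' : R ≤ ‖x‖ := by
        have : R < ‖x‖ := by simpa using hx
        exact this.le
      rw [Set.indicator_of_notMem hx, (hv k).eq_zero x hx', h0]
      simp

/-- Radially decreasing rearrangement: an equidistributed function that is radially
nonincreasing and has no larger energy. -/
theorem exists_radial_rearrangement (hn : 0 < n) {R L : ℝ} (hR0 : 0 < R) (hR : R < 1)
    (hL : 0 ≤ L) {v₀ : EuclideanSpace ℝ (Fin n) → ℝ} (hv₀ : IsHypLip R L v₀) {p : ℝ}
    (hp : 2 < p) :
    ∃ v : EuclideanSpace ℝ (Fin n) → ℝ, IsHypLip R L v ∧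
      (∀ Φ : ℝ → ℝ, Continuous Φ → Φ 0 = 0 →
        ∫ x, Φ (v x) ∂(hypVolume n) = ∫ x, Φ (v₀ x) ∂(hypVolume n)) ∧
      hypEnergy p v ≤ hypEnergy p v₀ ∧
      ∀ x y, ‖x‖ < ‖y‖ → ‖y‖ < 1 → v y ≤ v x := by
  set K : Set (EuclideanSpace ℝ (Fin n) → ℝ) := {v | IsHypLip R L v ∧
      (∀ Φ : ℝ → ℝ, Continuous Φ → Φ 0 = 0 →
        ∫ x, Φ (v x) ∂(hypVolume n) = ∫ x, Φ (v₀ x) ∂(hypVolume n)) ∧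
      hypEnergy p v ≤ hypEnergy p v₀} with hK
  have hne : (hypMoment '' K).Nonempty := ⟨_, v₀, ⟨hv₀, fun _ _ _ => rfl, le_rfl⟩, rfl⟩
  have hbdd : BddAbove (hypMoment '' K) := by
    refine ⟨∫ x, v₀ x ∂(hypVolume n), ?_⟩
    rintro _ ⟨v, ⟨h1, h2, -⟩, rfl⟩
    have h3 := h2 (fun t => t) continuous_id rfl
    rw [← h3]
    refine integral_mono (h1.integrable_moment hn hR0 hR hL)
      (h1.integrable_comp hn hR0 hR hL continuous_id rfl) fun x => ?_
    exact mul_le_of_le_one_right (h1.nonneg x) (by nlinarith [norm_nonneg x])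
  obtain ⟨s, -, hs, hsK⟩ := exists_seq_tendsto_sSup hne hbdd
  choose v hvK hvs using hsK
  obtain ⟨w, φ, hφ, hlim⟩ := exists_subseq_tendsto_of_isHypLip hn hR0 hR hL
    (fun k => (hvK k).1)
  have hφlip : ∀ k, IsHypLip R L (v (φ k)) := fun k => (hvK (φ k)).1
  have hw := IsHypLip.of_tendsto hφlip hlim
  have hwK : w ∈ K := by
    refine ⟨hw, fun Φ hΦ h0 => ?_, hypEnergy_le_of_tendsto hn hR0 hR hL hφlip hw hlim hp
      fun k => (hvK (φ k)).2.2⟩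
    have h := tendsto_integral_of_isHypLip hn hR0 hR hL hφlip hlim hΦ h0
      (m := fun _ => 1) continuous_const
    simp only [mul_one] at h
    simp_rw [fun k => (hvK (φ k)).2.1 Φ hΦ h0] at h
    exact tendsto_nhds_unique h tendsto_const_nhds
  have hmax : hypMoment w = sSup (hypMoment '' K) := by
    have h := tendsto_integral_of_isHypLip hn hR0 hR hL hφlip hlim continuous_id rfl
      (m := fun x => 1 - ‖x‖ ^ 2) (by fun_prop)
    refine tendsto_nhds_unique h ?_
    have h' := hs.comp hφ.tendsto_atTop
    refine h'.congr fun k => ?_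
    rw [Function.comp_apply, ← hvs]
    rfl
  refine ⟨w, hw, hwK.2.1, hwK.2.2, fun x y hxy hy => ?_⟩
  by_contra! hlt
  obtain ⟨a, ha, rfl⟩ := exists_hypReflection_eq hxy hy
  have h1 := hypMoment_lt_polarization hn hR0 hR hL hw ha (hxy.trans hy) hxy hlt
  have h2 : polarization a w ∈ K := by
    refine ⟨hw.polarization hL ha, fun Φ hΦ h0 => ?_, ?_⟩
    · rw [integral_comp_polarization hn hR0 hR hL hw ha hΦ h0, hwK.2.1 Φ hΦ h0]
    · rw [hypEnergy_polarization hn hR0 hR hL hw ha (by linarith)]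
      exact hwK.2.2
  have h3 := le_csSup hbdd ⟨_, h2, rfl⟩
  rw [← hmax] at h3
  exact h3.not_gt h1

end Rearrangement

section RadialReduction

variable {n : ℕ}

/-- The surface area of the unit sphere of `ℝⁿ`. -/
noncomputable def sphereArea (n : ℕ) : ℝ :=
  n * volume.real (Metric.ball (0 : EuclideanSpace ℝ (Fin n)) 1)

/-- The density of hyperbolic volume in the Euclidean radius, per unit area of the sphere. -/
noncomputable def hypWeight (n : ℕ) (r : ℝ) : ℝ := (2 / (1 - r ^ 2)) ^ n * r ^ (n - 1)

lemma integral_hypVolume_norm (hn : 0 < n) (f : ℝ → ℝ) :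
    ∫ x, f ‖x‖ ∂(hypVolume n) = sphereArea n * ∫ r in (0 : ℝ)..1, f r * hypWeight n r := by
  have : Nonempty (Fin n) := ⟨⟨0, hn⟩⟩
  have h := integral_fun_norm_addHaar (volume : Measure (EuclideanSpace ℝ (Fin n)))
    ((Set.Iio (1 : ℝ)).indicator fun r => f r * (2 / (1 - r ^ 2)) ^ (n : ℝ))
  rw [finrank_euclideanSpace_fin] at h
  have h2 : ∫ x, f ‖x‖ ∂(hypVolume n) = ∫ x : EuclideanSpace ℝ (Fin n),
      (Set.Iio (1 : ℝ)).indicator (fun r => f r * (2 / (1 - r ^ 2)) ^ (n : ℝ)) ‖x‖ := by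
    rw [integral_hypVolume_eq_indicator]
    congr 1
    ext x
    simp only [Set.indicator, Metric.mem_ball, dist_zero_right, Set.mem_Iio]
  rw [h2, h, sphereArea, nsmul_eq_mul, smul_eq_mul, mul_assoc]
  congr 2
  rw [intervalIntegral.integral_of_le zero_le_one, integral_Ioc_eq_integral_Ioo]
  have h3 : ∀ y : ℝ, y ^ (n - 1) • (Set.Iio (1 : ℝ)).indicator
      (fun r => f r * (2 / (1 - r ^ 2)) ^ (n : ℝ)) y =
      (Set.Iio (1 : ℝ)).indicator (fun r => f r * hypWeight n r) y := by
    intro y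
    simp only [Set.indicator, hypWeight, smul_eq_mul, Real.rpow_natCast]
    split_ifs
    · ring
    · ring
  simp_rw [h3]
  rw [setIntegral_indicator measurableSet_Iio, Set.Ioi_inter_Iio]

lemma sphereArea_pos (hn : 0 < n) : 0 < sphereArea n := by
  refine mul_pos (by exact_mod_cast hn) ?_
  exact ENNReal.toReal_pos (Metric.measure_ball_pos _ _ one_pos).ne' measure_ball_lt_top.ne

lemma eq_of_norm_eq_of_radial {v : EuclideanSpace ℝ (Fin n) → ℝ} (hv : Continuous v)
    (hmono : ∀ x y, ‖x‖ < ‖y‖ → ‖y‖ < 1 → v y ≤ v x) {x y : EuclideanSpace ℝ (Fin n)}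
    (hxy : ‖x‖ = ‖y‖) (hy : ‖y‖ < 1) : v x = v y := by
  have key : ∀ x y : EuclideanSpace ℝ (Fin n), ‖x‖ = ‖y‖ → ‖y‖ < 1 → v y ≤ v x := by
    intro x y hxy hy
    rcases eq_or_ne y 0 with h | h
    · rw [h, norm_zero, norm_eq_zero] at hxy
      rw [hxy, h]
    have ht : Filter.Tendsto (fun t : ℝ => v (t • x)) (nhdsWithin 1 (Set.Iio 1))
        (nhds (v ((1 : ℝ) • x))) := by
      have : Continuous fun t : ℝ => v (t • x) := by fun_prop
      exact this.continuousAt.tendsto.mono_left nhdsWithin_le_nhds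
    rw [one_smul] at ht
    refine ge_of_tendsto ht ?_
    have : Set.Ioo (0 : ℝ) 1 ∈ nhdsWithin (1 : ℝ) (Set.Iio 1) := Ioo_mem_nhdsLT zero_lt_one
    filter_upwards [this] with t ht
    refine hmono _ _ ?_ hy
    rw [norm_smul, Real.norm_eq_abs, abs_of_pos ht.1, hxy]
    exact mul_lt_of_lt_one_left (norm_pos_iff.2 h) ht.2
  exact le_antisymm (key y x hxy.symm (hxy ▸ hy)) (key x y hxy hy)

lemma exists_radial_profile (hn : 0 < n) {R L : ℝ} (hR0 : 0 < R) (hR : R < 1) (hL : 0 ≤ L)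
    {v : EuclideanSpace ℝ (Fin n) → ℝ} (hv : IsHypLip R L v)
    (hmono : ∀ x y, ‖x‖ < ‖y‖ → ‖y‖ < 1 → v y ≤ v x) :
    ∃ φ : ℝ → ℝ, LipschitzWith (Real.toNNReal (√L / (1 - R ^ 2))) φ ∧ (∀ r, 0 ≤ φ r) ∧
      (∀ r, R ≤ r → φ r = 0) ∧ AntitoneOn φ (Set.Ici 0) ∧ ∀ x, v x = φ ‖x‖ := by
  have : Nonempty (Fin n) := ⟨⟨0, hn⟩⟩
  have hlip := hv.lipschitzWith hR0 hR hL
  obtain ⟨e, he⟩ := exists_norm_eq (EuclideanSpace ℝ (Fin n)) zero_le_one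
  have hnorm : ∀ r : ℝ, 0 ≤ r → ‖r • e‖ = r := fun r hr => by
    rw [norm_smul, he, mul_one, Real.norm_eq_abs, abs_of_nonneg hr]
  have hzero : ∀ r, R ≤ r → v (r • e) = 0 := fun r hr =>
    hv.eq_zero _ (by rwa [hnorm r (hR0.le.trans hr)])
  refine ⟨fun r => v (r • e), ?_, fun r => hv.nonneg _, hzero, ?_, fun x => ?_⟩
  · refine LipschitzWith.of_dist_le_mul fun r s => ?_
    refine (hlip.dist_le_mul _ _).trans (le_of_eq ?_)
    rw [dist_eq_norm, ← sub_smul, norm_smul, he, mul_one, Real.norm_eq_abs, ← Real.dist_eq]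
  · intro r hr s hs hrs
    rcases hrs.eq_or_lt with h | h
    · rw [h]
    rcases lt_or_ge s 1 with h1 | h1
    · exact hmono _ _ (by rw [hnorm r hr, hnorm s hs]; exact h) (by rwa [hnorm s hs])
    · simp only [hzero s (hR.le.trans h1)]
      exact hv.nonneg _
  · rcases lt_or_ge ‖x‖ 1 with h | h
    · exact eq_of_norm_eq_of_radial hlip.continuous hmono
        (by rw [hnorm _ (norm_nonneg x)]) (by rwa [hnorm _ (norm_nonneg x)])
    · rw [hv.eq_zero x (hR.le.trans h)]
      exact (hzero _ (hR.le.trans h)).symm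

lemma abs_deriv_profile_le {v : EuclideanSpace ℝ (Fin n) → ℝ} {φ : ℝ → ℝ}
    (hφ : ∀ x, v x = φ ‖x‖) {x : EuclideanSpace ℝ (Fin n)} (hx : x ≠ 0)
    (hd : DifferentiableAt ℝ v x) : |deriv φ ‖x‖| ≤ ‖fderiv ℝ v x‖ := by
  have hpos : 0 < ‖x‖ := norm_pos_iff.2 hx
  have hx1 : ‖‖x‖⁻¹ • x‖ = 1 := by
    rw [norm_smul, norm_inv, norm_norm, inv_mul_cancel₀ hpos.ne']
  have hxx : ‖x‖ • ‖x‖⁻¹ • x = x := smul_inv_smul₀ hpos.ne' x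
  have h1 : HasDerivAt (fun t : ℝ => t • ‖x‖⁻¹ • x) (‖x‖⁻¹ • x) ‖x‖ := by
    simpa using (hasDerivAt_id ‖x‖).smul_const (‖x‖⁻¹ • x)
  have h2 : HasDerivAt (fun t : ℝ => v (t • ‖x‖⁻¹ • x)) (fderiv ℝ v x (‖x‖⁻¹ • x)) ‖x‖ := by
    have hd' : HasFDerivAt v (fderiv ℝ v x) (‖x‖ • ‖x‖⁻¹ • x) := by
      rw [hxx]; exact hd.hasFDerivAt
    exact hd'.comp_hasDerivAt ‖x‖ h1
  have h3 : φ =ᶠ[nhds ‖x‖] fun t : ℝ => v (t • ‖x‖⁻¹ • x) := by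
    filter_upwards [lt_mem_nhds hpos] with t ht
    rw [hφ, norm_smul, hx1, mul_one, Real.norm_eq_abs, abs_of_pos ht]
  rw [(h2.congr_of_eventuallyEq h3).deriv]
  have := (fderiv ℝ v x).le_opNorm (‖x‖⁻¹ • x)
  rwa [hx1, mul_one] at this

lemma radial_energy_le (hn : 0 < n) {R L : ℝ} (hR0 : 0 < R) (hR : R < 1) (hL : 0 ≤ L)
    {v : EuclideanSpace ℝ (Fin n) → ℝ} (hv : IsHypLip R L v) {φ : ℝ → ℝ}
    (hφ : ∀ x, v x = φ ‖x‖) {p : ℝ} (hp : 0 < p) :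
    sphereArea n * ∫ r in (0 : ℝ)..1, ((1 - r ^ 2) / 2 * |deriv φ r|) ^ p * hypWeight n r ≤
      hypEnergy p v := by
  have : Nonempty (Fin n) := ⟨⟨0, hn⟩⟩
  rw [← integral_hypVolume_norm hn fun r => ((1 - r ^ 2) / 2 * |deriv φ r|) ^ p]
  have h0 : ∀ᵐ x ∂(hypVolume n), x ≠ 0 := by
    refine hypVolume_absolutelyContinuous.ae_le ?_
    exact measure_eq_zero_iff_ae_notMem.1 (measure_singleton 0)
  refine integral_mono_of_nonneg ?_ (hv.integrable_hypGrad_rpow hR0 hR hL hp) ?_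
  · filter_upwards [ae_hypVolume_norm_lt_one] with x hx
    have : 0 ≤ (1 - ‖x‖ ^ 2) / 2 := by nlinarith [norm_nonneg x]
    simp only [Pi.zero_apply]
    positivity
  · filter_upwards [ae_hypVolume_norm_lt_one, h0, hypVolume_absolutelyContinuous.ae_le
      (hv.lipschitzWith hR0 hR hL).ae_differentiableAt] with x hx hx0 hd
    have h1 : 0 ≤ (1 - ‖x‖ ^ 2) / 2 := by nlinarith [norm_nonneg x]
    exact Real.rpow_le_rpow (by positivity)
      (mul_le_mul_of_nonneg_left (abs_deriv_profile_le hφ hx0 hd) h1) hp.le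

end RadialReduction

section AbsoluteValue

variable {n : ℕ}

lemma sq_le_hypDelta {x y : EuclideanSpace ℝ (Fin n)} (hx : ‖x‖ < 1) (hy : ‖y‖ < 1) :
    ‖x - y‖ ^ 2 ≤ hypDelta x y := by
  have h1 : 0 < 1 - ‖x‖ ^ 2 := by nlinarith [norm_nonneg x]
  have h2 : 0 < 1 - ‖y‖ ^ 2 := by nlinarith [norm_nonneg y]
  rw [hypDelta, le_div_iff₀ (mul_pos h1 h2)]
  refine mul_le_of_le_one_right (sq_nonneg _) ?_
  exact mul_le_one₀ (by nlinarith [norm_nonneg x]) h2.le (by nlinarith [norm_nonneg y])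

lemma exists_radius_of_tsupport_subset {u : EuclideanSpace ℝ (Fin n) → ℝ}
    (hsupp : tsupport u ⊆ Metric.ball 0 1) :
    HasCompactSupport u ∧ ∃ R, 0 < R ∧ R < 1 ∧ ∀ x, R ≤ ‖x‖ → u x = 0 := by
  have hc : HasCompactSupport u :=
    (isCompact_closedBall (0 : EuclideanSpace ℝ (Fin n)) 1).of_isClosed_subset
      (isClosed_tsupport u) (hsupp.trans Metric.ball_subset_closedBall)
  refine ⟨hc, ?_⟩
  obtain ⟨R', hR', hsub⟩ := exists_lt_subset_ball (isClosed_tsupport u) hsupp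
  refine ⟨max R' (1 / 2), by positivity, max_lt hR' (by norm_num), fun x hx => ?_⟩
  by_contra h
  have := hsub (subset_tsupport u h)
  rw [Metric.mem_ball, dist_zero_right] at this
  linarith [le_max_left R' (1 / 2)]

lemma isHypLip_abs {u : EuclideanSpace ℝ (Fin n) → ℝ} {D : NNReal} (hu : LipschitzWith D u)
    {R : ℝ} (h0 : ∀ x, R ≤ ‖x‖ → u x = 0) : IsHypLip R ((D : ℝ) ^ 2) fun x => |u x| := by
  refine ⟨fun x => abs_nonneg _, fun x hx => by rw [h0 x hx, abs_zero], fun x y hx hy => ?_⟩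
  refine le_trans ?_ (mul_le_mul_of_nonneg_left (sq_le_hypDelta hx hy) (sq_nonneg _))
  rw [← mul_pow, ← sq_abs]
  refine pow_le_pow_left₀ (abs_nonneg _) ?_ 2
  have := hu.dist_le_mul x y
  rw [Real.dist_eq, dist_eq_norm] at this
  exact (abs_abs_sub_abs_le _ _).trans this

lemma norm_fderiv_abs_le {u : EuclideanSpace ℝ (Fin n) → ℝ} {x : EuclideanSpace ℝ (Fin n)}
    (hu : DifferentiableAt ℝ u x) : ‖fderiv ℝ (fun y => |u y|) x‖ ≤ ‖fderiv ℝ u x‖ := by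
  rcases lt_trichotomy (u x) 0 with h | h | h
  · have : (fun y => |u y|) =ᶠ[nhds x] fun y => -u y := by
      filter_upwards [hu.continuousAt.eventually_lt_const h] with y hy
      exact abs_of_neg hy
    rw [this.fderiv_eq, fderiv_fun_neg, norm_neg]
  · have : IsLocalMin (fun y => |u y|) x :=
      Filter.Eventually.of_forall fun y => by simp [h]
    rw [this.fderiv_eq_zero, norm_zero]
    exact norm_nonneg _
  · have : (fun y => |u y|) =ᶠ[nhds x] u := by
      filter_upwards [hu.continuousAt.eventually_const_lt h] with y hy
      exact abs_of_pos hy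
    rw [this.fderiv_eq]

lemma integrable_hypGrad_rpow_of_lipschitz {u : EuclideanSpace ℝ (Fin n) → ℝ} {D : NNReal}
    (hu : LipschitzWith D u) {R : ℝ} (hR : R < 1) (h0 : ∀ x, R ≤ ‖x‖ → u x = 0) {p : ℝ}
    (hp : 0 < p) : Integrable (fun x => hypGrad u x ^ p) (hypVolume n) := by
  refine integrable_hypVolume (C := (D : ℝ) ^ p) hR
    ((measurable_hypGrad u).pow_const p).aestronglyMeasurable
    (Filter.Eventually.of_forall fun x => ?_) fun x hx => ?_
  · rcases le_or_gt ‖x‖ R with hx | hx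
    · have h1 : 0 ≤ (1 - ‖x‖ ^ 2) / 2 := by nlinarith [norm_nonneg x]
      have h2 : (1 - ‖x‖ ^ 2) / 2 ≤ 1 := by nlinarith [norm_nonneg x]
      have h3 := norm_fderiv_le_of_lipschitz ℝ hu (x₀ := x)
      have h4 : 0 ≤ hypGrad u x := mul_nonneg h1 (norm_nonneg _)
      rw [abs_of_nonneg (by positivity)]
      refine Real.rpow_le_rpow h4 ?_ hp.le
      exact (mul_le_mul h2 h3 (norm_nonneg _) zero_le_one).trans (one_mul _).le
    · rw [hypGrad_eq_zero h0 hx, Real.zero_rpow hp.ne', abs_zero]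
      positivity
  · rw [hypGrad_eq_zero h0 hx, Real.zero_rpow hp.ne']

lemma hypEnergy_abs_le {u : EuclideanSpace ℝ (Fin n) → ℝ} {D : NNReal}
    (hu : LipschitzWith D u) (hd : Differentiable ℝ u) {R : ℝ} (hR : R < 1)
    (h0 : ∀ x, R ≤ ‖x‖ → u x = 0) {p : ℝ} (hp : 0 < p) :
    hypEnergy p (fun x => |u x|) ≤ hypEnergy p u := by
  refine integral_mono_of_nonneg ?_ (integrable_hypGrad_rpow_of_lipschitz hu hR h0 hp) ?_
  · filter_upwards [ae_hypVolume_norm_lt_one] with x hx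
    have : 0 ≤ (1 - ‖x‖ ^ 2) / 2 := by nlinarith [norm_nonneg x]
    simp only [Pi.zero_apply, hypGrad]
    positivity
  · filter_upwards [ae_hypVolume_norm_lt_one] with x hx
    have h1 : 0 ≤ (1 - ‖x‖ ^ 2) / 2 := by nlinarith [norm_nonneg x]
    exact Real.rpow_le_rpow (by unfold hypGrad; positivity)
      (mul_le_mul_of_nonneg_left (norm_fderiv_abs_le (hd x)) h1) hp.le

/-- Reduction of inequalities between integrals of a function on the ball to radially
nonincreasing profiles. -/
theorem exists_profile_of_smooth (hn : 0 < n) {u : EuclideanSpace ℝ (Fin n) → ℝ}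
    (hu : ContDiff ℝ (⊤ : ℕ∞) u) (hsupp : tsupport u ⊆ Metric.ball 0 1) {p : ℝ} (hp : 2 < p) :
    ∃ (φ : ℝ → ℝ) (K : NNReal) (R : ℝ), 0 < R ∧ R < 1 ∧ LipschitzWith K φ ∧ (∀ r, 0 ≤ φ r) ∧
      (∀ r, R ≤ r → φ r = 0) ∧ AntitoneOn φ (Set.Ici 0) ∧
      (∀ s : ℝ, 0 < s → ∫ x, |u x| ^ s ∂(hypVolume n) =
        sphereArea n * ∫ r in (0 : ℝ)..1, φ r ^ s * hypWeight n r) ∧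
      sphereArea n * ∫ r in (0 : ℝ)..1, ((1 - r ^ 2) / 2 * |deriv φ r|) ^ p * hypWeight n r ≤
        hypEnergy p u := by
  obtain ⟨hc, R, hR0, hR, h0⟩ := exists_radius_of_tsupport_subset hsupp
  obtain ⟨D, hD⟩ := ContDiff.lipschitzWith_of_hasCompactSupport hc hu (by simp)
  obtain ⟨v, hv, hinteg, hE, hmono⟩ := exists_radial_rearrangement hn hR0 hR (sq_nonneg _)
    (isHypLip_abs hD h0) hp
  obtain ⟨φ, hφ1, hφ2, hφ3, hφ4, hφ5⟩ := exists_radial_profile hn hR0 hR (sq_nonneg _) hv hmono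
  refine ⟨φ, _, R, hR0, hR, hφ1, hφ2, hφ3, hφ4, fun s hs => ?_, ?_⟩
  · have h1 := hinteg (fun t => |t| ^ s)
      (continuous_abs.rpow_const fun _ => Or.inr hs.le) (by simp [hs.ne'])
    simp only [abs_abs] at h1
    rw [← h1, ← integral_hypVolume_norm hn fun r => φ r ^ s]
    congr 1
    ext x
    rw [abs_of_nonneg (hv.nonneg x), hφ5]
  · exact (radial_energy_le hn hR0 hR (sq_nonneg _) hv hφ5 (by linarith)).trans
      (hE.trans (hypEnergy_abs_le hD (hu.differentiable (by simp)) hR h0 (by linarith)))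

end AbsoluteValue

section Transport

/-- A one-dimensional monotone transport map onto a weighted interval. -/
theorem exists_transport {g f : ℝ → ℝ} {n : ℕ} {M r₀ : ℝ} (hg : Continuous g)
    (hg0 : ∀ t, 0 < g t) (hM : 0 < M) (hr₀ : 0 < r₀) (hf : ContinuousOn f (Set.Icc 0 r₀))
    (hf0 : ∀ r ∈ Set.Ioo 0 r₀, 0 < f r)
    (hmass : ∫ r in (0 : ℝ)..r₀, f r = ∫ t in (0 : ℝ)..M, g t * t ^ (n - 1)) :
    ∃ T : ℝ → ℝ, ContinuousOn T (Set.Icc 0 r₀) ∧ T 0 = 0 ∧ T r₀ = M ∧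
      ∀ r ∈ Set.Ioo 0 r₀, 0 < T r ∧ T r < M ∧
        HasDerivAt T (f r / (g (T r) * T r ^ (n - 1))) r := by
  set k : ℝ → ℝ := fun t => g (max 0 (min t M)) * |t| ^ (n - 1) with hk
  have hkc : Continuous k := by fun_prop
  have hk0 : ∀ t, t ≠ 0 → 0 < k t := fun t ht =>
    mul_pos (hg0 _) (pow_pos (abs_pos.2 ht) _)
  have hkeq : ∀ t ∈ Set.Icc 0 M, k t = g t * t ^ (n - 1) := fun t ht => by
    simp only [hk]
    rw [min_eq_left ht.2, max_eq_right ht.1, abs_of_nonneg ht.1]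
  set G : ℝ → ℝ := fun y => ∫ t in (0 : ℝ)..y, k t with hG
  have hGd : ∀ y, HasDerivAt G (k y) y := fun y =>
    intervalIntegral.integral_hasDerivAt_right (hkc.intervalIntegrable _ _)
      (hkc.stronglyMeasurableAtFilter _ _) hkc.continuousAt
  have hGc : Continuous G := continuous_iff_continuousAt.2 fun y => (hGd y).continuousAt
  have hG0 : G 0 = 0 := by simp [hG]
  have hmono : StrictMono G := by
    have h1 : StrictMonoOn G (Set.Iic 0) := by
      refine strictMonoOn_of_deriv_pos (convex_Iic 0) hGc.continuousOn fun x hx => ?_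
      rw [interior_Iic] at hx
      rw [(hGd x).deriv]; exact hk0 x (ne_of_lt hx)
    have h2 : StrictMonoOn G (Set.Ici 0) := by
      refine strictMonoOn_of_deriv_pos (convex_Ici 0) hGc.continuousOn fun x hx => ?_
      rw [interior_Ici] at hx
      rw [(hGd x).deriv]; exact hk0 x (ne_of_gt hx)
    exact h1.Iic_union_Ici h2
  obtain ⟨c, hc0, hc⟩ : ∃ c, 0 < c ∧ ∀ t, 1 ≤ |t| → c ≤ k t := by
    obtain ⟨z, hz, hzm⟩ := isCompact_Icc.exists_isMinOn (Set.nonempty_Icc.2 hM.le)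
      (hg.continuousOn (s := Set.Icc 0 M))
    refine ⟨g z, hg0 z, fun t ht => ?_⟩
    have : g z ≤ g (max 0 (min t M)) := hzm ⟨le_max_left _ _, max_le hM.le (min_le_right _ _)⟩
    calc g z = g z * 1 := (mul_one _).symm
      _ ≤ k t := mul_le_mul this (one_le_pow₀ ht) zero_le_one (hg0 _).le
  have hdiff : Differentiable ℝ G := fun y => (hGd y).differentiableAt
  have hsurj : Function.Surjective G := by
    refine hGc.surjective ?_ ?_
    · refine Filter.tendsto_atTop_mono' _ (f₁ := fun y => G 1 + c * (y - 1)) ?_ ?_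
      · filter_upwards [Filter.eventually_ge_atTop 1] with y hy
        have := (convex_Ici (1 : ℝ)).mul_sub_le_image_sub_of_le_deriv hGc.continuousOn
          hdiff.differentiableOn (C := c) (fun x hx => by
            rw [interior_Ici] at hx
            rw [(hGd x).deriv]
            exact hc x (le_trans (le_of_lt hx) (le_abs_self x))) 1 Set.self_mem_Ici y hy hy
        linarith
      · refine Filter.tendsto_atTop_add_const_left _ _ (Filter.Tendsto.const_mul_atTop hc0 ?_)
        exact Filter.tendsto_atTop_add_const_right _ _ Filter.tendsto_id
    · refine Filter.tendsto_atBot_mono' _ (f₁ := fun y => G (-1) + c * (y + 1)) ?_ ?_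
      · filter_upwards [Filter.eventually_le_atBot (-1)] with y hy
        have := (convex_Iic (-1 : ℝ)).mul_sub_le_image_sub_of_le_deriv hGc.continuousOn
          hdiff.differentiableOn (C := c) (fun x hx => by
            rw [interior_Iic] at hx
            rw [(hGd x).deriv]
            refine hc x (le_trans ?_ (neg_le_abs x))
            have : x < -1 := hx
            linarith) y hy (-1) Set.self_mem_Iic hy
        linarith
      · refine Filter.tendsto_atBot_add_const_left _ _ (Filter.Tendsto.const_mul_atBot hc0 ?_)
        exact Filter.tendsto_atBot_add_const_right _ _ Filter.tendsto_id
  set e := hmono.orderIsoOfSurjective G hsurj with he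
  have heG : ∀ y, G (e.symm y) = y := fun y => e.apply_symm_apply y
  have hGe : ∀ y, e.symm (G y) = y := fun y => e.symm_apply_apply y
  set F : ℝ → ℝ := fun r => ∫ s in (0 : ℝ)..r, f s with hF
  have hFc : ContinuousOn F (Set.Icc 0 r₀) := by
    have h : IntegrableOn f (Set.uIcc 0 r₀) := by
      rw [Set.uIcc_of_le hr₀.le]; exact hf.integrableOn_Icc
    have := intervalIntegral.continuousOn_primitive_interval h
    rwa [Set.uIcc_of_le hr₀.le] at this
  have hFpos : ∀ r, 0 < r → r ≤ r₀ → 0 < F r := fun r hr hrr =>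
    intervalIntegral.intervalIntegral_pos_of_pos_on
      ((hf.mono (by rw [Set.uIcc_of_le hr.le]; exact Set.Icc_subset_Icc le_rfl hrr)).intervalIntegrable)
      (fun x hx => hf0 x ⟨hx.1, hx.2.trans_le hrr⟩) hr
  have hFlt : ∀ r, 0 < r → r < r₀ → F r < F r₀ := fun r hr hrr => by
    have hi : ∀ a b, 0 ≤ a → a ≤ b → b ≤ r₀ →
        IntervalIntegrable f volume a b := fun a b ha hab hb =>
      (hf.mono (by rw [Set.uIcc_of_le hab]; exact Set.Icc_subset_Icc ha hb)).intervalIntegrable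
    have h1 := intervalIntegral.integral_add_adjacent_intervals (hi 0 r le_rfl hr.le hrr.le)
      (hi r r₀ hr.le hrr.le le_rfl)
    have h2 := intervalIntegral.intervalIntegral_pos_of_pos_on (hi r r₀ hr.le hrr.le le_rfl)
      (fun x hx => hf0 x ⟨hr.trans hx.1, hx.2⟩) hrr
    simp only [hF]; linarith
  have hFM : F r₀ = G M := by
    simp only [hF, hG]; rw [hmass]
    refine intervalIntegral.integral_congr fun t ht => ?_
    rw [Set.uIcc_of_le hM.le] at ht
    exact (hkeq t ht).symm
  refine ⟨fun r => e.symm (F r), e.symm.continuous.comp_continuousOn hFc, ?_, ?_, fun r hr => ?_⟩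
  · simp only [hF, intervalIntegral.integral_same]
    exact (congrArg e.symm hG0.symm).trans (hGe 0)
  · simp only []; rw [hFM, hGe]
  · have hT0 : 0 < e.symm (F r) := by
      rw [← hGe 0, hG0]; exact e.symm.strictMono (hFpos r hr.1 hr.2.le)
    have hTM : e.symm (F r) < M := by
      rw [← hGe M, ← hFM]; exact e.symm.strictMono (hFlt r hr.1 hr.2)
    refine ⟨hT0, hTM, ?_⟩
    have hkT := hkeq _ ⟨hT0.le, hTM.le⟩
    have h1 : HasDerivAt e.symm (k (e.symm (F r)))⁻¹ (F r) :=
      HasDerivAt.of_local_left_inverse e.symm.continuous.continuousAt (hGd _)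
        (hk0 _ hT0.ne').ne' (Filter.Eventually.of_forall heG)
    have h2 : HasDerivAt F (f r) r := by
      refine intervalIntegral.integral_hasDerivAt_right
        ((hf.mono (by rw [Set.uIcc_of_le hr.1.le]; exact Set.Icc_subset_Icc le_rfl hr.2.le)).intervalIntegrable)
        ?_ (hf.continuousAt (Icc_mem_nhds hr.1 hr.2))
      exact (hf.mono Set.Ioo_subset_Icc_self).stronglyMeasurableAtFilter isOpen_Ioo _ hr
    have h3 := h1.comp r h2
    rw [hkT] at h3
    rw [div_eq_inv_mul]
    exact h3

end Transport

section TransportInequality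

lemma transport_amgm {H φ J m μ l α p : ℝ} {n : ℕ} (hH : 0 < H) (hφ : 0 < φ) (hJ : 0 < J)
    (hm : 0 < m) (hμ : 0 < μ) (hl : 0 < l) (hn : 0 < n) (hα : 1 < α) (hp : 0 < p)
    (hκ : n * (α - 1) / (α * p) ≤ 1) (hJm : J * m ^ (n - 1) = μ * (φ / H) ^ (α * p)) :
    H ^ (α * (p - 1) + 1) * (J * m ^ (n - 1)) ≤
      μ ^ (1 - (α - 1) / (α * p)) * (φ ^ (α * (p - 1) + 1) *
        ((1 - n * (α - 1) / (α * p)) * l ^ (n * (α - 1) / (α * p)) +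
          l ^ (n * (α - 1) / (α * p) - 1) * ((α - 1) / (α * p)) * (J + (n - 1 : ℝ) * m))) := by
  have hα0 : 0 < α := by linarith
  have hαp : 0 < α * p := by positivity
  set k := (α - 1) / (α * p) with hk
  have hk0 : 0 < k := div_pos (by linarith) hαp
  have hκe : n * (α - 1) / (α * p) = n * k := by rw [hk]; ring
  rw [hκe] at hκ ⊢
  set ρ := φ / H with hρ
  have hρ0 : 0 < ρ := div_pos hφ hH
  have hφe : φ = H * ρ := by rw [hρ]; field_simp
  have hn1 : (1 : ℝ) ≤ n := by exact_mod_cast hn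
  have hcast : ((n - 1 : ℕ) : ℝ) = (n : ℝ) - 1 := by
    rw [Nat.cast_sub hn, Nat.cast_one]
  have amgm := Real.geom_mean_le_arith_mean3_weighted (w₁ := 1 - n * k) (w₂ := k)
    (w₃ := (n - 1 : ℝ) * k) (p₁ := 1) (p₂ := J / l) (p₃ := m / l) (by linarith) hk0.le
    (mul_nonneg (by linarith) hk0.le) zero_le_one (by positivity) (by positivity) (by ring)
  have e1 : (J / l) ^ k * (m / l) ^ ((n - 1 : ℝ) * k) = (μ * ρ ^ (α * p)) ^ k * l ^ (-(n * k)) := by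
    rw [← hJm, Real.mul_rpow hJ.le (by positivity), ← Real.rpow_natCast m (n - 1),
      ← Real.rpow_mul hm.le, hcast, Real.div_rpow hJ.le hl.le, Real.div_rpow hm.le hl.le,
      Real.rpow_neg hl.le, show (n : ℝ) * k = k + (n - 1) * k by ring, Real.rpow_add hl]
    field_simp
  rw [Real.one_rpow, one_mul, e1] at amgm
  have e2 : (μ * ρ ^ (α * p)) ^ k = μ ^ k * ρ ^ (α - 1) := by
    rw [Real.mul_rpow hμ.le (by positivity), ← Real.rpow_mul hρ0.le]
    congr 2; rw [hk]; field_simp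
  have e3 : H ^ (α * (p - 1) + 1) * (J * m ^ (n - 1)) =
      μ ^ (1 - k) * φ ^ (α * (p - 1) + 1) * (μ ^ k * ρ ^ (α - 1)) := by
    have h1 : μ = μ ^ (1 - k) * μ ^ k := by rw [← Real.rpow_add hμ]; simp
    have h2 : ρ ^ (α * p) = ρ ^ (α * (p - 1) + 1) * ρ ^ (α - 1) := by
      rw [← Real.rpow_add hρ0]; congr 1; ring
    rw [hJm, h2, hφe, Real.mul_rpow hH.le hρ0.le]
    nth_rewrite 1 [h1]; ring
  rw [e3, ← e2]
  have h4 : (μ * ρ ^ (α * p)) ^ k ≤ (1 - n * k) * l ^ (n * k) +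
      l ^ (n * k - 1) * k * (J + (n - 1 : ℝ) * m) := by
    have := mul_le_mul_of_nonneg_right amgm (Real.rpow_nonneg hl.le (n * k))
    rw [mul_assoc, ← Real.rpow_add hl, neg_add_cancel, Real.rpow_zero, mul_one] at this
    refine this.trans_eq ?_
    rw [Real.rpow_sub_one hl.ne']
    field_simp
    ring
  rw [mul_assoc]
  gcongr

end TransportInequality

section PartsAndHolder

lemma lipschitzOnWith_rpow {φ : ℝ → ℝ} {K : NNReal} (hφ : LipschitzWith K φ) {a b q : ℝ}
    (h0 : ∀ x ∈ Set.Icc a b, 0 ≤ φ x) (hq : 1 < q) :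
    ∃ L, LipschitzOnWith L (fun x => φ x ^ q) (Set.Icc a b) := by
  obtain ⟨B, hB⟩ := (isCompact_Icc (a := a) (b := b)).bddAbove_image hφ.continuous.continuousOn
  have hB' : ∀ x ∈ Set.Icc a b, φ x ∈ Set.Icc 0 B := fun x hx => ⟨h0 x hx, hB ⟨x, hx, rfl⟩⟩
  have hL : LipschitzOnWith (q * (max B 0) ^ (q - 1)).toNNReal (fun y : ℝ => y ^ q)
      (Set.Icc 0 B) := by
    refine (convex_Icc 0 B).lipschitzOnWith_of_nnnorm_hasDerivWithin_le
      (f' := fun y => q * y ^ (q - 1)) (fun y hy =>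
        (Real.hasDerivAt_rpow_const (Or.inr hq.le)).hasDerivWithinAt) fun y hy => ?_
    rw [← NNReal.coe_le_coe, coe_nnnorm, Real.norm_of_nonneg
      (mul_nonneg (by linarith) (Real.rpow_nonneg hy.1 _)), Real.coe_toNNReal _ (by positivity)]
    have h1 : y ^ (q - 1) ≤ (max B 0) ^ (q - 1) :=
      Real.rpow_le_rpow hy.1 (hy.2.trans (le_max_left _ _)) (by linarith)
    gcongr
  exact ⟨_, hL.comp (hφ.lipschitzOnWith (s := Set.Icc a b)) hB'⟩

lemma lipschitzOnWith_of_hasDerivAt {V V' : ℝ → ℝ} {a b : ℝ}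
    (hV : ∀ x ∈ Set.Icc a b, HasDerivAt V (V' x) x) (hV' : ContinuousOn V' (Set.Icc a b)) :
    ∃ L, LipschitzOnWith L V (Set.Icc a b) := by
  obtain ⟨C, hC⟩ := (isCompact_Icc (a := a) (b := b)).exists_bound_of_continuousOn hV'
  refine ⟨C.toNNReal, (convex_Icc a b).lipschitzOnWith_of_nnnorm_hasDerivWithin_le
      (fun y hy => (hV y hy).hasDerivWithinAt) fun y hy => ?_⟩
  rw [← NNReal.coe_le_coe, coe_nnnorm]
  exact (hC y hy).trans (Real.le_coe_toNNReal C)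

lemma integral_rpow_mul_deriv_le {φ V V' : ℝ → ℝ} {K : NNReal} (hφ : LipschitzWith K φ)
    {a b q : ℝ} (hab : a ≤ b) (h0 : ∀ x ∈ Set.Icc a b, 0 ≤ φ x) (hq : 1 < q)
    (hV : ∀ x ∈ Set.Icc a b, HasDerivAt V (V' x) x) (hV' : ContinuousOn V' (Set.Icc a b))
    (hV0 : ∀ x ∈ Set.Icc a b, 0 ≤ V x) :
    ∫ x in a..b, φ x ^ q * V' x ≤
      φ b ^ q * V b + q * ∫ x in a..b, |deriv φ x| * (φ x ^ (q - 1) * V x) := by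
  obtain ⟨L₁, hL₁⟩ := lipschitzOnWith_rpow hφ h0 hq
  obtain ⟨L₂, hL₂⟩ := lipschitzOnWith_of_hasDerivAt hV hV'
  rw [← Set.uIcc_of_le hab] at hL₁ hL₂
  have ibp := hL₁.absolutelyContinuousOnInterval.integral_mul_deriv_eq_deriv_mul
    hL₂.absolutelyContinuousOnInterval
  have hVc : ContinuousOn V (Set.Icc a b) := fun x hx => (hV x hx).continuousAt.continuousWithinAt
  have e1 : ∫ x in a..b, φ x ^ q * V' x = ∫ x in a..b, φ x ^ q * deriv V x := by
    refine intervalIntegral.integral_congr fun x hx => ?_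
    rw [Set.uIcc_of_le hab] at hx
    simp only [(hV x hx).deriv]
  rw [e1, ibp]
  have e2 : ∫ x in a..b, deriv (fun x => φ x ^ q) x * V x =
      ∫ x in a..b, q * (deriv φ x * (φ x ^ (q - 1) * V x)) := by
    refine intervalIntegral.integral_congr_ae ?_
    filter_upwards [hφ.ae_differentiableAt_real] with x hx _
    rw [(hx.hasDerivAt.rpow_const (Or.inr hq.le)).deriv]; ring
  have hinteg : ∀ D : ℝ → ℝ, Measurable D → (∀ x, |D x| ≤ K) →
      IntervalIntegrable (fun x => D x * (φ x ^ (q - 1) * V x)) volume a b := by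
    intro D hD hDK
    have hc : ContinuousOn (fun x => φ x ^ (q - 1) * V x) (Set.Icc a b) :=
      (hφ.continuous.continuousOn.rpow_const fun x _ => Or.inr (by linarith)).mul hVc
    rw [intervalIntegrable_iff_integrableOn_Icc_of_le hab]
    exact hc.integrableOn_Icc.bdd_mul hD.aestronglyMeasurable
      (Filter.Eventually.of_forall fun x => (hDK x : ‖D x‖ ≤ K))
  have hd : ∀ x, |deriv φ x| ≤ K := fun x => norm_deriv_le_of_lipschitz hφ
  have e3 : -(∫ x in a..b, deriv φ x * (φ x ^ (q - 1) * V x)) ≤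
      ∫ x in a..b, |deriv φ x| * (φ x ^ (q - 1) * V x) := by
    rw [← intervalIntegral.integral_neg]
    refine intervalIntegral.integral_mono_on hab (hinteg _ (measurable_deriv φ) hd).neg
      (hinteg _ (measurable_deriv φ).abs fun x => by rw [abs_abs]; exact hd x) fun x hx => ?_
    rw [← neg_mul]
    exact mul_le_mul_of_nonneg_right (neg_le_abs _)
      (mul_nonneg (Real.rpow_nonneg (h0 x hx) _) (hV0 x hx))
  rw [e2, intervalIntegral.integral_const_mul]
  have h4 : 0 ≤ φ a ^ q * V a := mul_nonneg
    (Real.rpow_nonneg (h0 a (Set.left_mem_Icc.2 hab)) _) (hV0 a (Set.left_mem_Icc.2 hab))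
  have h5 := mul_le_mul_of_nonneg_left e3 (by linarith : (0 : ℝ) ≤ q)
  linarith

lemma integral_abs_deriv_mul_le {φ c d : ℝ → ℝ} {K : NNReal} (hφ : LipschitzWith K φ)
    {a b p : ℝ} (hab : a ≤ b) (hp : 1 < p) (hc : ContinuousOn c (Set.Icc a b))
    (hd : ContinuousOn d (Set.Icc a b)) (hc0 : ∀ x ∈ Set.Icc a b, 0 ≤ c x)
    (hd0 : ∀ x ∈ Set.Icc a b, 0 ≤ d x) :
    ∫ x in a..b, |deriv φ x| * (c x * d x) ≤
      (∫ x in a..b, (|deriv φ x| * c x) ^ p) ^ (1 / p) *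
        (∫ x in a..b, d x ^ (p / (p - 1))) ^ (1 / (p / (p - 1))) := by
  have hpq : p.HolderConjugate (p / (p - 1)) := Real.HolderConjugate.conjExponent hp
  have hdm : AEStronglyMeasurable d (volume.restrict (Set.Ioc a b)) :=
    (hd.mono Set.Ioc_subset_Icc_self).aestronglyMeasurable measurableSet_Ioc
  have hcm : AEStronglyMeasurable (fun x => |deriv φ x| * c x) (volume.restrict (Set.Ioc a b)) :=
    ((measurable_deriv φ).abs.aestronglyMeasurable).mul
      ((hc.mono Set.Ioc_subset_Icc_self).aestronglyMeasurable measurableSet_Ioc)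
  obtain ⟨C, hC⟩ := (isCompact_Icc (a := a) (b := b)).exists_bound_of_continuousOn hc
  obtain ⟨D, hD⟩ := (isCompact_Icc (a := a) (b := b)).exists_bound_of_continuousOn hd
  have hK : ∀ x, |deriv φ x| ≤ K := fun x => norm_deriv_le_of_lipschitz hφ
  rw [intervalIntegral.integral_of_le hab, intervalIntegral.integral_of_le hab,
    intervalIntegral.integral_of_le hab]
  have key := integral_mul_le_Lp_mul_Lq_of_nonneg (μ := volume.restrict (Set.Ioc a b)) hpq
    (f := fun x => |deriv φ x| * c x) (g := d) ?_ ?_ ?_ ?_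
  · refine le_trans (le_of_eq ?_) key
    refine integral_congr_ae (Filter.Eventually.of_forall fun x => ?_)
    simp only; ring
  · exact (ae_restrict_iff' measurableSet_Ioc).2 (Filter.Eventually.of_forall fun x hx =>
      mul_nonneg (abs_nonneg _) (hc0 x (Set.Ioc_subset_Icc_self hx)))
  · exact (ae_restrict_iff' measurableSet_Ioc).2 (Filter.Eventually.of_forall fun x hx =>
      hd0 x (Set.Ioc_subset_Icc_self hx))
  · refine MemLp.of_bound hcm (K * C) ((ae_restrict_iff' measurableSet_Ioc).2
      (Filter.Eventually.of_forall fun x hx => ?_))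
    rw [norm_mul, Real.norm_eq_abs, abs_abs]
    exact mul_le_mul (hK x) (hC x (Set.Ioc_subset_Icc_self hx)) (norm_nonneg _) K.2
  · exact MemLp.of_bound hdm D ((ae_restrict_iff' measurableSet_Ioc).2
      (Filter.Eventually.of_forall fun x hx => hD x (Set.Ioc_subset_Icc_self hx)))

end PartsAndHolder

section TransportInequality

lemma continuousOn_of_hasDerivAt {R R' : ℝ → ℝ} {s : Set ℝ}
    (hR : ∀ r ∈ s, HasDerivAt R (R' r) r) : ContinuousOn R s :=
  fun x hx => (hR x hx).continuousAt.continuousWithinAt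

lemma transport_pointwise {H φ T T' R R' w μ l α p : ℝ} {n : ℕ} (hH : 0 < H) (hφ : 0 < φ)
    (hT : 0 < T) (hR : 0 < R) (hR' : 0 < R') (hw : R ^ (n - 1) * R' = w)
    (hT' : T' = μ * (φ ^ (α * p) * w) / (H ^ (α * p) * T ^ (n - 1)))
    (hμ : 0 < μ) (hl : 0 < l) (hn : 2 ≤ n) (hα : 1 < α) (hp : 0 < p)
    (hκ : n * (α - 1) / (α * p) ≤ 1) :
    H ^ (α * (p - 1) + 1) * T ^ (n - 1) * T' ≤
      μ ^ (1 - (α - 1) / (α * p)) *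
        ((1 - n * (α - 1) / (α * p)) * l ^ (n * (α - 1) / (α * p)) *
            (φ ^ (α * (p - 1) + 1) * w) +
          l ^ (n * (α - 1) / (α * p) - 1) * ((α - 1) / (α * p)) *
            (φ ^ (α * (p - 1) + 1) *
              (T' * R ^ (n - 1) + T * ((n - 1 : ℕ) * R ^ (n - 1 - 1) * R')))) := by
  have hw0 : 0 < w := by rw [← hw]; positivity
  have hT'0 : 0 < T' := by rw [hT']; positivity
  have hJm : T' / R' * (T / R) ^ (n - 1) = μ * (φ / H) ^ (α * p) := by
    rw [hT', Real.div_rpow hφ.le hH.le, div_pow, ← hw]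
    have := (Real.rpow_pos_of_pos hH (α * p)).ne'
    field_simp
  have key := transport_amgm hH hφ (div_pos hT'0 hR') (div_pos hT hR) hμ hl (by omega) hα hp hκ hJm
  have h1 := mul_le_mul_of_nonneg_right key hw0.le
  have hcast : ((n - 1 : ℕ) : ℝ) = (n : ℝ) - 1 := by
    rw [Nat.cast_sub (by omega), Nat.cast_one]
  have e1 : T' / R' * (T / R) ^ (n - 1) * w = T ^ (n - 1) * T' := by
    rw [← hw, div_pow]; field_simp
  have e2 : (T' / R' + (n - 1 : ℝ) * (T / R)) * w =
      T' * R ^ (n - 1) + T * ((n - 1 : ℕ) * R ^ (n - 1 - 1) * R') := by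
    have : R ^ (n - 1) = R ^ (n - 1 - 1) * R := by rw [← pow_succ]; congr 1; omega
    rw [← hw, hcast, this]; field_simp
  calc H ^ (α * (p - 1) + 1) * T ^ (n - 1) * T'
      = H ^ (α * (p - 1) + 1) * (T' / R' * (T / R) ^ (n - 1)) * w := by
        rw [mul_assoc, ← e1]; ring
    _ ≤ _ := h1
    _ = _ := by rw [← e2]; ring

theorem transport_inequality {φ R R' w h : ℝ → ℝ} {K : NNReal} {n : ℕ} {p α r₀ M l : ℝ}
    (hφ : LipschitzWith K φ) (hφ0 : ∀ r ∈ Set.Ico 0 r₀, 0 < φ r) (hφr : φ r₀ = 0) (hr₀ : 0 < r₀)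
    (hR : ∀ r ∈ Set.Ioc 0 r₀, 0 < R r ∧ 0 < R' r ∧ HasDerivAt R (R' r) r ∧
      R r ^ (n - 1) * R' r = w r)
    (hR'c : ContinuousOn R' (Set.Ioc 0 r₀)) (hwc : ContinuousOn w (Set.Icc 0 r₀))
    (hh : Continuous h) (hh0 : ∀ t, 0 < h t) (hn : 2 ≤ n) (hp : 1 < p) (hα : 1 < α)
    (hκ : n * (α - 1) / (α * p) ≤ 1) (hM : 0 < M) (hl : 0 < l)
    (hinteg : IntegrableOn (fun r => (|deriv φ r| / R' r) ^ p * w r) (Set.Ioc 0 r₀)) :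
    ∫ t in (0 : ℝ)..M, h t ^ (α * (p - 1) + 1) * t ^ (n - 1) ≤
      ((∫ t in (0 : ℝ)..M, h t ^ (α * p) * t ^ (n - 1)) /
        ∫ r in (0 : ℝ)..r₀, φ r ^ (α * p) * w r) ^ (1 - (α - 1) / (α * p)) *
      ((1 - n * (α - 1) / (α * p)) * l ^ (n * (α - 1) / (α * p)) *
          (∫ r in (0 : ℝ)..r₀, φ r ^ (α * (p - 1) + 1) * w r) +
        l ^ (n * (α - 1) / (α * p) - 1) * ((α - 1) / (α * p)) *
          ((α * (p - 1) + 1) * ((∫ r in (0 : ℝ)..r₀, (|deriv φ r| / R' r) ^ p * w r) ^ (1 / p) *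
            ((∫ t in (0 : ℝ)..M, h t ^ (α * p) * t ^ (n - 1) * t ^ (p / (p - 1))) /
              ((∫ t in (0 : ℝ)..M, h t ^ (α * p) * t ^ (n - 1)) /
                ∫ r in (0 : ℝ)..r₀, φ r ^ (α * p) * w r)) ^ (1 / (p / (p - 1)))))) := by
  have hp0 : 0 < p := by linarith
  have hα0 : 0 < α := by linarith
  have hαp : 0 < α * p := by positivity
  have hq1 : 1 < α * (p - 1) + 1 := by nlinarith
  have hpp : 0 < p / (p - 1) := div_pos hp0 (by linarith)
  set q := α * (p - 1) + 1 with hq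
  set a := ∫ r in (0 : ℝ)..r₀, φ r ^ (α * p) * w r with ha
  set A := ∫ t in (0 : ℝ)..M, h t ^ (α * p) * t ^ (n - 1) with hA
  set μ := A / a with hμ
  have hφnn : ∀ r ∈ Set.Icc 0 r₀, 0 ≤ φ r := fun r hr => by
    rcases hr.2.lt_or_eq with h | h
    · exact (hφ0 r ⟨hr.1, h⟩).le
    · rw [h, hφr]
  have hw0 : ∀ r ∈ Set.Ioc 0 r₀, 0 < w r := fun r hr => by
    obtain ⟨h1, h2, -, h4⟩ := hR r hr
    rw [← h4]; positivity
  have hφpc : ∀ s : ℝ, 0 ≤ s → Continuous fun r => φ r ^ s := fun s hs =>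
    hφ.continuous.rpow_const fun _ => Or.inr hs
  have hhc : ∀ s : ℝ, Continuous fun r => h r ^ s := fun s =>
    hh.rpow_const fun x => Or.inl (hh0 x).ne'
  have ha0 : 0 < a := by
    refine intervalIntegral.intervalIntegral_pos_of_pos_on ?_ (fun x hx => ?_) hr₀
    · refine ContinuousOn.intervalIntegrable ?_
      rw [Set.uIcc_of_le hr₀.le]
      exact (hφpc _ hαp.le).continuousOn.mul hwc
    · exact mul_pos (Real.rpow_pos_of_pos (hφ0 x ⟨hx.1.le, hx.2⟩) _) (hw0 x ⟨hx.1, hx.2.le⟩)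
  have hA0 : 0 < A := by
    refine intervalIntegral.intervalIntegral_pos_of_pos_on ?_ (fun x hx => ?_) hM
    · exact ((hhc _).mul (by fun_prop)).intervalIntegrable _ _
    · exact mul_pos (Real.rpow_pos_of_pos (hh0 x) _) (pow_pos hx.1 _)
  have hμ0 : 0 < μ := div_pos hA0 ha0
  obtain ⟨T, hTc, hT0, hTr, hT⟩ := exists_transport (g := fun t => h t ^ (α * p))
    (f := fun r => μ * (φ r ^ (α * p) * w r)) (n := n) (hhc _)
    (fun t => Real.rpow_pos_of_pos (hh0 t) _) hM hr₀
    (continuousOn_const.mul ((hφpc _ hαp.le).continuousOn.mul hwc))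
    (fun r hr => mul_pos hμ0 (mul_pos (Real.rpow_pos_of_pos (hφ0 r ⟨hr.1.le, hr.2⟩) _)
      (hw0 r ⟨hr.1, hr.2.le⟩)))
    (by rw [intervalIntegral.integral_const_mul, hμ, ← ha, div_mul_cancel₀ _ ha0.ne'])
  set b := ∫ r in (0 : ℝ)..r₀, φ r ^ q * w r with hb
  set e := ∫ r in (0 : ℝ)..r₀, (|deriv φ r| / R' r) ^ p * w r with he
  set C := ∫ t in (0 : ℝ)..M, h t ^ (α * p) * t ^ (n - 1) * t ^ (p / (p - 1)) with hC
  set T' : ℝ → ℝ := fun r => μ * (φ r ^ (α * p) * w r) / (h (T r) ^ (α * p) * T r ^ (n - 1))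
    with hT'
  have hTd : ∀ r ∈ Set.Ioo 0 r₀, HasDerivAt T (T' r) r := fun r hr => (hT r hr).2.2
  have hRc : ContinuousOn R (Set.Ioc 0 r₀) :=
    continuousOn_of_hasDerivAt fun r hr => (hR r hr).2.2.1
  have hT'c : ContinuousOn T' (Set.Ioo 0 r₀) := by
    have h1 : ContinuousOn T (Set.Ioo 0 r₀) := hTc.mono Set.Ioo_subset_Icc_self
    refine ContinuousOn.div (continuousOn_const.mul ((hφpc _ hαp.le).continuousOn.mul
      (hwc.mono Set.Ioo_subset_Icc_self))) (((hhc _).comp_continuousOn h1).mul (h1.pow _)) ?_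
    exact fun x hx => (mul_pos (Real.rpow_pos_of_pos (hh0 _) _) (pow_pos (hT x hx).1 _)).ne'
  have key : ∀ ε r, 0 < ε → ε ≤ r → r < r₀ →
      ∫ t in (T ε)..(T r), h t ^ q * t ^ (n - 1) ≤
        μ ^ (1 - (α - 1) / (α * p)) *
        ((1 - n * (α - 1) / (α * p)) * l ^ (n * (α - 1) / (α * p)) * b +
          l ^ (n * (α - 1) / (α * p) - 1) * ((α - 1) / (α * p)) *
            (φ r ^ q * (T r * R r ^ (n - 1)) +
              q * (e ^ (1 / p) * (C / μ) ^ (1 / (p / (p - 1)))))) := by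
    intro ε r hε hεr hr
    have hsub : Set.Icc ε r ⊆ Set.Ioo 0 r₀ := fun x hx => ⟨hε.trans_le hx.1, hx.2.trans_lt hr⟩
    have hsub' : Set.Icc ε r ⊆ Set.Ioc 0 r₀ := hsub.trans Set.Ioo_subset_Ioc_self
    have hTc' : ContinuousOn T (Set.Icc ε r) :=
      hTc.mono (hsub.trans Set.Ioo_subset_Icc_self)
    have hT'c' := hT'c.mono hsub
    have hRc' := hRc.mono hsub'
    have hR'c' := hR'c.mono hsub'
    have hwc' : ContinuousOn w (Set.Icc ε r) := hwc.mono (hsub.trans Set.Ioo_subset_Icc_self)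
    have cov : ∀ G : ℝ → ℝ, ContinuousOn G (Set.Icc 0 M) →
        ∫ x in ε..r, G (T x) * T' x = ∫ t in (T ε)..(T r), G t := by
      intro G hG
      refine intervalIntegral.integral_comp_mul_deriv'' ?_ ?_ ?_ ?_
      · rwa [Set.uIcc_of_le hεr]
      · intro x hx
        rw [min_eq_left hεr, max_eq_right hεr] at hx
        exact (hTd x (hsub (Set.Ioo_subset_Icc_self hx))).hasDerivWithinAt
      · rwa [Set.uIcc_of_le hεr]
      · rw [Set.uIcc_of_le hεr]
        refine hG.mono ?_
        rintro _ ⟨x, hx, rfl⟩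
        exact ⟨(hT x (hsub hx)).1.le, (hT x (hsub hx)).2.1.le⟩
    set V' : ℝ → ℝ := fun x =>
      T' x * R x ^ (n - 1) + T x * ((n - 1 : ℕ) * R x ^ (n - 1 - 1) * R' x) with hV'
    have hV'c : ContinuousOn V' (Set.Icc ε r) :=
      (hT'c'.mul (hRc'.pow _)).add
        (hTc'.mul ((continuousOn_const.mul (hRc'.pow _)).mul hR'c'))
    have hφq : ContinuousOn (fun x => φ x ^ q) (Set.Icc ε r) :=
      (hφpc q (by linarith)).continuousOn
    have ii : ∀ {G : ℝ → ℝ}, ContinuousOn G (Set.Icc ε r) → IntervalIntegrable G volume ε r :=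
      fun {G} hG => ContinuousOn.intervalIntegrable (by rwa [Set.uIcc_of_le hεr])
    have s1 : ∫ t in (T ε)..(T r), h t ^ q * t ^ (n - 1) ≤
        μ ^ (1 - (α - 1) / (α * p)) *
        ((1 - n * (α - 1) / (α * p)) * l ^ (n * (α - 1) / (α * p)) *
            (∫ x in ε..r, φ x ^ q * w x) +
          l ^ (n * (α - 1) / (α * p) - 1) * ((α - 1) / (α * p)) *
            ∫ x in ε..r, φ x ^ q * V' x) := by
      have i1 : IntervalIntegrable (fun x => (1 - n * (α - 1) / (α * p)) *
          l ^ (n * (α - 1) / (α * p)) * (φ x ^ q * w x)) volume ε r :=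
        ii (continuousOn_const.mul (hφq.mul hwc'))
      have i2 : IntervalIntegrable (fun x => l ^ (n * (α - 1) / (α * p) - 1) *
          ((α - 1) / (α * p)) * (φ x ^ q * V' x)) volume ε r :=
        ii (continuousOn_const.mul (hφq.mul hV'c))
      rw [← cov (fun t => h t ^ q * t ^ (n - 1)) ((hhc _).mul (by fun_prop)).continuousOn,
        ← intervalIntegral.integral_const_mul, ← intervalIntegral.integral_const_mul,
        ← intervalIntegral.integral_add i1 i2,
        ← intervalIntegral.integral_const_mul]
      refine intervalIntegral.integral_mono_on hεr (ii ?_) (ii ?_) fun x hx => ?_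
      · exact ((((hhc _).comp_continuousOn hTc').mul (hTc'.pow _))).mul hT'c'
      · exact continuousOn_const.mul ((continuousOn_const.mul (hφq.mul hwc')).add
          (continuousOn_const.mul (hφq.mul hV'c)))
      · obtain ⟨h1, h2, -, h4⟩ := hR x (hsub' hx)
        exact transport_pointwise (hh0 _) (hφ0 x ⟨(hsub hx).1.le, (hsub hx).2⟩)
          (hT x (hsub hx)).1 h1 h2 h4 rfl hμ0 hl hn hα hp0 hκ
    have s2 := integral_rpow_mul_deriv_le hφ hεr
      (fun x hx => hφnn x (Set.Ioo_subset_Icc_self (hsub hx))) hq1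
      (V := fun x => T x * R x ^ (n - 1)) (V' := V')
      (fun x hx => (hTd x (hsub hx)).mul ((hR x (hsub' hx)).2.2.1.pow (n - 1))) hV'c
      (fun x hx => mul_nonneg (hT x (hsub hx)).1.le (pow_nonneg (hR x (hsub' hx)).1.le _))
    have s3 := integral_abs_deriv_mul_le hφ hεr hp
      (c := fun x => w x ^ (1 / p) / R' x)
      (d := fun x => φ x ^ (q - 1) * T x * w x ^ (1 / (p / (p - 1))))
      ((hwc'.rpow_const fun x hx => Or.inl (hw0 x (hsub' hx)).ne').div hR'c'
        fun x hx => (hR x (hsub' hx)).2.1.ne')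
      (((hφpc _ (by linarith)).continuousOn.mul hTc').mul
        (hwc'.rpow_const fun x hx => Or.inl (hw0 x (hsub' hx)).ne'))
      (fun x hx => div_nonneg (Real.rpow_nonneg (hw0 x (hsub' hx)).le _) (hR x (hsub' hx)).2.1.le)
      (fun x hx => mul_nonneg (mul_nonneg (Real.rpow_nonneg
        (hφ0 x ⟨(hsub hx).1.le, (hsub hx).2⟩).le _) (hT x (hsub hx)).1.le)
          (Real.rpow_nonneg (hw0 x (hsub' hx)).le _))
    have e1 : ∫ x in ε..r, |deriv φ x| * (φ x ^ (q - 1) * (T x * R x ^ (n - 1))) =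
        ∫ x in ε..r, |deriv φ x| * (w x ^ (1 / p) / R' x *
          (φ x ^ (q - 1) * T x * w x ^ (1 / (p / (p - 1))))) := by
      refine intervalIntegral.integral_congr fun x hx => ?_
      rw [Set.uIcc_of_le hεr] at hx
      obtain ⟨h1, h2, -, h4⟩ := hR x (hsub' hx)
      have hw' : w x ^ (1 / p) * w x ^ (1 / (p / (p - 1))) = R x ^ (n - 1) * R' x := by
        rw [← Real.rpow_add (hw0 x (hsub' hx)), h4]
        have : 1 / p + 1 / (p / (p - 1)) = 1 := by
          have : p - 1 ≠ 0 := by linarith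
          field_simp; ring
        rw [this, Real.rpow_one]
      calc |deriv φ x| * (φ x ^ (q - 1) * (T x * R x ^ (n - 1)))
          = |deriv φ x| * φ x ^ (q - 1) * T x * (R x ^ (n - 1) * R' x) / R' x := by field_simp
        _ = _ := by rw [← hw']; ring
    have e2 : ∫ x in ε..r, (|deriv φ x| * (w x ^ (1 / p) / R' x)) ^ p ≤ e := by
      have : ∫ x in ε..r, (|deriv φ x| * (w x ^ (1 / p) / R' x)) ^ p =
          ∫ x in ε..r, (|deriv φ x| / R' x) ^ p * w x := by
        refine intervalIntegral.integral_congr fun x hx => ?_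
        rw [Set.uIcc_of_le hεr] at hx
        obtain ⟨h1, h2, -, h4⟩ := hR x (hsub' hx)
        have hwx := hw0 x (hsub' hx)
        rw [show |deriv φ x| * (w x ^ (1 / p) / R' x) = |deriv φ x| / R' x * w x ^ (1 / p) by ring,
          Real.mul_rpow (by positivity) (by positivity), ← Real.rpow_mul hwx.le,
          one_div_mul_cancel hp0.ne', Real.rpow_one]
      rw [this]
      refine intervalIntegral.integral_mono_interval hε.le hεr hr.le ?_ ?_
      · refine (ae_restrict_iff' measurableSet_Ioc).2 (Filter.Eventually.of_forall fun x hx => ?_)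
        exact mul_nonneg (Real.rpow_nonneg (div_nonneg (abs_nonneg _) (hR x hx).2.1.le) _)
          (hw0 x hx).le
      · rwa [intervalIntegrable_iff_integrableOn_Ioc_of_le hr₀.le]
    have hCint : Continuous fun t : ℝ => h t ^ (α * p) * t ^ (n - 1) * t ^ (p / (p - 1)) :=
      ((hhc _).mul (by fun_prop)).mul (Real.continuous_rpow_const hpp.le)
    have hmem : ∀ x ∈ Set.Icc ε r, T x ∈ Set.Ioo 0 M := fun x hx =>
      ⟨(hT x (hsub hx)).1, (hT x (hsub hx)).2.1⟩
    have hmono : T ε ≤ T r := by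
      have h1 : MonotoneOn T (Set.Icc ε r) := by
        refine monotoneOn_of_deriv_nonneg (convex_Icc ε r) hTc' ?_ fun x hx => ?_
        · intro x hx
          rw [interior_Icc] at hx
          exact (hTd x (hsub (Set.Ioo_subset_Icc_self hx))).differentiableAt.differentiableWithinAt
        · rw [interior_Icc] at hx
          have hx' := Set.Ioo_subset_Icc_self hx
          rw [(hTd x (hsub hx')).deriv]
          exact div_nonneg (mul_nonneg hμ0.le (mul_nonneg (Real.rpow_nonneg
            (hφ0 x ⟨(hsub hx').1.le, (hsub hx').2⟩).le _) (hw0 x (hsub' hx')).le))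
            (mul_nonneg (Real.rpow_nonneg (hh0 _).le _) (pow_nonneg (hmem x hx').1.le _))
      exact h1 (Set.left_mem_Icc.2 hεr) (Set.right_mem_Icc.2 hεr) hεr
    have e3 : ∫ x in ε..r, (φ x ^ (q - 1) * T x * w x ^ (1 / (p / (p - 1)))) ^ (p / (p - 1)) ≤
        C / μ := by
      have : ∫ x in ε..r, (φ x ^ (q - 1) * T x * w x ^ (1 / (p / (p - 1)))) ^ (p / (p - 1)) =
          ∫ x in ε..r, μ⁻¹ * (h (T x) ^ (α * p) * T x ^ (n - 1) * T x ^ (p / (p - 1)) * T' x) := by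
        refine intervalIntegral.integral_congr fun x hx => ?_
        rw [Set.uIcc_of_le hεr] at hx
        have hwx := hw0 x (hsub' hx)
        have hφx := hφ0 x ⟨(hsub hx).1.le, (hsub hx).2⟩
        have hTx := (hmem x hx).1
        have hhx := Real.rpow_pos_of_pos (hh0 (T x)) (α * p)
        simp only [hT']
        rw [Real.mul_rpow (by positivity) (by positivity), Real.mul_rpow (by positivity) hTx.le,
          ← Real.rpow_mul hwx.le, one_div_mul_cancel hpp.ne', Real.rpow_one,
          ← Real.rpow_mul hφx.le]
        have : (q - 1) * (p / (p - 1)) = α * p := by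
          have : p - 1 ≠ 0 := by linarith
          rw [hq]; field_simp; ring
        rw [this]
        field_simp
      rw [this, intervalIntegral.integral_const_mul,
        cov (fun t => h t ^ (α * p) * t ^ (n - 1) * t ^ (p / (p - 1))) hCint.continuousOn,
        inv_mul_eq_div]
      gcongr
      refine intervalIntegral.integral_mono_interval (hmem ε (Set.left_mem_Icc.2 hεr)).1.le hmono
        (hmem r (Set.right_mem_Icc.2 hεr)).2.le ?_ (hCint.intervalIntegrable _ _)
      refine (ae_restrict_iff' measurableSet_Ioc).2 (Filter.Eventually.of_forall fun x hx => ?_)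
      exact mul_nonneg (mul_nonneg (Real.rpow_nonneg (hh0 _).le _) (pow_nonneg hx.1.le _))
        (Real.rpow_nonneg hx.1.le _)
    have e4 : ∫ x in ε..r, φ x ^ q * w x ≤ b := by
      refine intervalIntegral.integral_mono_interval hε.le hεr hr.le ?_ ?_
      · refine (ae_restrict_iff' measurableSet_Ioc).2 (Filter.Eventually.of_forall fun x hx => ?_)
        exact mul_nonneg (Real.rpow_nonneg (hφnn x (Set.Ioc_subset_Icc_self hx)) _) (hw0 x hx).le
      · refine ContinuousOn.intervalIntegrable ?_
        rw [Set.uIcc_of_le hr₀.le]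
        exact (hφpc q (by linarith)).continuousOn.mul hwc
    have nn1 : 0 ≤ ∫ x in ε..r, (|deriv φ x| * (w x ^ (1 / p) / R' x)) ^ p :=
      intervalIntegral.integral_nonneg hεr fun x hx => Real.rpow_nonneg (mul_nonneg (abs_nonneg _)
        (div_nonneg (Real.rpow_nonneg (hw0 x (hsub' hx)).le _) (hR x (hsub' hx)).2.1.le)) _
    have nn2 : 0 ≤ ∫ x in ε..r,
        (φ x ^ (q - 1) * T x * w x ^ (1 / (p / (p - 1)))) ^ (p / (p - 1)) :=
      intervalIntegral.integral_nonneg hεr fun x hx => Real.rpow_nonneg (mul_nonneg (mul_nonneg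
        (Real.rpow_nonneg (hφ0 x ⟨(hsub hx).1.le, (hsub hx).2⟩).le _) (hmem x hx).1.le)
        (Real.rpow_nonneg (hw0 x (hsub' hx)).le _)) _
    have e5 : ∫ x in ε..r, |deriv φ x| * (φ x ^ (q - 1) * (T x * R x ^ (n - 1))) ≤
        e ^ (1 / p) * (C / μ) ^ (1 / (p / (p - 1))) := by
      rw [e1]
      refine s3.trans (mul_le_mul (Real.rpow_le_rpow nn1 e2 (by positivity))
        (Real.rpow_le_rpow nn2 e3 (by positivity)) (Real.rpow_nonneg nn2 _)
        (Real.rpow_nonneg (nn1.trans e2) _))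
    refine s1.trans (mul_le_mul_of_nonneg_left (add_le_add
      (mul_le_mul_of_nonneg_left e4 ?_) (mul_le_mul_of_nonneg_left ?_ ?_)) ?_)
    · exact mul_nonneg (by linarith) (Real.rpow_nonneg hl.le _)
    · exact s2.trans (add_le_add le_rfl (mul_le_mul_of_nonneg_left e5 (by linarith)))
    · exact mul_nonneg (Real.rpow_nonneg hl.le _) (div_nonneg (by linarith) hαp.le)
    · exact Real.rpow_nonneg hμ0.le _
  have hGc : Continuous fun t => h t ^ q * t ^ (n - 1) := (hhc q).mul (by fun_prop)
  have hPc : Continuous fun z => ∫ t in (0 : ℝ)..z, h t ^ q * t ^ (n - 1) :=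
    intervalIntegral.continuous_primitive (fun _ _ => hGc.intervalIntegrable _ _) 0
  have lim_l : Filter.Tendsto (fun ε => r₀ - ε) (nhdsWithin 0 (Set.Ioi 0))
      (nhdsWithin r₀ (Set.Icc 0 r₀)) := by
    refine tendsto_nhdsWithin_iff.2 ⟨?_, ?_⟩
    · have : Filter.Tendsto (fun ε => r₀ - ε) (nhds 0) (nhds (r₀ - 0)) :=
        (continuous_const.sub continuous_id).tendsto 0
      rw [sub_zero] at this
      exact this.mono_left nhdsWithin_le_nhds
    · filter_upwards [Ioo_mem_nhdsGT hr₀] with ε hε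
      exact ⟨by linarith [hε.2], by linarith [hε.1]⟩
  have lim_0 : Filter.Tendsto (fun ε : ℝ => ε) (nhdsWithin 0 (Set.Ioi 0))
      (nhdsWithin 0 (Set.Icc 0 r₀)) := by
    refine tendsto_nhdsWithin_iff.2 ⟨nhdsWithin_le_nhds, ?_⟩
    filter_upwards [Ioo_mem_nhdsGT hr₀] with ε hε
    exact ⟨hε.1.le, hε.2.le⟩
  have limT0 : Filter.Tendsto (fun ε => T ε) (nhdsWithin 0 (Set.Ioi 0)) (nhds 0) := by
    have := (hTc 0 (Set.left_mem_Icc.2 hr₀.le)).tendsto.comp lim_0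
    rwa [hT0] at this
  have limTr : Filter.Tendsto (fun ε => T (r₀ - ε)) (nhdsWithin 0 (Set.Ioi 0)) (nhds M) := by
    have := (hTc r₀ (Set.right_mem_Icc.2 hr₀.le)).tendsto.comp lim_l
    rwa [hTr] at this
  have limR : Filter.Tendsto (fun ε => R (r₀ - ε)) (nhdsWithin 0 (Set.Ioi 0)) (nhds (R r₀)) :=
    (hR r₀ ⟨hr₀, le_rfl⟩).2.2.1.continuousAt.tendsto.comp
      (lim_l.mono_right nhdsWithin_le_nhds)
  have limφ : Filter.Tendsto (fun ε => φ (r₀ - ε) ^ q) (nhdsWithin 0 (Set.Ioi 0)) (nhds 0) := by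
    have := ((hφpc q (by linarith)).tendsto r₀).comp (lim_l.mono_right nhdsWithin_le_nhds)
    rw [hφr, Real.zero_rpow (by linarith)] at this
    exact this
  have limL : Filter.Tendsto (fun ε => ∫ t in (T ε)..(T (r₀ - ε)), h t ^ q * t ^ (n - 1))
      (nhdsWithin 0 (Set.Ioi 0)) (nhds (∫ t in (0 : ℝ)..M, h t ^ q * t ^ (n - 1))) := by
    have h1 := ((hPc.tendsto M).comp limTr).sub ((hPc.tendsto 0).comp limT0)
    simp only [intervalIntegral.integral_same, sub_zero] at h1
    refine h1.congr fun ε => ?_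
    exact intervalIntegral.integral_interval_sub_left (hGc.intervalIntegrable _ _)
      (hGc.intervalIntegrable _ _)
  have limRhs := (limφ.mul (limTr.mul (limR.pow (n - 1))))
  rw [zero_mul] at limRhs
  have limRhs' := ((((limRhs.add_const (q * (e ^ (1 / p) * (C / μ) ^ (1 / (p / (p - 1)))))
    ).const_mul
    (l ^ (n * (α - 1) / (α * p) - 1) * ((α - 1) / (α * p)))).const_add
      ((1 - n * (α - 1) / (α * p)) * l ^ (n * (α - 1) / (α * p)) * b)).const_mul
        (μ ^ (1 - (α - 1) / (α * p))))
  rw [zero_add] at limRhs'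
  refine le_of_tendsto_of_tendsto limL limRhs' ?_
  filter_upwards [Ioo_mem_nhdsGT (half_pos hr₀)] with ε hε
  exact key ε (r₀ - ε) hε.1 (by linarith [hε.2]) (by linarith [hε.1])

end TransportInequality

section RadialGeometry

lemma continuousOn_hypWeight (n : ℕ) : ContinuousOn (hypWeight n) (Set.Ioo (-1) 1) := by
  refine ContinuousOn.mul (ContinuousOn.pow (continuousOn_const.div (by fun_prop) ?_) _)
    (by fun_prop)
  intro x hx
  have := hx.1; have := hx.2
  nlinarith

lemma hypWeight_pos (n : ℕ) {r : ℝ} (h0 : 0 < r) (h1 : r < 1) : 0 < hypWeight n r := by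
  have : 0 < 1 - r ^ 2 := by nlinarith
  unfold hypWeight; positivity

/-- The normalised hyperbolic volume of the ball of Euclidean radius `r`. -/
noncomputable def hypMass (n : ℕ) (r : ℝ) : ℝ := n * ∫ s in (0 : ℝ)..r, hypWeight n s

lemma intervalIntegrable_hypWeight (n : ℕ) {r : ℝ} (h0 : 0 ≤ r) (h1 : r < 1) :
    IntervalIntegrable (hypWeight n) volume 0 r := by
  refine ((continuousOn_hypWeight n).mono ?_).intervalIntegrable
  rw [Set.uIcc_of_le h0]
  exact fun x hx => ⟨by linarith [hx.1], hx.2.trans_lt h1⟩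

lemma hasDerivAt_hypMass (n : ℕ) {r : ℝ} (h0 : 0 ≤ r) (h1 : r < 1) :
    HasDerivAt (hypMass n) (n * hypWeight n r) r := by
  have hr : r ∈ Set.Ioo (-1 : ℝ) 1 := ⟨by linarith, h1⟩
  exact (intervalIntegral.integral_hasDerivAt_right (intervalIntegrable_hypWeight n h0 h1)
    ((continuousOn_hypWeight n).stronglyMeasurableAtFilter isOpen_Ioo _ hr)
    ((continuousOn_hypWeight n).continuousAt (isOpen_Ioo.mem_nhds hr))).const_mul _

lemma hypMass_zero (n : ℕ) : hypMass n 0 = 0 := by simp [hypMass]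

lemma hypMass_pos {n : ℕ} (hn : 0 < n) {r : ℝ} (h0 : 0 < r) (h1 : r < 1) : 0 < hypMass n r := by
  refine mul_pos (by exact_mod_cast hn) ?_
  exact intervalIntegral.intervalIntegral_pos_of_pos_on (intervalIntegrable_hypWeight n h0.le h1)
    (fun x hx => hypWeight_pos n hx.1 (hx.2.trans h1)) h0

lemma nonneg_of_hasDerivAt_nonneg {f f' : ℝ → ℝ} (hc : ContinuousOn f (Set.Ico 0 1))
    (h0 : f 0 = 0) (hd : ∀ x ∈ Set.Ioo (0 : ℝ) 1, HasDerivAt f (f' x) x)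
    (hf' : ∀ x ∈ Set.Ioo (0 : ℝ) 1, 0 ≤ f' x) {r : ℝ} (hr : r ∈ Set.Ico (0 : ℝ) 1) : 0 ≤ f r := by
  have h : MonotoneOn f (Set.Ico 0 1) := by
    refine monotoneOn_of_deriv_nonneg (convex_Ico 0 1) hc ?_ ?_
    · rw [interior_Ico]
      exact fun x hx => (hd x hx).differentiableAt.differentiableWithinAt
    · rw [interior_Ico]
      exact fun x hx => by rw [(hd x hx).deriv]; exact hf' x hx
  rw [← h0]
  exact h ⟨le_rfl, zero_lt_one⟩ hr hr.1

lemma hasDerivAt_sinh_radius {r : ℝ} (h0 : 0 ≤ r) (h1 : r < 1) :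
    HasDerivAt (fun r : ℝ => 2 * r / (1 - r ^ 2))
      ((1 + r ^ 2) / (1 - r ^ 2) * (2 / (1 - r ^ 2))) r := by
  have hp : 1 - r ^ 2 ≠ 0 := by nlinarith
  have h := ((hasDerivAt_id' r).const_mul 2).div ((hasDerivAt_pow 2 r).const_sub 1) hp
  refine h.congr_deriv ?_
  simp only [Nat.cast_ofNat, pow_one, Nat.add_one_sub_one]
  field_simp
  ring

lemma hasDerivAt_cosh_radius {r : ℝ} (h0 : 0 ≤ r) (h1 : r < 1) :
    HasDerivAt (fun r : ℝ => (1 + r ^ 2) / (1 - r ^ 2))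
      (2 * r / (1 - r ^ 2) * (2 / (1 - r ^ 2))) r := by
  have hp : 1 - r ^ 2 ≠ 0 := by nlinarith
  have h := ((hasDerivAt_pow 2 r).const_add 1).div ((hasDerivAt_pow 2 r).const_sub 1) hp
  refine h.congr_deriv ?_
  simp only [Nat.cast_ofNat, pow_one, Nat.add_one_sub_one]
  field_simp
  ring

lemma hypWeight_eq {n : ℕ} (hn : 0 < n) (r : ℝ) :
    hypWeight n r = (2 * r / (1 - r ^ 2)) ^ (n - 1) * (2 / (1 - r ^ 2)) := by
  obtain ⟨m, rfl⟩ : ∃ m, n = m + 1 := ⟨n - 1, by omega⟩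
  simp only [hypWeight, Nat.add_sub_cancel, pow_succ]
  rw [mul_div_right_comm, mul_pow]; ring

lemma continuousOn_hypMass (n : ℕ) : ContinuousOn (hypMass n) (Set.Ico 0 1) := fun _ hr =>
  (hasDerivAt_hypMass n hr.1 hr.2).continuousAt.continuousWithinAt

lemma hypMass_nonneg {n : ℕ} (hn : 0 < n) {r : ℝ} (h0 : 0 ≤ r) (h1 : r < 1) :
    0 ≤ hypMass n r := by
  rcases h0.eq_or_lt with rfl | h
  · rw [hypMass_zero]
  · exact (hypMass_pos hn h h1).le

lemma mul_hypMass_le_sinh_pow {n : ℕ} (hn : 3 ≤ n) {r : ℝ} (hr : r ∈ Set.Ico (0 : ℝ) 1) :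
    ((n : ℝ) - 1) / n * hypMass n r ≤ (2 * r / (1 - r ^ 2)) ^ (n - 1) := by
  have hn0 : (0 : ℝ) < n := by exact_mod_cast (by omega : 0 < n)
  have hcast : ((n - 1 : ℕ) : ℝ) = (n : ℝ) - 1 := by
    rw [Nat.cast_sub (by omega), Nat.cast_one]
  have hn1 : (0 : ℝ) ≤ (n : ℝ) - 1 := by rw [← hcast]; positivity
  have hd : ∀ x ∈ Set.Ico (0 : ℝ) 1, HasDerivAt
      (fun r => (2 * r / (1 - r ^ 2)) ^ (n - 1) - ((n : ℝ) - 1) / n * hypMass n r)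
      ((n - 1 : ℕ) * (2 * x / (1 - x ^ 2)) ^ (n - 1 - 1) *
        ((1 + x ^ 2) / (1 - x ^ 2) * (2 / (1 - x ^ 2))) -
          ((n : ℝ) - 1) / n * (n * hypWeight n x)) x :=
    fun x hx => ((hasDerivAt_sinh_radius hx.1 hx.2).pow (n - 1)).sub
      ((hasDerivAt_hypMass n hx.1 hx.2).const_mul _)
  have := nonneg_of_hasDerivAt_nonneg
    (fun x hx => (hd x hx).continuousAt.continuousWithinAt) ?_
    (fun x hx => hd x (Set.Ioo_subset_Ico_self hx)) ?_ hr
  · linarith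
  · simp only [hypMass_zero]
    rw [mul_zero, zero_div, zero_pow (by omega)]; simp
  · intro x hx
    have hp : 0 < 1 - x ^ 2 := by nlinarith [hx.1, hx.2]
    have hx0 := hx.1
    rw [hypWeight_eq (by omega), hcast]
    have : (2 * x / (1 - x ^ 2)) ^ (n - 1) =
        (2 * x / (1 - x ^ 2)) ^ (n - 1 - 1) * (2 * x / (1 - x ^ 2)) := by
      rw [← pow_succ]; congr 1; omega
    rw [this]
    have e : ((n : ℝ) - 1) * (2 * x / (1 - x ^ 2)) ^ (n - 1 - 1) *
        ((1 + x ^ 2) / (1 - x ^ 2) * (2 / (1 - x ^ 2))) - ((n : ℝ) - 1) / n *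
          (n * ((2 * x / (1 - x ^ 2)) ^ (n - 1 - 1) * (2 * x / (1 - x ^ 2)) * (2 / (1 - x ^ 2)))) =
        ((n : ℝ) - 1) * (2 * x / (1 - x ^ 2)) ^ (n - 1 - 1) * (2 / (1 - x ^ 2)) *
          ((1 - x) ^ 2 / (1 - x ^ 2)) := by
      field_simp; ring
    rw [e]; positivity

lemma sinh_pow_mul_cosh_ge {n : ℕ} (hn : 3 ≤ n) {r : ℝ} (hr : r ∈ Set.Ico (0 : ℝ) 1) :
    hypMass n r + (((n : ℝ) - 1) / n * hypMass n r) ^ (((n : ℝ) + 1) / (n - 1)) ≤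
      (2 * r / (1 - r ^ 2)) ^ n * ((1 + r ^ 2) / (1 - r ^ 2)) := by
  have hn0 : (0 : ℝ) < n := by exact_mod_cast (by omega : 0 < n)
  have hn1 : (0 : ℝ) < (n : ℝ) - 1 := by
    have : (3 : ℝ) ≤ n := by exact_mod_cast hn
    linarith
  have he : 1 ≤ ((n : ℝ) + 1) / (n - 1) := by rw [le_div_iff₀ hn1]; linarith
  have hd : ∀ x ∈ Set.Ico (0 : ℝ) 1, HasDerivAt
      (fun r => (2 * r / (1 - r ^ 2)) ^ n * ((1 + r ^ 2) / (1 - r ^ 2)) - (hypMass n r +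
        (((n : ℝ) - 1) / n * hypMass n r) ^ (((n : ℝ) + 1) / (n - 1))))
      ((n * (2 * x / (1 - x ^ 2)) ^ (n - 1) * ((1 + x ^ 2) / (1 - x ^ 2) * (2 / (1 - x ^ 2)))) *
          ((1 + x ^ 2) / (1 - x ^ 2)) + (2 * x / (1 - x ^ 2)) ^ n *
            (2 * x / (1 - x ^ 2) * (2 / (1 - x ^ 2))) - (n * hypWeight n x +
        ((n : ℝ) - 1) / n * (n * hypWeight n x) * (((n : ℝ) + 1) / (n - 1)) *
          (((n : ℝ) - 1) / n * hypMass n x) ^ (((n : ℝ) + 1) / (n - 1) - 1))) x :=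
    fun x hx => (((hasDerivAt_sinh_radius hx.1 hx.2).pow n).mul
      (hasDerivAt_cosh_radius hx.1 hx.2)).sub ((hasDerivAt_hypMass n hx.1 hx.2).add
        (((hasDerivAt_hypMass n hx.1 hx.2).const_mul _).rpow_const (Or.inr he)))
  have := nonneg_of_hasDerivAt_nonneg
    (fun x hx => (hd x hx).continuousAt.continuousWithinAt) ?_
    (fun x hx => hd x (Set.Ioo_subset_Ico_self hx)) ?_ hr
  · linarith
  · simp only [hypMass_zero]
    rw [mul_zero, zero_div, zero_pow (by omega), mul_zero, Real.zero_rpow (by linarith)]; simp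
  · intro x hx
    have hp : 0 < 1 - x ^ 2 := by nlinarith [hx.1, hx.2]
    have hx0 := hx.1
    set s := 2 * x / (1 - x ^ 2) with hs
    have hs0 : 0 < s := by positivity
    have hsC : ((1 + x ^ 2) / (1 - x ^ 2)) ^ 2 = 1 + s ^ 2 := by rw [hs]; field_simp; ring
    rw [hypWeight_eq (by omega), ← hs]
    set τ := 2 / (1 - x ^ 2) with hτ
    set Z := (((n : ℝ) - 1) / n * hypMass n x) ^ (((n : ℝ) + 1) / (n - 1) - 1) with hZ
    have hX := mul_hypMass_le_sinh_pow hn (Set.Ioo_subset_Ico_self hx)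
    rw [← hs] at hX
    have hcast : ((n - 1 : ℕ) : ℝ) = (n : ℝ) - 1 := by
      rw [Nat.cast_sub (by omega), Nat.cast_one]
    have hZle : Z ≤ s ^ 2 := by
      have h1 : Z ≤ (s ^ (n - 1)) ^ (((n : ℝ) + 1) / (n - 1) - 1) :=
        Real.rpow_le_rpow (mul_nonneg (by positivity) (hypMass_nonneg (by omega) hx.1.le hx.2)) hX
          (by linarith)
      refine h1.trans_eq ?_
      rw [← Real.rpow_natCast s (n - 1), ← Real.rpow_mul hs0.le, hcast, ← Real.rpow_natCast s 2]
      congr 1; push_cast; field_simp; ring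
    have hsn : s ^ n = s ^ (n - 1) * s := by rw [← pow_succ]; congr 1; omega
    have e : n * s ^ (n - 1) * ((1 + x ^ 2) / (1 - x ^ 2) * τ) * ((1 + x ^ 2) / (1 - x ^ 2)) +
        s ^ n * (s * τ) - (n * (s ^ (n - 1) * τ) + ((n : ℝ) - 1) / n * (n * (s ^ (n - 1) * τ)) *
          (((n : ℝ) + 1) / (n - 1)) * Z) = s ^ (n - 1) * τ * ((n + 1) * (s ^ 2 - Z)) := by
      have h1 : ((n : ℝ) - 1) / n * (n * (s ^ (n - 1) * τ)) * (((n : ℝ) + 1) / (n - 1)) * Z =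
          s ^ (n - 1) * τ * ((n + 1) * Z) := by field_simp
      rw [h1, hsn]
      linear_combination n * s ^ (n - 1) * τ * hsC
    rw [e]
    have : 0 ≤ s ^ 2 - Z := by linarith
    have : 0 ≤ τ := by positivity
    positivity

lemma hypMass_comparison_aux {n : ℕ} (hn : 3 ≤ n) {r : ℝ} (hr : r ∈ Set.Ico (0 : ℝ) 1) :
    hypMass n r ^ 2 + (((n : ℝ) - 1) / n * hypMass n r) ^ (2 * (n : ℝ) / (n - 1)) ≤
      (2 * r / (1 - r ^ 2)) ^ (2 * n) := by
  have hn0 : (0 : ℝ) < n := by exact_mod_cast (by omega : 0 < n)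
  have hn1 : (0 : ℝ) < (n : ℝ) - 1 := by
    have : (3 : ℝ) ≤ n := by exact_mod_cast hn
    linarith
  have he : 1 ≤ 2 * (n : ℝ) / (n - 1) := by rw [le_div_iff₀ hn1]; linarith
  have hd : ∀ x ∈ Set.Ico (0 : ℝ) 1, HasDerivAt
      (fun r => (2 * r / (1 - r ^ 2)) ^ (2 * n) - (hypMass n r ^ 2 +
        (((n : ℝ) - 1) / n * hypMass n r) ^ (2 * (n : ℝ) / (n - 1))))
      (((2 * n : ℕ) : ℝ) * (2 * x / (1 - x ^ 2)) ^ (2 * n - 1) *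
          ((1 + x ^ 2) / (1 - x ^ 2) * (2 / (1 - x ^ 2))) -
        (((2 : ℕ) : ℝ) * hypMass n x ^ (2 - 1) * (n * hypWeight n x) +
        ((n : ℝ) - 1) / n * (n * hypWeight n x) * (2 * (n : ℝ) / (n - 1)) *
          (((n : ℝ) - 1) / n * hypMass n x) ^ (2 * (n : ℝ) / (n - 1) - 1))) x :=
    fun x hx => ((hasDerivAt_sinh_radius hx.1 hx.2).pow (2 * n)).sub
      (((hasDerivAt_hypMass n hx.1 hx.2).pow 2).add
        (((hasDerivAt_hypMass n hx.1 hx.2).const_mul _).rpow_const (Or.inr he)))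
  have := nonneg_of_hasDerivAt_nonneg
    (fun x hx => (hd x hx).continuousAt.continuousWithinAt) ?_
    (fun x hx => hd x (Set.Ioo_subset_Ico_self hx)) ?_ hr
  · linarith
  · simp only [hypMass_zero]
    rw [mul_zero, zero_div, zero_pow (by omega), mul_zero, Real.zero_rpow (by linarith)]; simp
  · intro x hx
    have hp : 0 < 1 - x ^ 2 := by nlinarith [hx.1, hx.2]
    have hx0 := hx.1
    have hG := sinh_pow_mul_cosh_ge hn (Set.Ioo_subset_Ico_self hx)
    set s := 2 * x / (1 - x ^ 2) with hs
    have hs0 : 0 < s := by positivity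
    rw [hypWeight_eq (by omega), ← hs]
    set τ := 2 / (1 - x ^ 2) with hτ
    have hee : 2 * (n : ℝ) / (n - 1) - 1 = ((n : ℝ) + 1) / (n - 1) := by field_simp; ring
    rw [hee]
    set Z := (((n : ℝ) - 1) / n * hypMass n x) ^ (((n : ℝ) + 1) / (n - 1)) with hZ
    have hsn : s ^ (2 * n - 1) = s ^ (n - 1) * s ^ n := by rw [← pow_add]; congr 1; omega
    have e : ((2 * n : ℕ) : ℝ) * s ^ (2 * n - 1) * ((1 + x ^ 2) / (1 - x ^ 2) * τ) -
        (((2 : ℕ) : ℝ) * hypMass n x ^ (2 - 1) * (n * (s ^ (n - 1) * τ)) +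
        ((n : ℝ) - 1) / n * (n * (s ^ (n - 1) * τ)) * (2 * (n : ℝ) / (n - 1)) * Z) =
        2 * n * s ^ (n - 1) * τ * (s ^ n * ((1 + x ^ 2) / (1 - x ^ 2)) - (hypMass n x + Z)) := by
      have h1 : ((n : ℝ) - 1) / n * (n * (s ^ (n - 1) * τ)) * (2 * (n : ℝ) / (n - 1)) * Z =
          2 * n * s ^ (n - 1) * τ * Z := by field_simp
      rw [h1, hsn]; push_cast; ring
    rw [e]
    have : 0 ≤ s ^ n * ((1 + x ^ 2) / (1 - x ^ 2)) - (hypMass n x + Z) := by linarith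
    have : 0 ≤ τ := by positivity
    positivity

end RadialGeometry

section RadialHardy

/-- The Euclidean radius of the ball with the same (normalised) volume as the hyperbolic ball of
radius `r`. -/
noncomputable def eqRadius (n : ℕ) (r : ℝ) : ℝ := hypMass n r ^ (1 / (n : ℝ))

/-- The derivative of `eqRadius`. -/
noncomputable def eqRadiusDeriv (n : ℕ) (r : ℝ) : ℝ := hypWeight n r / eqRadius n r ^ (n - 1)

variable {n : ℕ} {r : ℝ}

lemma eqRadius_pos (hn : 0 < n) (h0 : 0 < r) (h1 : r < 1) : 0 < eqRadius n r :=
  Real.rpow_pos_of_pos (hypMass_pos hn h0 h1) _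

lemma eqRadius_pow (hn : 0 < n) (h0 : 0 ≤ r) (h1 : r < 1) : eqRadius n r ^ n = hypMass n r := by
  rw [eqRadius, ← Real.rpow_natCast, ← Real.rpow_mul (hypMass_nonneg hn h0 h1),
    one_div_mul_cancel (by exact_mod_cast hn.ne'), Real.rpow_one]

lemma eqRadiusDeriv_pos (hn : 0 < n) (h0 : 0 < r) (h1 : r < 1) : 0 < eqRadiusDeriv n r :=
  div_pos (hypWeight_pos n h0 h1) (pow_pos (eqRadius_pos hn h0 h1) _)

lemma eqRadius_pow_mul_deriv (hn : 0 < n) (h0 : 0 < r) (h1 : r < 1) :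
    eqRadius n r ^ (n - 1) * eqRadiusDeriv n r = hypWeight n r :=
  mul_div_cancel₀ _ (pow_pos (eqRadius_pos hn h0 h1) _).ne'

lemma hasDerivAt_eqRadius (hn : 0 < n) (h0 : 0 < r) (h1 : r < 1) :
    HasDerivAt (eqRadius n) (eqRadiusDeriv n r) r := by
  have hX := hypMass_pos hn h0 h1
  have hn' : (n : ℝ) ≠ 0 := by exact_mod_cast hn.ne'
  refine ((hasDerivAt_hypMass n h0.le h1).rpow_const (p := 1 / (n : ℝ))
    (Or.inl hX.ne')).congr_deriv ?_
  have : 1 / (n : ℝ) - 1 = -(1 / n * ((n - 1 : ℕ) : ℝ)) := by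
    rw [Nat.cast_sub hn]; push_cast; field_simp; ring
  rw [eqRadiusDeriv, eqRadius, ← Real.rpow_natCast, ← Real.rpow_mul hX.le, this,
    Real.rpow_neg hX.le]
  field_simp

lemma continuousOn_eqRadius (hn : 0 < n) : ContinuousOn (eqRadius n) (Set.Ioo 0 1) :=
  continuousOn_of_hasDerivAt fun _ hr => hasDerivAt_eqRadius hn hr.1 hr.2

lemma continuousOn_eqRadiusDeriv (hn : 0 < n) : ContinuousOn (eqRadiusDeriv n) (Set.Ioo 0 1) :=
  ((continuousOn_hypWeight n).mono (Set.Ioo_subset_Ioo (by norm_num) le_rfl)).div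
    ((continuousOn_eqRadius hn).pow _) fun _ hx => (pow_pos (eqRadius_pos hn hx.1 hx.2) _).ne'

lemma eqRadius_comparison (hn : 3 ≤ n) {p : ℝ} (hp : 2 * (n : ℝ) / (n - 1) ≤ p)
    (h0 : 0 < r) (h1 : r < 1) :
    1 + (((n : ℝ) - 1) / n * eqRadius n r) ^ p ≤ ((1 - r ^ 2) / 2 * eqRadiusDeriv n r) ^ p := by
  have hn0 : (0 : ℝ) < n := by exact_mod_cast (by omega : 0 < n)
  have hn1 : (0 : ℝ) < (n : ℝ) - 1 := by
    have : (3 : ℝ) ≤ n := by exact_mod_cast hn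
    linarith
  have hp0 : 0 < 2 * (n : ℝ) / (n - 1) := by positivity
  have hr : 0 < 1 - r ^ 2 := by nlinarith
  have hR := eqRadius_pos (by omega : 0 < n) h0 h1
  have hX := hypMass_pos (by omega : 0 < n) h0 h1
  have hcast : ((n - 1 : ℕ) : ℝ) = (n : ℝ) - 1 := by
    rw [Nat.cast_sub (by omega), Nat.cast_one]
  have aux := hypMass_comparison_aux hn (r := r) ⟨h0.le, h1⟩
  set s := 2 * r / (1 - r ^ 2) with hs
  have hs0 : 0 < s := by positivity
  set Y := eqRadius n r ^ (n - 1) with hY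
  have hY0 : 0 < Y := by positivity
  have hXY : hypMass n r = Y * eqRadius n r := by
    rw [← eqRadius_pow (by omega) h0.le h1, hY, ← pow_succ]; congr 1; omega
  have e1 : (1 - r ^ 2) / 2 * eqRadiusDeriv n r = s ^ (n - 1) / Y := by
    rw [eqRadiusDeriv, hypWeight_eq (by omega), ← hs, ← hY]; field_simp
  have e2 : s ^ (2 * n) = (s ^ (n - 1)) ^ (2 * (n : ℝ) / (n - 1)) := by
    rw [← Real.rpow_natCast s (n - 1), ← Real.rpow_mul hs0.le, hcast, ← Real.rpow_natCast s (2 * n)]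
    congr 1; push_cast; field_simp
  have e3 : hypMass n r ^ 2 = Y ^ (2 * (n : ℝ) / (n - 1)) := by
    rw [hY, ← Real.rpow_natCast _ (n - 1), ← Real.rpow_mul hR.le, hcast,
      ← eqRadius_pow (by omega : 0 < n) h0.le h1, ← pow_mul, ← Real.rpow_natCast]
    congr 1; push_cast; field_simp
  rw [e2, e3] at aux
  set p₀ := 2 * (n : ℝ) / (n - 1) with hp₀
  have hpp : 1 ≤ p / p₀ := by rwa [le_div_iff₀ hp0, one_mul]
  have main : Y ^ p + (((n : ℝ) - 1) / n * hypMass n r) ^ p ≤ (s ^ (n - 1)) ^ p := by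
    have h2 := Real.rpow_le_rpow (by positivity) aux (by linarith : 0 ≤ p / p₀)
    have h3 := Real.add_rpow_le_rpow_add (a := Y ^ p₀)
      (b := (((n : ℝ) - 1) / n * hypMass n r) ^ p₀) (by positivity) (by positivity) hpp
    have h4 := h3.trans h2
    rwa [← Real.rpow_mul (by positivity), ← Real.rpow_mul (by positivity),
      ← Real.rpow_mul (by positivity), mul_div_cancel₀ _ hp0.ne'] at h4
  rw [e1, Real.div_rpow (by positivity) hY0.le, le_div_iff₀ (by positivity)]
  refine le_trans (le_of_eq ?_) main
  rw [add_mul, one_mul, ← Real.mul_rpow (by positivity) hY0.le, hXY]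
  congr 2; ring

theorem radial_hardy {φ : ℝ → ℝ} {K : NNReal} (hφ : LipschitzWith K φ) (hφ0 : ∀ r, 0 ≤ φ r)
    {r₀ p : ℝ} (hr₀ : 0 < r₀) (hr₁ : r₀ < 1) (hφr : φ r₀ = 0) (hn : 3 ≤ n)
    (hp : 2 * (n : ℝ) / (n - 1) ≤ p) :
    IntegrableOn (fun r => (|deriv φ r| / eqRadiusDeriv n r) ^ p * hypWeight n r)
      (Set.Ioc 0 r₀) ∧
    (∫ r in (0 : ℝ)..r₀, (|deriv φ r| / eqRadiusDeriv n r) ^ p * hypWeight n r) +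
      (((n : ℝ) - 1) / p) ^ p * ∫ r in (0 : ℝ)..r₀, φ r ^ p * hypWeight n r ≤
    ∫ r in (0 : ℝ)..r₀, ((1 - r ^ 2) / 2 * |deriv φ r|) ^ p * hypWeight n r := by
  have hnpos : 0 < n := by omega
  have hn0 : (0 : ℝ) < n := by exact_mod_cast hnpos
  have hn1 : (0 : ℝ) < (n : ℝ) - 1 := by
    have : (3 : ℝ) ≤ n := by exact_mod_cast hn
    linarith
  have hp1 : 1 < p := lt_of_lt_of_le (by rw [lt_div_iff₀ hn1]; linarith) hp
  have hp0 : 0 < p := by linarith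
  have hsub : Set.Ioc 0 r₀ ⊆ Set.Ioo (0 : ℝ) 1 := fun x hx => ⟨hx.1, hx.2.trans_lt hr₁⟩
  have hwc : ContinuousOn (hypWeight n) (Set.Icc 0 r₀) := (continuousOn_hypWeight n).mono
    fun x hx => ⟨by linarith [hx.1], hx.2.trans_lt hr₁⟩
  have hK : ∀ x, |deriv φ x| ≤ K := fun x => norm_deriv_le_of_lipschitz hφ
  have hwi : IntegrableOn (hypWeight n) (Set.Ioc 0 r₀) :=
    hwc.integrableOn_Icc.mono_set Set.Ioc_subset_Icc_self
  have hwm := hwi.aestronglyMeasurable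
  have hdm : AEStronglyMeasurable (fun r => |deriv φ r|) (volume.restrict (Set.Ioc 0 r₀)) :=
    (measurable_deriv φ).abs.aestronglyMeasurable
  have hRm : AEStronglyMeasurable (eqRadius n) (volume.restrict (Set.Ioc 0 r₀)) :=
    ((continuousOn_eqRadius hnpos).mono hsub).aestronglyMeasurable measurableSet_Ioc
  have hR'm : AEMeasurable (eqRadiusDeriv n) (volume.restrict (Set.Ioc 0 r₀)) :=
    (((continuousOn_eqRadiusDeriv hnpos).mono hsub).aestronglyMeasurable
      measurableSet_Ioc).aemeasurable
  have hae : ∀ {P : ℝ → Prop}, (∀ x ∈ Set.Ioc 0 r₀, P x) →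
      ∀ᵐ x ∂volume.restrict (Set.Ioc 0 r₀), P x :=
    fun h => (ae_restrict_iff' measurableSet_Ioc).2 (Filter.Eventually.of_forall h)
  have hDi : IntegrableOn (fun r => ((1 - r ^ 2) / 2 * |deriv φ r|) ^ p * hypWeight n r)
      (Set.Ioc 0 r₀) := by
    refine Integrable.mono' (hwi.const_mul ((K : ℝ) ^ p)) ?_ (hae fun x hx => ?_)
    · refine AEStronglyMeasurable.mul ?_ hwm
      exact ((Measurable.pow_const (by fun_prop) _ : Measurable fun r : ℝ =>
        ((1 - r ^ 2) / 2 * |deriv φ r|) ^ p)).aestronglyMeasurable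
    · have hw := hypWeight_pos n (hsub hx).1 (hsub hx).2
      have : 0 < 1 - x ^ 2 := by nlinarith [(hsub hx).1, (hsub hx).2]
      rw [Real.norm_of_nonneg (by positivity)]
      have h2 : (1 - x ^ 2) / 2 * |deriv φ x| ≤ K := by
        have h3 : (1 - x ^ 2) / 2 ≤ 1 := by nlinarith [sq_nonneg x]
        calc _ ≤ 1 * |deriv φ x| := by gcongr
          _ ≤ K := by rw [one_mul]; exact hK x
      gcongr
  have hpt : ∀ x ∈ Set.Ioc 0 r₀, (|deriv φ x| / eqRadiusDeriv n x) ^ p * hypWeight n x +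
      ((n - 1 : ℝ) / n) ^ p *
        ((|deriv φ x| * eqRadius n x / eqRadiusDeriv n x) ^ p * hypWeight n x) ≤
      ((1 - x ^ 2) / 2 * |deriv φ x|) ^ p * hypWeight n x := by
    intro x hx
    have hw := hypWeight_pos n (hsub hx).1 (hsub hx).2
    have hR := eqRadius_pos hnpos (hsub hx).1 (hsub hx).2
    have hR' := eqRadiusDeriv_pos hnpos (hsub hx).1 (hsub hx).2
    have : 0 < 1 - x ^ 2 := by nlinarith [(hsub hx).1, (hsub hx).2]
    have key := eqRadius_comparison hn hp (hsub hx).1 (hsub hx).2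
    have e1 : (1 - x ^ 2) / 2 * |deriv φ x| =
        (1 - x ^ 2) / 2 * eqRadiusDeriv n x * (|deriv φ x| / eqRadiusDeriv n x) := by field_simp
    have e2 : |deriv φ x| * eqRadius n x / eqRadiusDeriv n x =
      (|deriv φ x| / eqRadiusDeriv n x) * eqRadius n x := by ring
    rw [e1, e2, Real.mul_rpow (x := (1 - x ^ 2) / 2 * eqRadiusDeriv n x) (by positivity)
      (by positivity), Real.mul_rpow (x := |deriv φ x| / eqRadiusDeriv n x) (by positivity) hR.le]
    rw [Real.mul_rpow (by positivity) hR.le] at key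
    have h2 : 0 ≤ (|deriv φ x| / eqRadiusDeriv n x) ^ p * hypWeight n x := by positivity
    nlinarith [mul_le_mul_of_nonneg_right key h2]
  have hei : IntegrableOn (fun r => (|deriv φ r| / eqRadiusDeriv n r) ^ p * hypWeight n r)
      (Set.Ioc 0 r₀) := by
    refine Integrable.mono' hDi ?_ (hae fun x hx => ?_)
    · exact (((hdm.aemeasurable.div hR'm).pow_const p).aestronglyMeasurable).mul hwm
    · have hw := hypWeight_pos n (hsub hx).1 (hsub hx).2
      have hR := eqRadius_pos hnpos (hsub hx).1 (hsub hx).2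
      have hR' := eqRadiusDeriv_pos hnpos (hsub hx).1 (hsub hx).2
      rw [Real.norm_of_nonneg (by positivity)]
      refine le_trans (le_add_of_nonneg_right ?_) (hpt x hx)
      positivity
  have hci : 0 < ((n - 1 : ℝ) / n) ^ p := by positivity
  have hfi : IntegrableOn (fun r => (|deriv φ r| * eqRadius n r / eqRadiusDeriv n r) ^ p *
      hypWeight n r) (Set.Ioc 0 r₀) := by
    refine Integrable.mono' (hDi.const_mul (((n - 1 : ℝ) / n) ^ p)⁻¹) ?_ (hae fun x hx => ?_)
    · exact ((((hdm.mul hRm).aemeasurable.div hR'm).pow_const p).aestronglyMeasurable).mul hwm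
    · have hw := hypWeight_pos n (hsub hx).1 (hsub hx).2
      have hR := eqRadius_pos hnpos (hsub hx).1 (hsub hx).2
      have hR' := eqRadiusDeriv_pos hnpos (hsub hx).1 (hsub hx).2
      rw [Real.norm_of_nonneg (by positivity), inv_mul_eq_div, le_div_iff₀ hci, mul_comm]
      refine le_trans (le_add_of_nonneg_left ?_) (hpt x hx)
      positivity
  refine ⟨hei, ?_⟩
  have hφpc : ∀ s : ℝ, 0 ≤ s → Continuous fun r => φ r ^ s := fun s hs =>
    hφ.continuous.rpow_const fun _ => Or.inr hs
  have hPi : IntegrableOn (fun r => φ r ^ p * hypWeight n r) (Set.Ioc 0 r₀) :=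
    ((hφpc p hp0.le).continuousOn.mul hwc).integrableOn_Icc.mono_set Set.Ioc_subset_Icc_self
  have hXc : ContinuousOn (hypMass n) (Set.Icc 0 r₀) :=
    (continuousOn_hypMass n).mono fun x hx => ⟨hx.1, hx.2.trans_lt hr₁⟩
  have hardy : ∫ r in Set.Ioc 0 r₀, φ r ^ p * hypWeight n r ≤
      (p / n) ^ p * ∫ r in Set.Ioc 0 r₀, (|deriv φ r| * eqRadius n r / eqRadiusDeriv n r) ^ p *
        hypWeight n r := by
    have s1 := integral_rpow_mul_deriv_le hφ hr₀.le (fun x _ => hφ0 x) hp1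
      (V := fun r => 1 / n * hypMass n r) (V' := hypWeight n) (fun x hx =>
        ((hasDerivAt_hypMass n hx.1 (hx.2.trans_lt hr₁)).const_mul (1 / (n : ℝ))).congr_deriv
          (by field_simp)) hwc (fun x hx => mul_nonneg (by positivity)
            (hypMass_nonneg hnpos hx.1 (hx.2.trans_lt hr₁)))
    rw [hφr, Real.zero_rpow hp0.ne', zero_mul, zero_add, intervalIntegral.integral_of_le hr₀.le,
      intervalIntegral.integral_of_le hr₀.le] at s1
    have hgi : IntegrableOn (fun x => |deriv φ x| * (φ x ^ (p - 1) * (1 / n * hypMass n x)))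
        (Set.Ioc 0 r₀) := by
      have hc : ContinuousOn (fun x => φ x ^ (p - 1) * (1 / n * hypMass n x)) (Set.Icc 0 r₀) :=
        (hφpc _ (by linarith)).continuousOn.mul (continuousOn_const.mul hXc)
      exact (hc.integrableOn_Icc.mono_set Set.Ioc_subset_Icc_self).bdd_mul hdm
        (Filter.Eventually.of_forall fun x => (by rw [Real.norm_eq_abs, abs_abs]; exact hK x :
          ‖|deriv φ x|‖ ≤ K))
    have s2 : ∫ x in Set.Ioc 0 r₀,
        (p * (p * (|deriv φ x| * (φ x ^ (p - 1) * (1 / n * hypMass n x))))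
        - (p - 1) * (φ x ^ p * hypWeight n x)) ≤ ∫ x in Set.Ioc 0 r₀, (p / n) ^ p *
          ((|deriv φ x| * eqRadius n x / eqRadiusDeriv n x) ^ p * hypWeight n x) := by
      refine integral_mono_ae (((hgi.const_mul p).const_mul p).sub (hPi.const_mul _))
        (hfi.const_mul _) (hae fun x hx => ?_)
      have hw := hypWeight_pos n (hsub hx).1 (hsub hx).2
      have hR := eqRadius_pos hnpos (hsub hx).1 (hsub hx).2
      have hR' := eqRadiusDeriv_pos hnpos (hsub hx).1 (hsub hx).2
      have hy := rpow_young (s := p / n * (|deriv φ x| * eqRadius n x / eqRadiusDeriv n x))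
        (t := φ x) (by positivity) (hφ0 x) hp1
      rw [Real.mul_rpow (by positivity) (by positivity)] at hy
      have hXe : hypMass n x = eqRadius n x / eqRadiusDeriv n x * hypWeight n x := by
        rw [← eqRadius_pow_mul_deriv hnpos (hsub hx).1 (hsub hx).2,
          ← eqRadius_pow hnpos (hsub hx).1.le (hsub hx).2]
        have : eqRadius n x ^ n = eqRadius n x ^ (n - 1) * eqRadius n x := by
          rw [← pow_succ]; congr 1; omega
        rw [this]; field_simp
      have h2 := mul_le_mul_of_nonneg_right hy hw.le
      refine le_trans (le_of_eq ?_) (h2.trans_eq (by ring))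
      simp only [hXe]; ring
    rw [integral_sub ((hgi.const_mul p).const_mul p) (hPi.const_mul _), integral_const_mul,
      integral_const_mul, integral_const_mul, integral_const_mul] at s2
    nlinarith [mul_le_mul_of_nonneg_left s1 hp0.le]
  have hsum : (∫ x in Set.Ioc 0 r₀, (|deriv φ x| / eqRadiusDeriv n x) ^ p * hypWeight n x) +
      ((n - 1 : ℝ) / n) ^ p * ∫ x in Set.Ioc 0 r₀,
        (|deriv φ x| * eqRadius n x / eqRadiusDeriv n x) ^ p * hypWeight n x ≤
      ∫ x in Set.Ioc 0 r₀, ((1 - x ^ 2) / 2 * |deriv φ x|) ^ p * hypWeight n x := by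
    rw [← integral_const_mul, ← integral_add hei (hfi.const_mul _)]
    exact integral_mono_ae (hei.add (hfi.const_mul _)) hDi (hae hpt)
  simp only [intervalIntegral.integral_of_le hr₀.le]
  have e4 : (((n : ℝ) - 1) / p) ^ p * (p / n) ^ p = ((n - 1 : ℝ) / n) ^ p := by
    rw [← Real.mul_rpow (by positivity) (by positivity)]; congr 1; field_simp
  have h5 := mul_le_mul_of_nonneg_left hardy
    (by positivity : 0 ≤ (((n : ℝ) - 1) / p) ^ p)
  rw [← mul_assoc, e4] at h5
  linarith

end RadialHardy

section BetaIntegral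

/-- Euler's beta integral on the unit interval. -/
lemma beta_integral_Ioo {a b : ℝ} (ha : 0 < a) (hb : 0 < b) :
    IntegrableOn (fun x : ℝ => x ^ (a - 1) * (1 - x) ^ (b - 1)) (Set.Ioo 0 1) ∧
    ∫ x in Set.Ioo (0 : ℝ) 1, x ^ (a - 1) * (1 - x) ^ (b - 1) =
      Gamma a * Gamma b / Gamma (a + b) := by
  have hβ := ProbabilityTheory.beta_pos ha hb
  have h1 := ProbabilityTheory.lintegral_betaPDF_eq_one ha hb
  rw [ProbabilityTheory.lintegral_betaPDF] at h1
  have hnn : 0 ≤ᵐ[volume.restrict (Set.Ioo 0 1)] fun x : ℝ =>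
      1 / ProbabilityTheory.beta a b * x ^ (a - 1) * (1 - x) ^ (b - 1) := by
    refine (ae_restrict_iff' measurableSet_Ioo).2 (Filter.Eventually.of_forall fun x hx => ?_)
    have h0 : 0 < x := hx.1
    have h2 : 0 < 1 - x := by linarith [hx.2]
    simp only [Pi.zero_apply]
    positivity
  have hm : AEStronglyMeasurable (fun x : ℝ =>
      1 / ProbabilityTheory.beta a b * x ^ (a - 1) * (1 - x) ^ (b - 1))
      (volume.restrict (Set.Ioo 0 1)) := by
    apply Measurable.aestronglyMeasurable
    fun_prop
  have hi := (lintegral_ofReal_ne_top_iff_integrable hm hnn).1 (by rw [h1]; simp)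
  have he : (fun x : ℝ => x ^ (a - 1) * (1 - x) ^ (b - 1)) = fun x =>
      ProbabilityTheory.beta a b *
        (1 / ProbabilityTheory.beta a b * x ^ (a - 1) * (1 - x) ^ (b - 1)) := by
    funext x; field_simp
  refine ⟨by rw [he]; exact hi.const_mul _, ?_⟩
  rw [he, integral_const_mul, integral_eq_lintegral_of_nonneg_ae hnn hm, h1]
  simp [ProbabilityTheory.beta]

/-- Euler's beta integral on the half line. -/
lemma beta_integral_Ioi {a b : ℝ} (ha : 0 < a) (hb : 0 < b) :
    IntegrableOn (fun z : ℝ => z ^ (a - 1) * (1 + z) ^ (-(a + b))) (Set.Ioi 0) ∧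
    ∫ z in Set.Ioi (0 : ℝ), z ^ (a - 1) * (1 + z) ^ (-(a + b)) =
      Gamma a * Gamma b / Gamma (a + b) := by
  have himg : (fun x : ℝ => x / (1 - x)) '' Set.Ioo 0 1 = Set.Ioi 0 := by
    ext z
    constructor
    · rintro ⟨x, hx, rfl⟩
      exact div_pos hx.1 (by linarith [hx.2])
    · intro (hz : 0 < z)
      refine ⟨z / (1 + z), ⟨by positivity, by rw [div_lt_one (by positivity)]; linarith⟩, ?_⟩
      have : 1 + z ≠ 0 := by positivity
      field_simp
      ring
  have hinj : Set.InjOn (fun x : ℝ => x / (1 - x)) (Set.Ioo 0 1) := by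
    intro x hx y hy h
    have h1 : 1 - x ≠ 0 := by linarith [hx.2]
    have h2 : 1 - y ≠ 0 := by linarith [hy.2]
    simp only at h
    rw [div_eq_div_iff h1 h2] at h
    linarith
  have hd : ∀ x ∈ Set.Ioo (0 : ℝ) 1,
      HasDerivWithinAt (fun x : ℝ => x / (1 - x)) (1 / (1 - x) ^ 2) (Set.Ioo 0 1) x := by
    intro x hx
    have h1 : 1 - x ≠ 0 := by linarith [hx.2]
    exact (((hasDerivAt_id x).div ((hasDerivAt_id x).const_sub 1) h1).congr_deriv
      (by simp)).hasDerivWithinAt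
  have hc : Set.EqOn (fun x : ℝ => |1 / (1 - x) ^ 2| •
      ((x / (1 - x)) ^ (a - 1) * (1 + x / (1 - x)) ^ (-(a + b))))
      (fun x => x ^ (a - 1) * (1 - x) ^ (b - 1)) (Set.Ioo 0 1) := by
    intro x hx
    have h0 : 0 < x := hx.1
    have h1 : 0 < 1 - x := by linarith [hx.2]
    have h2 : 1 + x / (1 - x) = (1 - x)⁻¹ := by field_simp; ring
    simp only [smul_eq_mul]
    rw [abs_of_pos (by positivity), h2, Real.inv_rpow h1.le, ← Real.rpow_neg h1.le, neg_neg,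
      Real.div_rpow h0.le h1.le, ← Real.rpow_natCast, div_eq_mul_inv, div_eq_mul_inv,
      ← Real.rpow_neg h1.le, ← Real.rpow_neg h1.le, one_mul]
    calc _ = x ^ (a - 1) * ((1 - x) ^ (-((2 : ℕ) : ℝ)) * (1 - x) ^ (-(a - 1)) *
        (1 - x) ^ (a + b)) := by ring
      _ = _ := by
        rw [← Real.rpow_add h1, ← Real.rpow_add h1]
        congr 2
        push_cast
        ring
  have hB := beta_integral_Ioo ha hb
  constructor
  · rw [← himg, integrableOn_image_iff_integrableOn_abs_deriv_smul measurableSet_Ioo hd hinj,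
      integrableOn_congr_fun hc measurableSet_Ioo]
    exact hB.1
  · rw [← himg, integral_image_eq_integral_abs_deriv_smul measurableSet_Ioo hd hinj,
      setIntegral_congr_fun measurableSet_Ioo hc]
    exact hB.2

/-- The moments of a Barenblatt-type profile. -/
lemma barenblatt_integral {n : ℕ} (hn : 0 < n) {r t : ℝ} (hr : 0 < r) (ht : n / r < t) :
    IntegrableOn (fun y : ℝ => (1 + y ^ r) ^ (-t) * y ^ (n - 1)) (Set.Ioi 0) ∧
    ∫ y in Set.Ioi (0 : ℝ), (1 + y ^ r) ^ (-t) * y ^ (n - 1) =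
      1 / n * (Gamma (n / r + 1) * Gamma (t - n / r) / Gamma t) := by
  have hn0 : (0 : ℝ) < n := by exact_mod_cast hn
  have ha : (0 : ℝ) < n / r := by positivity
  have hB := beta_integral_Ioi ha (sub_pos.2 ht)
  rw [add_sub_cancel] at hB
  have hc : Set.EqOn (fun y : ℝ => (1 + y ^ r) ^ (-t) * y ^ (n - 1))
      (fun y => 1 / r * ((|r| * y ^ (r - 1)) • ((y ^ r) ^ ((n : ℝ) / r - 1) * (1 + y ^ r) ^ (-t))))
      (Set.Ioi 0) := by
    intro y (hy : 0 < y)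
    simp only [smul_eq_mul]
    rw [abs_of_pos hr, ← Real.rpow_mul hy.le, ← Real.rpow_natCast, Nat.cast_sub hn]
    calc _ = (1 + y ^ r) ^ (-t) * (y ^ (r - 1) * y ^ (r * ((n : ℝ) / r - 1))) := by
          rw [← Real.rpow_add hy]
          congr 2
          push_cast
          field_simp
          ring
      _ = _ := by field_simp
  constructor
  · rw [integrableOn_congr_fun hc measurableSet_Ioi]
    exact ((integrableOn_Ioi_comp_rpow_iff _ hr.ne').2 hB.1).const_mul _
  · rw [setIntegral_congr_fun measurableSet_Ioi hc, integral_const_mul,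
      integral_comp_rpow_Ioi (fun z : ℝ => z ^ ((n : ℝ) / r - 1) * (1 + z) ^ (-t)) hr.ne', hB.2,
      Real.Gamma_add_one ha.ne']
    field_simp

end BetaIntegral

section Barenblatt

/-- The profile of the extremals of the Gagliardo–Nirenberg inequality. -/
noncomputable def barenblatt (p α t : ℝ) : ℝ := (1 + |t| ^ (p / (p - 1))) ^ (-(1 / (α - 1)))

/-- The radial moment of order `α (p - 1) + 1` of the profile `barenblatt p α`. -/
noncomputable def barenblattMoment (n : ℕ) (p α : ℝ) : ℝ :=
  1 / n * (Gamma (n * (p - 1) / p + 1) *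
    Gamma ((p - 1) / p * ((n * p - (n - p) * (α * (p - 1) + 1)) / (α * (p - 1) + 1 - p))) /
      Gamma ((α * (p - 1) + 1) * (p - 1) / (α * (p - 1) + 1 - p)))

variable {n : ℕ} {p α : ℝ}

lemma barenblatt_pos (p α t : ℝ) : 0 < barenblatt p α t := by
  unfold barenblatt
  positivity

lemma continuous_barenblatt (hp : 1 < p) : Continuous (barenblatt p α) := by
  unfold barenblatt
  have h : 0 ≤ p / (p - 1) := div_nonneg (by linarith) (by linarith)
  refine Continuous.rpow_const (continuous_const.add
    (continuous_abs.rpow_const fun _ => Or.inr h)) fun x => Or.inl ?_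
  positivity

lemma barenblatt_rpow {t : ℝ} (ht : 0 < t) (m : ℝ) :
    barenblatt p α t ^ m = (1 + t ^ (p / (p - 1))) ^ (-(m / (α - 1))) := by
  rw [barenblatt, abs_of_pos ht, ← Real.rpow_mul (by positivity)]
  congr 1
  ring

lemma barenblattMoment_pos (hn : 0 < n) (hp : 1 < p) (hα : 1 < α)
    (hδ : 0 < n * p - (n - p) * (α * (p - 1) + 1)) : 0 < barenblattMoment n p α := by
  have h1 : 0 < p - 1 := by linarith
  have h2 : 0 < α - 1 := by linarith
  have h3 : 0 < α * (p - 1) + 1 - p := by nlinarith [mul_pos h1 h2]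
  have h4 : 0 < α * (p - 1) + 1 := by linarith
  have hn0 : (0 : ℝ) < n := by exact_mod_cast hn
  unfold barenblattMoment
  have g1 := Gamma_pos_of_pos (by positivity : 0 < n * (p - 1) / p + 1)
  have g2 := Gamma_pos_of_pos (by positivity : 0 < (p - 1) / p *
    ((n * p - (n - p) * (α * (p - 1) + 1)) / (α * (p - 1) + 1 - p)))
  have g3 := Gamma_pos_of_pos (by positivity :
    0 < (α * (p - 1) + 1) * (p - 1) / (α * (p - 1) + 1 - p))
  positivity

lemma barenblatt_moment_mass (hn : 0 < n) (hp : 1 < p) (hα : 1 < α)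
    (hδ : 0 < n * p - (n - p) * (α * (p - 1) + 1)) :
    IntegrableOn (fun t => barenblatt p α t ^ (α * (p - 1) + 1) * t ^ (n - 1)) (Set.Ioi 0) ∧
    ∫ t in Set.Ioi (0 : ℝ), barenblatt p α t ^ (α * (p - 1) + 1) * t ^ (n - 1) =
      barenblattMoment n p α := by
  have h1 : 0 < p - 1 := by linarith
  have h2 : 0 < α - 1 := by linarith
  have e3 : α * (p - 1) + 1 - p = (α - 1) * (p - 1) := by ring
  have h4 : 0 < α * (p - 1) + 1 := by positivity
  have hn0 : (0 : ℝ) < n := by exact_mod_cast hn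
  have hpp : 0 < p / (p - 1) := by positivity
  have e5 : (α * (p - 1) + 1) / (α - 1) - n / (p / (p - 1)) =
      (p - 1) / p * ((n * p - (n - p) * (α * (p - 1) + 1)) / (α * (p - 1) + 1 - p)) := by
    rw [e3]; field_simp; ring
  have hlt : n / (p / (p - 1)) < (α * (p - 1) + 1) / (α - 1) := by
    rw [← sub_pos, e5, e3]
    positivity
  have hb := barenblatt_integral hn hpp hlt
  have hc : Set.EqOn (fun t => barenblatt p α t ^ (α * (p - 1) + 1) * t ^ (n - 1))
      (fun y : ℝ => (1 + y ^ (p / (p - 1))) ^ (-((α * (p - 1) + 1) / (α - 1))) * y ^ (n - 1))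
      (Set.Ioi 0) := by
    intro t (ht : 0 < t)
    simp only [barenblatt_rpow ht]
  rw [integrableOn_congr_fun hc measurableSet_Ioi, setIntegral_congr_fun measurableSet_Ioi hc]
  refine ⟨hb.1, hb.2.trans ?_⟩
  rw [e5, barenblattMoment]
  congr 3
  · congr 1
    field_simp
  · rw [e3]; field_simp

lemma barenblatt_moment_energy (hn : 0 < n) (hp : 1 < p) (hα : 1 < α)
    (hδ : 0 < n * p - (n - p) * (α * (p - 1) + 1)) :
    IntegrableOn (fun t => barenblatt p α t ^ (α * p) * t ^ (n - 1)) (Set.Ioi 0) ∧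
    ∫ t in Set.Ioi (0 : ℝ), barenblatt p α t ^ (α * p) * t ^ (n - 1) =
      barenblattMoment n p α * ((n * p - (n - p) * (α * (p - 1) + 1)) /
        (p * (α * (p - 1) + 1))) := by
  have h1 : 0 < p - 1 := by linarith
  have h2 : 0 < α - 1 := by linarith
  have e3 : α * (p - 1) + 1 - p = (α - 1) * (p - 1) := by ring
  have h4 : 0 < α * (p - 1) + 1 := by positivity
  have hn0 : (0 : ℝ) < n := by exact_mod_cast hn
  have hpp : 0 < p / (p - 1) := by positivity
  have e5 : (α * (p - 1) + 1) / (α - 1) - n / (p / (p - 1)) =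
      (p - 1) / p * ((n * p - (n - p) * (α * (p - 1) + 1)) / (α * (p - 1) + 1 - p)) := by
    rw [e3]; field_simp; ring
  have e6 : α * p / (α - 1) = (α * (p - 1) + 1) / (α - 1) + 1 := by field_simp; ring
  have hlt : n / (p / (p - 1)) < (α * (p - 1) + 1) / (α - 1) := by
    rw [← sub_pos, e5, e3]
    positivity
  have hb := barenblatt_integral hn hpp (t := α * p / (α - 1)) (by rw [e6]; linarith)
  have hc : Set.EqOn (fun t => barenblatt p α t ^ (α * p) * t ^ (n - 1))
      (fun y : ℝ => (1 + y ^ (p / (p - 1))) ^ (-(α * p / (α - 1))) * y ^ (n - 1))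
      (Set.Ioi 0) := by
    intro t (ht : 0 < t)
    simp only [barenblatt_rpow ht]
  rw [integrableOn_congr_fun hc measurableSet_Ioi, setIntegral_congr_fun measurableSet_Ioi hc]
  refine ⟨hb.1, hb.2.trans ?_⟩
  have hd : 0 < (p - 1) / p *
      ((n * p - (n - p) * (α * (p - 1) + 1)) / (α * (p - 1) + 1 - p)) := by
    rw [e3]; positivity
  have e7 : (α * (p - 1) + 1) * (p - 1) / (α * (p - 1) + 1 - p) =
      (α * (p - 1) + 1) / (α - 1) := by
    rw [e3]; field_simp
  have hs : 0 < (α * (p - 1) + 1) / (α - 1) := by positivity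
  rw [e6, add_sub_right_comm, e5, Real.Gamma_add_one hd.ne', Real.Gamma_add_one hs.ne',
    barenblattMoment, e7]
  have e8 : (n : ℝ) / (p / (p - 1)) = n * (p - 1) / p := by field_simp
  have hg := (Gamma_pos_of_pos hs).ne'
  rw [e8]
  have e9 : (p - 1) / p * ((n * p - (n - p) * (α * (p - 1) + 1)) / (α * (p - 1) + 1 - p)) =
      (n * p - (n - p) * (α * (p - 1) + 1)) / (p * (α * (p - 1) + 1)) *
        ((α * (p - 1) + 1) / (α - 1)) := by
    rw [e3]; field_simp
  generalize Gamma ((p - 1) / p *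
    ((n * p - (n - p) * (α * (p - 1) + 1)) / (α * (p - 1) + 1 - p))) = g
  rw [e9]
  generalize (α * (p - 1) + 1) / (α - 1) = z at *
  generalize Gamma z = gz at *
  have := hs.ne'
  field_simp

lemma barenblatt_moment_cost (hn : 0 < n) (hp : 1 < p) (hα : 1 < α)
    (hδ : 0 < n * p - (n - p) * (α * (p - 1) + 1)) :
    IntegrableOn (fun t => barenblatt p α t ^ (α * p) * t ^ (n - 1) * t ^ (p / (p - 1)))
      (Set.Ioi 0) ∧
    ∫ t in Set.Ioi (0 : ℝ), barenblatt p α t ^ (α * p) * t ^ (n - 1) * t ^ (p / (p - 1)) =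
      barenblattMoment n p α * (n * (α * (p - 1) + 1 - p) / (p * (α * (p - 1) + 1))) := by
  have h1 : 0 < p - 1 := by linarith
  have h2 : 0 < α - 1 := by linarith
  have h4 : 0 < α * (p - 1) + 1 := by positivity
  obtain ⟨hB, hB'⟩ := barenblatt_moment_mass hn hp hα hδ
  obtain ⟨hA, hA'⟩ := barenblatt_moment_energy hn hp hα hδ
  have hc : Set.EqOn (fun t => barenblatt p α t ^ (α * p) * t ^ (n - 1) * t ^ (p / (p - 1)))
      (fun t => barenblatt p α t ^ (α * (p - 1) + 1) * t ^ (n - 1) -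
        barenblatt p α t ^ (α * p) * t ^ (n - 1)) (Set.Ioi 0) := by
    intro t (ht : 0 < t)
    have hX : 0 < 1 + t ^ (p / (p - 1)) := by positivity
    have e : -((α * (p - 1) + 1) / (α - 1)) = -(α * p / (α - 1)) + 1 := by field_simp; ring
    simp only [barenblatt_rpow ht, e, Real.rpow_add hX, Real.rpow_one]
    ring
  rw [integrableOn_congr_fun hc measurableSet_Ioi, setIntegral_congr_fun measurableSet_Ioi hc]
  refine ⟨hB.sub hA, ?_⟩
  rw [integral_sub hB hA, hB', hA']
  field_simp
  ring

end Barenblatt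

section SharpConstant

variable {n : ℕ} {p α : ℝ}

lemma sphereArea_eq (hn : 0 < n) : sphereArea n = n * (√π ^ n / Gamma (n / 2 + 1)) := by
  have : Nonempty (Fin n) := ⟨⟨0, hn⟩⟩
  rw [sphereArea, measureReal_def, EuclideanSpace.volume_ball, Fintype.card_fin,
    ENNReal.ofReal_one, one_pow, one_mul, ENNReal.toReal_ofReal]
  have := Gamma_pos_of_pos (by positivity : (0 : ℝ) < n / 2 + 1)
  positivity

lemma thetaGN_eq : thetaGN n p α =
    n * (α - 1) / (α * (n * p - (n - p) * (α * (p - 1) + 1))) := by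
  rw [thetaGN]
  congr 2
  ring

lemma thetaGN_pos (hn : 0 < n) (hα : 1 < α)
    (hδ : 0 < n * p - (n - p) * (α * (p - 1) + 1)) : 0 < thetaGN n p α := by
  have h2 : 0 < α - 1 := by linarith
  have hn0 : (0 : ℝ) < n := by exact_mod_cast hn
  rw [thetaGN_eq]
  positivity

lemma log_gagliardoNirenbergConst (hn : 0 < n) (hp : 1 < p) (hα : 1 < α)
    (hδ : 0 < n * p - (n - p) * (α * (p - 1) + 1)) :
    0 < gagliardoNirenbergConst n p α ∧
    log (gagliardoNirenbergConst n p α) =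
      thetaGN n p α * (log (α * (p - 1) + 1 - p) - log p) +
      thetaGN n p α / p * (log p + log (α * (p - 1) + 1) - log n - log (α * (p - 1) + 1 - p)) +
      1 / (α * p) * (log (n * p - (n - p) * (α * (p - 1) + 1)) - log p -
        log (α * (p - 1) + 1)) -
      thetaGN n p α / n * (log (sphereArea n) + log (barenblattMoment n p α)) := by
  have h1 : 0 < p - 1 := by linarith
  have h2 : 0 < α - 1 := by linarith
  have h3 : 0 < α * (p - 1) + 1 - p := by nlinarith [mul_pos h1 h2]
  have h4 : 0 < α * (p - 1) + 1 := by linarith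
  have hn0 : (0 : ℝ) < n := by exact_mod_cast hn
  have hω := sphereArea_pos hn
  have hB := barenblattMoment_pos hn hp hα hδ
  have hpi : 0 < √π := Real.sqrt_pos.2 Real.pi_pos
  have hg := Gamma_pos_of_pos (by positivity : (0 : ℝ) < n / 2 + 1)
  have e : Gamma ((α * (p - 1) + 1) * (p - 1) / (α * (p - 1) + 1 - p)) * Gamma ((n : ℝ) / 2 + 1) /
      (Gamma ((p - 1) / p * ((n * p - (n - p) * (α * (p - 1) + 1)) / (α * (p - 1) + 1 - p))) *
        Gamma ((n : ℝ) * (p - 1) / p + 1)) =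
      √π ^ n / (sphereArea n * barenblattMoment n p α) := by
    have g1 := Gamma_pos_of_pos (by positivity : 0 < n * (p - 1) / p + 1)
    have g2 := Gamma_pos_of_pos (by positivity : 0 < (p - 1) / p *
      ((n * p - (n - p) * (α * (p - 1) + 1)) / (α * (p - 1) + 1 - p)))
    have g3 := Gamma_pos_of_pos (by positivity :
      0 < (α * (p - 1) + 1) * (p - 1) / (α * (p - 1) + 1 - p))
    rw [sphereArea_eq hn, barenblattMoment]
    generalize Gamma ((n : ℝ) * (p - 1) / p + 1) = x1 at *
    generalize Gamma ((p - 1) / p * ((n * p - (n - p) * (α * (p - 1) + 1)) /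
      (α * (p - 1) + 1 - p))) = x2 at *
    generalize Gamma ((α * (p - 1) + 1) * (p - 1) / (α * (p - 1) + 1 - p)) = x3 at *
    generalize Gamma ((n : ℝ) / 2 + 1) = x4 at *
    field_simp
  simp only [gagliardoNirenbergConst]
  rw [e]
  generalize α * (p - 1) + 1 = q at *
  generalize (n : ℝ) * p - (n - p) * q = δ at *
  refine ⟨by positivity, ?_⟩
  rw [Real.log_mul (by positivity) (by positivity), Real.log_mul (by positivity) (by positivity),
    Real.log_mul (by positivity) (by positivity), Real.log_rpow (by positivity),
    Real.log_rpow (by positivity), Real.log_rpow (by positivity), Real.log_rpow (by positivity),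
    Real.log_div (by positivity) (by positivity), Real.log_div (by positivity) (by positivity),
    Real.log_div (by positivity) (by positivity), Real.log_div (by positivity) (by positivity),
    Real.log_mul (by positivity) (by positivity), Real.log_mul (by positivity) (by positivity),
    Real.log_mul (by positivity) (by positivity), Real.log_mul (by positivity) (by positivity),
    Real.log_pow]
  field_simp
  ring

/-- Optimising the transport inequality over the dilation parameter `l` yields the sharp
Gagliardo–Nirenberg inequality. -/
lemma gagliardoNirenberg_of_dilation (hn : 0 < n) (hp : 1 < p) (hα : 1 < α)
    (hδ : 0 < n * p - (n - p) * (α * (p - 1) + 1)) {a b e A B C : ℝ} (ha : 0 < a) (hb : 0 < b)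
    (he : 0 ≤ e) (hB : B = barenblattMoment n p α)
    (hA : A = B * ((n * p - (n - p) * (α * (p - 1) + 1)) / (p * (α * (p - 1) + 1))))
    (hC : C = B * (n * (α * (p - 1) + 1 - p) / (p * (α * (p - 1) + 1))))
    (H : ∀ l : ℝ, 0 < l → B ≤ (A / a) ^ (1 - (α - 1) / (α * p)) *
      ((1 - n * (α - 1) / (α * p)) * l ^ (n * (α - 1) / (α * p)) * b +
        l ^ (n * (α - 1) / (α * p) - 1) * ((α - 1) / (α * p)) *
          ((α * (p - 1) + 1) * (e ^ (1 / p) * (C / (A / a)) ^ (1 / (p / (p - 1))))))) :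
    (sphereArea n * a) ^ (1 / (α * p)) ≤ gagliardoNirenbergConst n p α *
      (sphereArea n * e) ^ (thetaGN n p α / p) *
      (sphereArea n * b) ^ ((1 - thetaGN n p α) / (α * (p - 1) + 1)) := by
  have h1 : 0 < p - 1 := by linarith
  have h2 : 0 < α - 1 := by linarith
  have h3 : 0 < α * (p - 1) + 1 - p := by nlinarith [mul_pos h1 h2]
  have h4 : 0 < α * (p - 1) + 1 := by linarith
  have hn0 : (0 : ℝ) < n := by exact_mod_cast hn
  have hω := sphereArea_pos hn
  have hB0 : 0 < B := by rw [hB]; exact barenblattMoment_pos hn hp hα hδ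
  obtain ⟨hGpos, hGlog⟩ := log_gagliardoNirenbergConst hn hp hα hδ
  rw [← hB] at hGlog
  have hθ := thetaGN_pos hn hα hδ
  have hθe : thetaGN n p α = _ := thetaGN_eq
  obtain ⟨q, hqe⟩ : ∃ q, q = α * (p - 1) + 1 := ⟨_, rfl⟩
  obtain ⟨δ, hδe⟩ : ∃ δ, δ = n * p - (n - p) * q := ⟨_, rfl⟩
  obtain ⟨m, hme⟩ : ∃ m, m = q - p := ⟨_, rfl⟩
  obtain ⟨θ, hθd⟩ : ∃ θ, θ = thetaGN n p α := ⟨_, rfl⟩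
  simp only [← hqe, ← hδe, ← hme, ← hθd] at H hδ h3 h4 hGlog hθe hA hC hθ ⊢
  have hA0 : 0 < A := by rw [hA]; positivity
  have hC0 : 0 < C := by rw [hC]; positivity
  obtain ⟨μ, hμ⟩ : ∃ μ, μ = A / a := ⟨_, rfl⟩
  have hμ0 : 0 < μ := by rw [hμ]; positivity
  have hk0 : 0 < (α - 1) / (α * p) := by positivity
  rw [← hμ] at H
  obtain ⟨k, hk⟩ : ∃ k, k = (α - 1) / (α * p) := ⟨_, rfl⟩
  have hκ : n * (α - 1) / (α * p) = n * k := by rw [hk]; ring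
  rw [hκ, ← hk] at H
  rw [← hk] at hk0
  have hnk : 0 < n * k := by positivity
  set l := (B / (b * μ ^ (1 - k))) ^ (1 / (n * k)) with hl
  have hl0 : 0 < l := by positivity
  have hlk : l ^ (n * k) = B / (b * μ ^ (1 - k)) := by
    rw [hl, ← Real.rpow_mul (by positivity), one_div_mul_cancel hnk.ne', Real.rpow_one]
  have Hl := H l hl0
  rw [Real.rpow_sub hl0, Real.rpow_one, hlk] at Hl
  have hμk : 0 < μ ^ (1 - k) := by positivity
  have e1 : μ ^ (1 - k) * ((1 - n * k) * (B / (b * μ ^ (1 - k))) * b +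
      B / (b * μ ^ (1 - k)) / l * k * (q * (e ^ (1 / p) * (C / μ) ^ (1 / (p / (p - 1)))))) =
      B - n * k * B + B * k / (b * l) * (q * (e ^ (1 / p) * (C / μ) ^ (1 / (p / (p - 1))))) := by
    field_simp
  rw [e1] at Hl
  have Hm : n * l * b ≤ q * (e ^ (1 / p) * (C / μ) ^ (1 / (p / (p - 1)))) := by
    have h5 : n * k * B ≤ B * k / (b * l) *
        (q * (e ^ (1 / p) * (C / μ) ^ (1 / (p / (p - 1))))) := by linarith
    have h6 := mul_le_mul_of_nonneg_left h5 (by positivity : 0 ≤ b * l / (B * k))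
    have h7 : b * l / (B * k) * (n * k * B) = n * l * b := by field_simp
    have h8 : ∀ z, b * l / (B * k) * (B * k / (b * l) * z) = z := by intro z; field_simp
    rwa [h7, h8] at h6
  have he0 : 0 < e := by
    rcases he.lt_or_eq with h | h
    · exact h
    · rw [← h, Real.zero_rpow (by positivity), zero_mul, mul_zero] at Hm
      have : 0 < n * l * b := by positivity
      linarith
  have Hlog := Real.log_le_log (by positivity) Hm
  rw [Real.log_mul (by positivity) (by positivity), Real.log_mul (by positivity) (by positivity),
    Real.log_mul (by positivity) (by positivity), Real.log_mul (by positivity) (by positivity),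
    hl, Real.log_rpow (by positivity), Real.log_rpow (by positivity), Real.log_rpow (by positivity),
    Real.log_div (by positivity) (by positivity), Real.log_div (by positivity) (by positivity),
    Real.log_mul (by positivity) (by positivity), Real.log_rpow (by positivity), hμ,
    Real.log_div (by positivity) (by positivity), hA, hC,
    Real.log_mul (by positivity) (by positivity), Real.log_mul (by positivity) (by positivity),
    Real.log_div (by positivity) (by positivity), Real.log_div (by positivity) (by positivity),
    Real.log_mul (by positivity) (by positivity), Real.log_mul (by positivity) (by positivity)]
    at Hlog
  rw [← Real.log_le_log_iff (by positivity) (by positivity),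
    Real.log_mul (by positivity) (by positivity), Real.log_mul (by positivity) (by positivity),
    Real.log_rpow (by positivity), Real.log_rpow (by positivity), Real.log_rpow (by positivity),
    Real.log_mul (by positivity) (by positivity), Real.log_mul (by positivity) (by positivity),
    Real.log_mul (by positivity) (by positivity), hGlog]
  generalize Real.log a = La at *
  generalize Real.log b = Lb at *
  generalize Real.log e = Le at *
  generalize Real.log B = LB at *
  generalize Real.log δ = Lδ at *
  generalize Real.log q = Lq at *
  generalize Real.log p = Lp at *
  generalize Real.log m = Lm at *
  generalize Real.log (sphereArea n) = Lω at *
  generalize Real.log n = Ln at *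
  have h9 := mul_le_mul_of_nonneg_left Hlog hθ.le
  rw [← sub_nonneg] at h9 ⊢
  refine h9.trans_eq ?_
  rw [hθe, hk]
  have hδ0 := hδ.ne'
  have hq0 := h4.ne'
  have hα0 : α ≠ 0 := by positivity
  have hp0 : p ≠ 0 := by positivity
  have hα1 : α - 1 ≠ 0 := h2.ne'
  have hn1 := hn0.ne'
  field_simp
  rw [hδe, hqe]
  ring

end SharpConstant

section ProfileInequality

variable {n : ℕ} {p α : ℝ} {φ : ℝ → ℝ} {K : NNReal}

/-- A nonnegative, nonincreasing profile, positive at the origin, is positive exactly on an initial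
interval. -/
lemma exists_first_zero (hφ : Continuous φ) (hφ0 : ∀ r, 0 ≤ φ r) (hanti : AntitoneOn φ (Set.Ici 0))
    {R : ℝ} (hR : 0 < R) (hφR : φ R = 0) (hpos : 0 < φ 0) :
    ∃ r₀, 0 < r₀ ∧ r₀ ≤ R ∧ (∀ r ∈ Set.Ico 0 r₀, 0 < φ r) ∧ ∀ r, r₀ ≤ r → φ r = 0 := by
  have hcl : IsClosed (Set.Ici 0 ∩ φ ⁻¹' {0}) :=
    isClosed_Ici.inter (isClosed_singleton.preimage hφ)
  have hbdd : BddBelow (Set.Ici 0 ∩ φ ⁻¹' {0}) := ⟨0, fun x hx => hx.1⟩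
  have hRm : R ∈ Set.Ici 0 ∩ φ ⁻¹' {0} := ⟨hR.le, hφR⟩
  have hmem := hcl.csInf_mem ⟨R, hRm⟩ hbdd
  refine ⟨sInf (Set.Ici 0 ∩ φ ⁻¹' {0}), lt_of_le_of_ne hmem.1 fun h => ?_, csInf_le hbdd hRm,
    fun r hr => lt_of_le_of_ne (hφ0 r) fun h => ?_, fun r hr => le_antisymm ?_ (hφ0 r)⟩
  · have h2 : φ (sInf (Set.Ici 0 ∩ φ ⁻¹' {0})) = 0 := hmem.2
    rw [← h] at h2
    exact hpos.ne' h2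
  · exact absurd (csInf_le hbdd ⟨hr.1, h.symm⟩) (not_le.2 hr.2)
  · have h2 : φ (sInf (Set.Ici 0 ∩ φ ⁻¹' {0})) = 0 := hmem.2
    exact (hanti hmem.1 (Set.mem_Ici.2 (le_trans (Set.mem_Ici.1 hmem.1) hr)) hr).trans_eq h2

lemma integral_eq_of_eq_zero {f : ℝ → ℝ} {r₀ : ℝ} (h0 : 0 ≤ r₀) (h1 : r₀ ≤ 1)
    (hf : ∀ r, r₀ < r → f r = 0) : ∫ r in (0 : ℝ)..1, f r = ∫ r in (0 : ℝ)..r₀, f r := by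
  rw [intervalIntegral.integral_of_le h0, intervalIntegral.integral_of_le zero_le_one]
  refine setIntegral_eq_of_subset_of_forall_sdiff_eq_zero measurableSet_Ioc
    (Set.Ioc_subset_Ioc_right h1) fun x hx => hf x ?_
  by_contra h
  exact hx.2 ⟨hx.1.1, not_lt.1 h⟩

lemma transport_inequality_limit (hφ : LipschitzWith K φ) (hφ0 : ∀ r, 0 ≤ φ r) {r₀ : ℝ}
    (hr₀ : 0 < r₀) (hr₁ : r₀ < 1) (hφp : ∀ r ∈ Set.Ico 0 r₀, 0 < φ r) (hφr : φ r₀ = 0)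
    (hn : 3 ≤ n) (hp : 2 * (n : ℝ) / (n - 1) ≤ p) (hp1 : 1 < p) (hα : 1 < α)
    (hκ : n * (α - 1) / (α * p) ≤ 1) (hδ : 0 < n * p - (n - p) * (α * (p - 1) + 1))
    (ha : 0 < ∫ r in (0 : ℝ)..r₀, φ r ^ (α * p) * hypWeight n r) {l : ℝ} (hl : 0 < l) :
    (∫ t in Set.Ioi (0 : ℝ), barenblatt p α t ^ (α * (p - 1) + 1) * t ^ (n - 1)) ≤
      ((∫ t in Set.Ioi (0 : ℝ), barenblatt p α t ^ (α * p) * t ^ (n - 1)) /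
        (∫ r in (0 : ℝ)..r₀, φ r ^ (α * p) * hypWeight n r)) ^ (1 - (α - 1) / (α * p)) *
      ((1 - n * (α - 1) / (α * p)) * l ^ (n * (α - 1) / (α * p)) *
          (∫ r in (0 : ℝ)..r₀, φ r ^ (α * (p - 1) + 1) * hypWeight n r) +
        l ^ (n * (α - 1) / (α * p) - 1) * ((α - 1) / (α * p)) *
          ((α * (p - 1) + 1) *
            ((∫ r in (0 : ℝ)..r₀, (|deriv φ r| / eqRadiusDeriv n r) ^ p * hypWeight n r) ^ (1 / p) *
            ((∫ t in Set.Ioi (0 : ℝ),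
                barenblatt p α t ^ (α * p) * t ^ (n - 1) * t ^ (p / (p - 1))) /
              ((∫ t in Set.Ioi (0 : ℝ), barenblatt p α t ^ (α * p) * t ^ (n - 1)) /
                (∫ r in (0 : ℝ)..r₀, φ r ^ (α * p) * hypWeight n r))) ^ (1 / (p / (p - 1)))))) := by
  have hnpos : 0 < n := by omega
  have hB := barenblatt_moment_mass hnpos hp1 hα hδ
  have hA := barenblatt_moment_energy hnpos hp1 hα hδ
  have hC := barenblatt_moment_cost hnpos hp1 hα hδ
  have hsub : Set.Ioc 0 r₀ ⊆ Set.Ioo (0 : ℝ) 1 := fun x hx => ⟨hx.1, hx.2.trans_lt hr₁⟩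
  have hApos : 0 < ∫ t in Set.Ioi (0 : ℝ), barenblatt p α t ^ (α * p) * t ^ (n - 1) := by
    have := barenblattMoment_pos hnpos hp1 hα hδ
    have h4 : 0 < α * (p - 1) + 1 := by nlinarith
    rw [hA.2]
    have : 0 < p := by linarith
    positivity
  have htB := intervalIntegral_tendsto_integral_Ioi 0 hB.1 Filter.tendsto_id
  have htA := intervalIntegral_tendsto_integral_Ioi 0 hA.1 Filter.tendsto_id
  have htC := intervalIntegral_tendsto_integral_Ioi 0 hC.1 Filter.tendsto_id
  have hp' : 0 ≤ 1 / (p / (p - 1)) := by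
    have : 0 < p - 1 := by linarith
    positivity
  have htμ := htA.div_const (∫ r in (0 : ℝ)..r₀, φ r ^ (α * p) * hypWeight n r)
  refine le_of_tendsto_of_tendsto htB ((htμ.rpow_const (Or.inl (by positivity))).mul
    (tendsto_const_nhds.add (tendsto_const_nhds.mul (tendsto_const_nhds.mul
      (tendsto_const_nhds.mul ((htC.div htμ (by positivity)).rpow_const (Or.inr hp')))))))
    ((Filter.eventually_gt_atTop 0).mono fun M hM => ?_)
  exact transport_inequality hφ hφp hφr hr₀ (R := eqRadius n) (fun r hr =>
    ⟨eqRadius_pos hnpos (hsub hr).1 (hsub hr).2, eqRadiusDeriv_pos hnpos (hsub hr).1 (hsub hr).2,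
      hasDerivAt_eqRadius hnpos (hsub hr).1 (hsub hr).2,
      eqRadius_pow_mul_deriv hnpos (hsub hr).1 (hsub hr).2⟩)
    ((continuousOn_eqRadiusDeriv hnpos).mono hsub)
    ((continuousOn_hypWeight n).mono fun x hx => ⟨by linarith [hx.1], hx.2.trans_lt hr₁⟩)
    (continuous_barenblatt hp1) (barenblatt_pos p α) (by omega) hp1 hα hκ hM hl
    (radial_hardy hφ hφ0 hr₀ hr₁ hφr hn hp).1

theorem profile_poincare_gagliardo_nirenberg (hn : 3 ≤ n) (hp : 2 * (n : ℝ) / (n - 1) ≤ p)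
    (hpn : p < n) (hα : 1 < α) (hα' : α ≤ n / (n - p)) (hφ : LipschitzWith K φ)
    (hφ0 : ∀ r, 0 ≤ φ r) (hanti : AntitoneOn φ (Set.Ici 0)) {R : ℝ} (hR : 0 < R) (hR1 : R < 1)
    (hφR : φ R = 0) (hpos : 0 < φ 0) :
    0 ≤ sphereArea n * (∫ r in (0 : ℝ)..1, ((1 - r ^ 2) / 2 * |deriv φ r|) ^ p * hypWeight n r) -
      ((n - 1) / p) ^ p * (sphereArea n * ∫ r in (0 : ℝ)..1, φ r ^ p * hypWeight n r) ∧
    (sphereArea n * ∫ r in (0 : ℝ)..1, φ r ^ (α * p) * hypWeight n r) ^ (1 / (α * p)) ≤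
      gagliardoNirenbergConst n p α *
        (sphereArea n * (∫ r in (0 : ℝ)..1, ((1 - r ^ 2) / 2 * |deriv φ r|) ^ p * hypWeight n r) -
          ((n - 1) / p) ^ p * (sphereArea n * ∫ r in (0 : ℝ)..1, φ r ^ p * hypWeight n r)) ^
            (thetaGN n p α / p) *
        (sphereArea n * ∫ r in (0 : ℝ)..1, φ r ^ (α * (p - 1) + 1) * hypWeight n r) ^
          ((1 - thetaGN n p α) / (α * (p - 1) + 1)) := by
  obtain ⟨r₀, hr₀, hrR, hφp, hφz⟩ := exists_first_zero hφ.continuous hφ0 hanti hR hφR hpos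
  have hr₁ := hrR.trans_lt hR1
  have hnpos : 0 < n := by omega
  have hn0 : (0 : ℝ) < n := by exact_mod_cast hnpos
  have hn1 : (0 : ℝ) < (n : ℝ) - 1 := by
    have : (3 : ℝ) ≤ n := by exact_mod_cast hn
    linarith
  have hp1 : 1 < p := lt_of_lt_of_le (by rw [lt_div_iff₀ hn1]; linarith) hp
  have hp0 : 0 < p := by linarith
  have hα0 : 0 < α := by linarith
  have hnp : 0 < (n : ℝ) - p := by linarith
  have hα2 : α * (n - p) ≤ n := (le_div_iff₀ hnp).1 hα'
  have hq0 : 0 < α * (p - 1) + 1 := by nlinarith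
  have hδ : 0 < n * p - (n - p) * (α * (p - 1) + 1) := by
    nlinarith [mul_le_mul_of_nonneg_right hα2 (by linarith : 0 ≤ p - 1)]
  have hκ : n * (α - 1) / (α * p) ≤ 1 := by
    rw [div_le_one (by positivity)]
    linarith
  have hω := sphereArea_pos hnpos
  have hwc : ContinuousOn (hypWeight n) (Set.Icc 0 r₀) := (continuousOn_hypWeight n).mono
    fun x hx => ⟨by linarith [hx.1], hx.2.trans_lt hr₁⟩
  have hinteg : ∀ s : ℝ, 0 < s → 0 < ∫ r in (0 : ℝ)..r₀, φ r ^ s * hypWeight n r := fun s hs => by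
    refine intervalIntegral.intervalIntegral_pos_of_pos_on ?_ (fun x hx => ?_) hr₀
    · refine ContinuousOn.intervalIntegrable ?_
      rw [Set.uIcc_of_le hr₀.le]
      exact (hφ.continuous.rpow_const fun _ => Or.inr hs.le).continuousOn.mul hwc
    · exact mul_pos (Real.rpow_pos_of_pos (hφp x ⟨hx.1.le, hx.2⟩) _)
        (hypWeight_pos n hx.1 (hx.2.trans hr₁))
  have hres : ∀ s : ℝ, 0 < s → ∫ r in (0 : ℝ)..1, φ r ^ s * hypWeight n r =
      ∫ r in (0 : ℝ)..r₀, φ r ^ s * hypWeight n r := fun s hs =>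
    integral_eq_of_eq_zero hr₀.le hr₁.le fun r hr => by
      rw [hφz r hr.le, Real.zero_rpow hs.ne', zero_mul]
  have hresd : ∫ r in (0 : ℝ)..1, ((1 - r ^ 2) / 2 * |deriv φ r|) ^ p * hypWeight n r =
      ∫ r in (0 : ℝ)..r₀, ((1 - r ^ 2) / 2 * |deriv φ r|) ^ p * hypWeight n r :=
    integral_eq_of_eq_zero hr₀.le hr₁.le fun r hr => by
      have : φ =ᶠ[nhds r] fun _ => 0 := (eventually_gt_nhds hr).mono fun x hx => hφz x hx.le
      rw [this.deriv_eq, deriv_const, abs_zero, mul_zero, Real.zero_rpow hp0.ne', zero_mul]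
  have hhardy := (radial_hardy hφ hφ0 hr₀ hr₁ (hφz r₀ le_rfl) hn hp).2
  have he : 0 ≤ ∫ r in (0 : ℝ)..r₀, (|deriv φ r| / eqRadiusDeriv n r) ^ p * hypWeight n r := by
    rw [intervalIntegral.integral_of_le hr₀.le]
    refine setIntegral_nonneg measurableSet_Ioc fun x hx => ?_
    have h1 := hypWeight_pos n hx.1 (hx.2.trans_lt hr₁)
    have h2 := eqRadiusDeriv_pos hnpos hx.1 (hx.2.trans_lt hr₁)
    positivity
  have hB := (barenblatt_moment_mass hnpos hp1 hα hδ).2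
  have hA := (barenblatt_moment_energy hnpos hp1 hα hδ).2
  have hC := (barenblatt_moment_cost hnpos hp1 hα hδ).2
  rw [← hB] at hA hC
  have key := gagliardoNirenberg_of_dilation hnpos hp1 hα hδ (hinteg _ (by positivity))
    (hinteg _ hq0) he hB hA hC fun l hl => transport_inequality_limit hφ hφ0 hr₀ hr₁ hφp
      (hφz r₀ le_rfl) hn hp hp1 hα hκ hδ (hinteg _ (by positivity)) hl
  rw [hres (α * p) (by positivity), hres p hp0, hres (α * (p - 1) + 1) hq0, hresd]
  have hbase := mul_le_mul_of_nonneg_left hhardy hω.le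
  refine ⟨by nlinarith [mul_nonneg hω.le he], key.trans ?_⟩
  have hG := (log_gagliardoNirenbergConst hnpos hp1 hα hδ).1
  have hθ := thetaGN_pos hnpos hα hδ
  have hb := hinteg _ hq0
  gcongr
  linarith

end ProfileInequality

/-- The Poincaré–Gagliardo–Nirenberg inequality in `ℍⁿ`, case `α > 1`. -/
theorem poincare_gagliardo_nirenberg_hyperbolic (n : ℕ) (hn : 4 ≤ n) (p : ℝ)
    (hp1 : 2 * (n : ℝ) / ((n : ℝ) - 1) ≤ p) (hp2 : p < n)
    (α : ℝ) (hα1 : 1 < α) (hα2 : α ≤ (n : ℝ) / ((n : ℝ) - p))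
    (u : EuclideanSpace ℝ (Fin n) → ℝ) (hu : ContDiff ℝ (⊤ : ℕ∞) u)
    (hsupp : tsupport u ⊆ Metric.ball (0 : EuclideanSpace ℝ (Fin n)) 1) :
    (∫ x in Metric.ball (0 : EuclideanSpace ℝ (Fin n)) 1,
        |u x| ^ (α * p) * (2 / (1 - ‖x‖ ^ 2)) ^ (n : ℝ)) ^ (1 / (α * p))
      ≤ gagliardoNirenbergConst n p α *
        ((∫ x in Metric.ball (0 : EuclideanSpace ℝ (Fin n)) 1,
            ((1 - ‖x‖ ^ 2) / 2) ^ p * ‖fderiv ℝ u x‖ ^ p * (2 / (1 - ‖x‖ ^ 2)) ^ (n : ℝ))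
          - (((n : ℝ) - 1) / p) ^ p *
            ∫ x in Metric.ball (0 : EuclideanSpace ℝ (Fin n)) 1,
              |u x| ^ p * (2 / (1 - ‖x‖ ^ 2)) ^ (n : ℝ)) ^ (thetaGN n p α / p) *
        (∫ x in Metric.ball (0 : EuclideanSpace ℝ (Fin n)) 1,
            |u x| ^ (α * (p - 1) + 1) * (2 / (1 - ‖x‖ ^ 2)) ^ (n : ℝ)) ^
          ((1 - thetaGN n p α) / (α * (p - 1) + 1)) := by
  have hn1 : (0 : ℝ) < (n : ℝ) - 1 := by
    have : (4 : ℝ) ≤ n := by exact_mod_cast hn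
    linarith
  have hn0 : 0 < n := by omega
  have hp : 2 < p := lt_of_lt_of_le (by rw [lt_div_iff₀ hn1]; linarith) hp1
  have hnp : 0 < (n : ℝ) - p := by linarith
  have hα' : α * (n - p) ≤ n := (le_div_iff₀ hnp).1 hα2
  have hq0 : 0 < α * (p - 1) + 1 := by nlinarith
  have hδ : 0 < n * p - (n - p) * (α * (p - 1) + 1) := by
    nlinarith [mul_le_mul_of_nonneg_right hα' (by linarith : 0 ≤ p - 1)]
  have hθ := thetaGN_pos hn0 hα1 hδ
  have hG := (log_gagliardoNirenbergConst hn0 (by linarith) hα1 hδ).1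
  have hω := sphereArea_pos hn0
  obtain ⟨φ, K, R, hR, hR1, hφ, hφ0, hφR, hanti, hmom, hen⟩ :=
    exists_profile_of_smooth hn0 hu hsupp hp
  have hE : ∫ x in Metric.ball (0 : EuclideanSpace ℝ (Fin n)) 1, ((1 - ‖x‖ ^ 2) / 2) ^ p *
      ‖fderiv ℝ u x‖ ^ p * (2 / (1 - ‖x‖ ^ 2)) ^ (n : ℝ) = hypEnergy p u := by
    rw [hypEnergy, integral_hypVolume]
    refine setIntegral_congr_fun measurableSet_ball fun x hx => ?_
    rw [hypGrad_rpow (mem_ball_zero_iff.1 hx)]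
  rw [hE, ← integral_hypVolume fun x => |u x| ^ (α * p), ← integral_hypVolume fun x => |u x| ^ p,
    ← integral_hypVolume fun x => |u x| ^ (α * (p - 1) + 1), hmom _ (by positivity),
    hmom _ (by positivity), hmom _ hq0]
  have hmom_nonneg : ∀ s : ℝ, 0 ≤ ∫ r in (0 : ℝ)..1, φ r ^ s * hypWeight n r := fun s => by
    rw [intervalIntegral.integral_of_le zero_le_one, integral_Ioc_eq_integral_Ioo]
    exact setIntegral_nonneg measurableSet_Ioo fun x hx =>
      mul_nonneg (Real.rpow_nonneg (hφ0 x) _) (hypWeight_pos n hx.1 hx.2).le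
  have hq1 := hmom_nonneg (α * (p - 1) + 1)
  rcases (hφ0 0).eq_or_lt with h0 | h0
  · have hzero : ∀ s : ℝ, 0 < s → ∫ r in (0 : ℝ)..1, φ r ^ s * hypWeight n r = 0 := fun s hs => by
      rw [intervalIntegral.integral_of_le zero_le_one]
      refine setIntegral_eq_zero_of_forall_eq_zero fun x hx => ?_
      have : φ x = 0 := le_antisymm
        ((hanti (Set.mem_Ici.2 le_rfl) (Set.mem_Ici.2 hx.1.le) hx.1.le).trans_eq h0.symm) (hφ0 x)
      rw [this, Real.zero_rpow hs.ne', zero_mul]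
    have hE0 : 0 ≤ hypEnergy p u := by
      refine le_trans (mul_nonneg hω.le ?_) hen
      rw [intervalIntegral.integral_of_le zero_le_one, integral_Ioc_eq_integral_Ioo]
      refine setIntegral_nonneg measurableSet_Ioo fun x hx => ?_
      have h1 := hypWeight_pos n hx.1 hx.2
      have h2 : 0 ≤ 1 - x ^ 2 := by nlinarith [hx.1, hx.2]
      positivity
    rw [hzero _ (by positivity), hzero p (by positivity), mul_zero, mul_zero, sub_zero,
      Real.zero_rpow (by positivity)]
    positivity
  · obtain ⟨hbase, hmain⟩ := profile_poincare_gagliardo_nirenberg (by omega) hp1 hp2 hα1 hα2 hφ hφ0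
      hanti hR hR1 (hφR R le_rfl) h0
    refine hmain.trans ?_
    gcongr
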